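/- A(18,6) ≤ 673. That is, every binary code of length 18 in which any two distinct codewords have Hamming distance at least 6 has at most 673 codewords. -/

import Mathlib

set_option autoImplicit false
set_option exponentiation.threshold 600

namespace CodeBound

/-- Packed integer factors of the positive semidefinite blocks of the first kind: entry
`[w][k][l][i][j]` is row `(i, j)` of the factor at position `(k, l)` of block `w`, encoded as
described at `unpackRow`. -/
def dataP : List (List (List (List (List ℕ)))) :=
  [[[[[33642432001, 0, 0, 381802394646074562, 6863798634767651070581891, 109302691030038407613948875023428,
  1447152918630330837770742940099898533061, 23393502046210381844039138639312408495330737350,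
  385250938261356088085514749983706111133335453144132935,
  10992324243696926455430010354398658825835846889317041381785032]], [[0, 0, 0, 30474691521,
  507213286636604354, 8056312050407809216502723, 137224557338818769373548610554820,
  1425180946098767412917272031324459484293, 22916107825015151474521238064468448993842973958]], [[0, 0, 0,
  29529455425, 365365404259519234, 6705683050943946500432643, 93104317159842873543717878012804,
  1845390410565936688340045757761132938053, 23075749129830209951918631360617269669239014470]], [[0, 0, 0,
  26767211201, 477143050358372994, 5210570433938771953435267, 84720047615046834891795134243460,
  1384694791998541541551429779569496636101]], [[0, 0, 0, 30584510913, 407104660970752386,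
  5603620826556082509418883, 81522234853975835548551605316100, 1389159027078513148430020500699472140869]],
  [[0, 0, 0, 26098526337, 321177439976437890, 5315958272408328592713795, 106606092266782786387327088171076]],
  [[0, 0, 0, 31839117569, 377318619841118338, 4952515389115871139895427, 81900164103160895379606946238724]]]],
  [[[[31451711041, 0, 0, 444282700602473602, 7772777441003874332167235, 102331677771124202599481555711044,
  1772258190973389928649510373019501044869, 27625289769809738221817832426836100092343551174,
  522191772472420674545555982191477019398526958309782919]], [[0, 0, 0, 29668543489, 454472022569163714,
  7753281098085425095410627, 100729622535122523788725648475140, 2332076938669728353804257548119832747077,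
  43382807732474534313822474644003405017976788102]], [[0, 0, 0, 33539437377, 458956452687258370,
  5523580495677131107013443, 92543278460055342477359229893444, 1422806422723276558266250741652407255941]],
  [[0, 0, 0, 30642602625, 349739182595568258, 9408325810910259422941763, 118088083991109600511858486186628,
  1527442266810565935056791189371276702597]], [[0, 0, 0, 29036714433, 482046773604041154,
  5015109262818681880916419, 87773861405443639119928164635076]], [[0, 0, 0, 26247106689, 373768609675276610,
  5597450821545492007663811, 84379322652742873711774098215300]], [[0, 0, 0, 32291444929, 352688930006968386,
  5111408538002168871954627]]]], [[[[27166602753, 0, 0, 464642944710405250, 8838529447812026989122627,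
  125799802946410868678290828110916, 2146843041730349278631473079852021834885,
  43992776494084403468100059555354510072775271622, 442629097187683237155611379443319110106096431643387271],
  [0, 0, 10562581040287935009214427308022664936162749480001720658799752,
  147178822749391387068343753414975927304184804137581044205449107868745,
  2095143219405248976799220806179291378267343720795861666192460259158243660874,
  31577123406071102349488725956462253651369448617603899661520646226948534977419404363,
  550713151947217514052011154110255421831560025194350854942107854425064535306283855957378188,
  10039958135966835191476490630504211634821988293819324999506768843940109652128729078044498499589389,
  219511517469745005366009750614517058087611653896715743683957966402813128336687189662867370973504951846286]],
  [[0, 0, 0, 30445396993, 453027366515301314, 7824104545515421143788483, 109091655189111380601918613478404,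
  2222504655297006349844808788192169907333], [0, 0, 45417017835453268630604139090412855534266309574,
  529540445354894580763558404189459935656918730182693831,
  12705783138642654200030926214345935710131317461657030578512776,
  137491585534092115509484443271182840069070290659145240583054791652297,
  2694844573446852707624398812519451545626147267246032634729799969450707495946,
  31628196126814041753671801529609465876591030423684189169741314897050092826046798987]], [[0, 0, 0,
  28838366017, 494074821708546818, 8719786817432033863340803, 145526783488367794709979514616644,
  1821685340432514384376882717360792292357], [0, 0, 39843743060408425251655987535162076209803227974,
  537673063958744244757125192015767084384607337802431239,
  8010629943833330010101307898913066020388298058352831280040712,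
  116503428179442893908225676381140549617585091921307039483049430090569,
  1866457727713060498877837461376317829784424642893887317096334766095925021642,
  31266123843469681130660860299751898955979282461798089100417034636918756755305157643]], [[0, 0, 0,
  28506325633, 490216703286397506, 7429820174357029091123843, 114328053859739979897619547929220], [0, 0,
  2187516803723800037374326276266469937733, 27498581885781554456495628047930956814338648710,
  412708092063178934581331580348581261914967780844008007,
  6813390557327344280276471689462115807996189004829545827729992,
  110026707494600414526009488739216355201508451112207978053965080904329]], [[0, 0, 0, 34059581825,
  440896735484537218, 5968655618821420503361923, 99940490215435163356308354091588], [0, 0,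
  1414429748341443516419861808435824982597, 25606557182885035858604719135974674859753730438,
  405415603760326370381165491366354520944986935020351815,
  6998753533287267030205359591615141045668678403080736818772296,
  109286680045587532265678756011935372080911503705721598028055446731337]], [[0, 0, 0, 31710654721,
  472191933899858050, 4976930130675110174728451], [0, 0, 0, 85294025062504344279572270182788,
  1583530561515717961276515520318168027333, 23230000583072054610755285396988691242640482630]], [[0, 0, 0,
  29164886209, 503008980479107138, 4986417333961880101169411], [0, 0, 0, 84657723763652069257387072094404,
  1393732304494177039877226203481661603909, 23764594992645909487559603557273828785009576198]]]],
  [[[[30320104961, 0, 0, 443817165226013826, 8449825441978440398918723, 128673767897670153519445470260292,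
  1982587666132843787543844101292511851653, 31760434061964956876459874170598662380423406790], [0, 0,
  597871899367559002353022502881749847110634537724738631,
  10995106627633087942110735976076194830960768526803668542581768,
  129750986551031341564377208065987181117898870492565182702721323895753,
  2202329460422921742873960635877082552156225469860750088190097442627543219210,
  32413395579417404892830884356858443049915436007585385074712579752030696586955076747,
  590717865661174631719135729255252097271272264845566308720999861006708753155089752623080716]], [[0, 0, 0,
  28477787137, 459728303787649986, 7667022967286043242589123, 109631184167867982561556809634820,
  2162269815630227280582001613420034022597], [0, 0, 34622831000874375433573539043675680015256890310,
  562707945052691636648836234549441071787929122376811399,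
  10965498123539167003658863661281607074612771747094121497609096,
  162281856459024515486641691036012415334769741232954932038411482155913,
  1906113022374681473037550604892564440940531117251915371397376466654843835402,
  31821253065396825537863340410872462749839531661635197080403898705166092472365261963]], [[0, 0, 0,
  26964837185, 431409122315436802, 5531461409415530634269443, 113196800911406052441042262094596], [0, 0,
  2221469131161764000769925635820017449733, 26931851292275780451218342287011760731335828230,
  478044152290723902166280765136335503029371862462442183,
  7756338269383933954426601018325735872316056071998040655133384,
  115661480079024817686035366413882317489104590538106309909442702494601]], [[0, 0, 0, 30942143105,
  410339452831234690, 5210982563465095692501635, 91390164321207696515553594714820], [0, 0,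
  1541327068724690880756105030535042587269, 26688592953475223034413364405906467353124583942,
  423202951990060199984065653121213825703157035447226823,
  6742033717917715381790768944251332344128519807140669935319560,
  113203122623428469985148889506696916013201053027856835460860932792905]], [[0, 0, 0, 28162083137,
  363340384068188546, 7795466424856329287539075], [0, 0, 115463160926556266082253460275588,
  1406845790130681850578076723083708805509, 29814579113414750360455189061236354353336072390,
  417994972880261420498356474554037735442537787095904519]], [[0, 0, 0, 30646436033, 420431263902916930,
  5210058487844453601995139], [0, 0, 0, 85769654758746966917029970118852,
  1659527438813171198162770410638248847493, 23330922982374305252707511044153319802909118790]], [[0, 0, 0,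
  31415392385, 342909091862538306], [0, 0, 0, 5432313940488601552982083, 87048805628598912305837037604868]]],
  [[[], [0, 0, 31720113217, 470101168848311298, 7212377050611749263037443, 96102966560398003284053806398532,
  1872798965187923167720741293966114643077, 37280577703080919866830058629502158908885769478]], [[], [0, 0,
  26209946561, 463304715507798914, 6934532194085003457969027, 141281569993817561282964312224644,
  1552769344571631952890073016997392391173, 23064389173804824688049102842690072226229367942]], [[], [0, 0,
  32422961921, 332156273234387714, 6561115810541295970757379, 91895440523487965208159685305028,
  1378330180172162910293587762786237375237]], [[], [0, 0, 31000318337, 339151366417461634,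
  5837022869488818830397827, 86274145891290535799657042407812, 1674563513316095763819036660779825119685]],
  [[], [0, 0, 28445772289, 323024771423363330, 5551589468864884437170371, 82783753781797843660667098739140]],
  [[], [0, 0, 0, 27275476993, 345974261070510082, 5371664996806961941086339]]]], [[[[26026638849, 0, 0,
  450751169581778050, 8281473549757522098691139, 128036209250475262090854826923076,
  2237488674188706633401332689442743676037, 40146376910954147751736900608861662560598117702], [0, 0,
  693812497698728015226958162227826730333782105755773959,
  7704908374488241585407668962022619243146036558807110021254152,
  166462424668735328279702023679759746615791763248624315042614615344073,
  2314823218417254455962599676331730763790449490905477887303481241657428603914,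
  34470304710498963990818686703650139897439948369003383916940497525702344713551410315,
  651301528726723504020069705394614520511021432241143843398537583508674946923260819934723340], [0,
  14666207355493016873529537105389048341828327290848163467532712139179787868292473015509115578530893,
  215377295859845598640654879961408714020905938748647119486707452025579146734228195254965533410417512315918,
  2830576262167038641752018477970602736890217589736098636703385240536538570325176857351892416866675433388566375439,
  41916863907006925669117802606807330563350471775018101963165568616005866231898508144850935011974471388805691890437530704,
  714129880675183013583143141049536923484798905499043924935957992860879884987064511440612087920505594391579490466523690030058641,
  11505567313932247315464435397604116451509811636386580698936289744837600793742812151720933900508438880099239723528275939678585269445906,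
  269916568790494900410966229576933119938217024541749873806531631758131875356966239209784311692297822335264905548025371474427412239616181005651]],
  [[0, 0, 0, 27798909953, 476958995975011266, 6677130344550356929770435, 129012480179858131978290617543620],
  [0, 0, 2042561219779735039909478216120256801669, 35877055633808348311800144422493021445865720646,
  464610492766430576359578552093232325533568269749795655,
  9589881825192455790919935890400919014985498740963908715778952,
  170982239443893775489302396228766328219847544718098213315197235155977], [0,
  2411046482948253551961079215421369647752756122789145016644835928012613852170,
  35628935536908550521970438483267042521444936767258813135788691762350388966223719371,
  780703425648210689000536696834754681576245641136955294037444403668036932709976029136173964,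
  9522495096079927669664170688361732253915164673486373455733547865666304676192322730464772149564365,
  147457583629919913514851234090330613565960301319306788447408941112883064508296553505097677099194179488846,
  2414648529546582832269010569364558936997428762535366570049091685821889489938494599801692391718677495894250390671]],
  [[0, 0, 0, 27921279809, 488712574022400770, 8033521057416350910745411, 118995888784801819615698420679556],
  [0, 0, 2004173102950806626813384702278232466117, 28027976905940698724041396717140417118057847430,
  572536490333482791224217757497144215989692042694589063,
  9316225497074877872638744176558669655114679969916174137621128,
  117912055105123735396552946342515195701358967135496255899204288310153], [0,
  1969896528130796987535034004509667971253136338249776607611887060148881515402,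
  34025767886610437424372096509573647265303831591185780899844579443618224282069717835,
  537466765311617613635078519869615245021853642898874988857353907766707907435329424266732300,
  8813321251511461379893526833797967250237041823467990581187667015894981552485156809676583980131085,
  144808104974238757654058028358906001737689934528603947869889397295302701815378065389936737036911647337294,
  2426861403349440357772280558759874002246851657991937492304680885177873870141603488118534843900798022854110227407]],
  [[0, 0, 0, 27135990337, 337005775481381442, 7345721362663978494210563], [0, 0,
  92615831908764942439220308775492, 2083987370869090620862497209615227384197,
  23791325116925959798894478448029743800389173766, 391715392095353754985854454388958139858668753474196039],
  [0, 0, 7289133043811284359472243852612910909906247031244571016639048,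
  115536255413690364627751689900359477677952588851709143681138716400201,
  1865531588845501445743869698741816131681563210316740267969725125412851030538,
  32861279323763389046721624771548106480844911757041005592305561057836455430155108811]], [[0, 0, 0,
  29783742913, 319605735695335874, 6400931252774563248398915], [0, 0, 83999322703542240692128592202244,
  1406916199557542865337822251691021132165, 24129206214528079748142163855517781149003913606,
  386619363624000172192044376302902715800707571307166215], [0, 0,
  6530805988804619456715348969431115542452185468849369254371912,
  108623593191394016979150479580470331523733204436760491037768238926281,
  1835969672249334226654607318659466923986883367106775569479686930358330282442,
  30656565339426071352386494127810771113580330903988876317120650335266147433492716107]], [[0, 0, 0,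
  28955293953, 410346949926283458], [0, 0, 0, 5521130491660634100496515, 86444420253613136599554514921604],
  [0, 0, 0, 1507758072704224985384772841013388378245, 23537985993349380470356541487528065598946797830]], [[0,
  0, 0, 33429154049, 313148062195634434], [0, 0, 0, 4918039464796278095122627,
  82288867658347758948407541217476], [0, 0, 0, 1385169074077300816544697369485918734597,
  23346975999722223760349894283399616953702693126]]], [[[], [0, 0, 32443405313, 540147245419215810,
  7271477629008093346237379, 101407162422429518089565859427332, 2423761452954644504166925089126501977157,
  32030461726616706372451398226006495169744678150]], [[], [0, 0, 26805592961, 474387207461014338,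
  5877035130875025099701123, 87231054276052841877395545334660, 1435147360074686668420325263546316061637]],
  [[], [0, 0, 28354794177, 323777750927073986, 5057828996552068957696643, 84129520475834556189672729440900,
  1508511433065111217153699362269548055237]], [[], [0, 0, 27970691329, 478307410239037634,
  8742933300816301320566979, 147161250910653444064656646408388]], [[], [0, 0, 33372064129, 366266461704183938,
  5330595133579174829226179, 83291241225755031533360288108996]], [[], [0, 0, 0, 24112861185,
  343852379307610114]]], [[[], [0, 0, 26492075009, 494029945141148610, 6645491423281731683791811,
  90081770681921585715556301589508, 1439382842395619097543214328902075530309,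
  24169046452502277913768968639313369315175572550]], [[], [0, 0, 33445870401, 482287496079979330,
  5624338429618832902331203, 82841987407206275208776785255236, 1369685318997737875251584875744355615621]],
  [[], [0, 0, 28702724673, 432789512723356354, 5767356764301824698024579, 83177623438837914829231896914500,
  1364932094844649325057029530693024164741]], [[], [0, 0, 27480150337, 304811347986145602,
  4982959896132126587984195, 86561037752004306579436712085828]], [[], [0, 0, 29920354561, 306500280970942594,
  5049338767578308236769411, 85961912868273319712474111441156]]]], [[[[29598510529, 0, 0, 434725581619477634,
  8033900926631961396956227, 155766027546054238299277770026052, 1809045839482426638939476821050021870789], [0,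
  0, 34313843542572948536259126987772964731394923526, 594717561932651226122765110396737689580044538646311879,
  10920445873726952464834310425387520104069134098436775192959944,
  190095214750095632583463019105087071514638455689225244548278784809993,
  3223790113805631487201344861658760803259871964819541996518337231504227003530], [0,
  55268048400591082716792423873062731194507851126427436683460848713640529033081392139,
  613960995436444871179197992543538412091811388517364162487050101781729372537013417468902412,
  9947685535857968852842563139762648973186056936466960438674907610256996420771890636294686731221965,
  152092931122201602566991021544100566535232938009328881971698802353025182603209000366136608521774317997070,
  2458072189394029922527268008679562169038680695758185569686890755073919913648331112191146829154602393891660747855,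
  41937463995311969038301516713316442155323632947986682743993068993028877690040749896545635365625117366298322760989517008]],
  [[0, 0, 0, 29092019201, 376406357791910850, 7861989606969221525900163, 129927530690320774653677396909060],
  [0, 0, 2096679245754762478361681650253256844101, 35846814237482682892792594152579891888912976646,
  545814626340367283028938265039164224067693492551998215,
  7011084818306430089407727934189322528845799902966746210034568,
  114219067936165473150941823329708386413747235207755651911017565465609], [0,
  2103519099921652750892675245432075568746786729470090439328372104611792946122,
  37099473033814906268301443559655268887609100779621577164539738287306738926145266507,
  587758335286731199121897471805946036966165587535394332523214321041724012232589493241543500,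
  9615082375410676021814570486932643537917483182209722979843736020839514715765726813716132337765197,
  155010178037870613060523669703648703168383593394809637244968299671179516503159130394196882545176074314638,
  2423977910182060164026388862018907692267689376329755283500892068469717560201809113159833010709465336873823644751]],
  [[0, 0, 0, 32448543489, 311842483936998210, 7555112148323759805313795], [0, 0,
  109898054034728032706635897756292, 1552779008734448850303138452352905597637,
  31578224171869721205654926431953317606780224134, 410127396364493096250363325898926507192928073644843783],
  [0, 7244654617877445875865288444515423866789761773880455650472712,
  119228266325651614575745146423853037608712562756941290129099062985417,
  1912913602484326915826214538412224373752764531500600827786495491261383180938,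
  33166239945922167625214358302926091011409298407666378404970330414248936361508698699,
  529535813449853774963933553451343302226049592387664573794514763036357819256958427814413068]], [[0, 0, 0,
  26994092545, 521424214157629954, 7129981642764714081630851], [0, 0, 102918661874608777572713507865092,
  1749389275274487920964901484117519985029, 26630186682297836570673088328989834623643152838,
  467154415796723926773527976682628339551335716701450695], [0, 0,
  7039966822237021128222356109511268108618304637773177162320392,
  118477967364416851990035928742582687449571135834098941482740145422793,
  1843147709769189533134666427317429070696915767807624323401859837959299867146,
  32889825770979710727037090586375179701698738726751798203626264843777849581087642059]], [[0, 0, 0,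
  27790041537, 316669067417469378], [0, 0, 5276451026182941546041731, 95202449848166181800515810859332,
  1407441266644003609269516851450619779525], [0, 0, 25179698739206185438045283172403897622001488198,
  387452921704813646063823706923246452111226057089517959,
  7124347647930306268445485135436519305257864181420270288814344]], [[0, 0, 0, 29178544385,
  495437442750451970], [0, 0, 0, 9384203392671827983079427, 86934664270138481070541735520388], [0, 0, 0,
  1425395259493884069391291034438590648517, 23496218435556198620958584060280818544875944198]], [[0, 0, 0,
  29727723649], [0, 0, 0, 322388635727880194], [0, 0, 0, 5316941642180130570989571]]], [[[], [0, 0,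
  26237502465, 463553679096599490, 6406900018888827948649411, 123327115095368121197154653479876,
  2102422976620118887312775809619054425157], [0, 37258840308702309907878690522255876088428725254,
  587548449423805366414105674443015378768701039283106759,
  8300624859031783659301651372527506087378582494485755227481032,
  145818725690164858000396070880637826306156117869912348049268477109193,
  1872583892991201401328895298305098818045496662773539141458176427713289579594,
  30450759434584445956004584494327206935051402567127626649001672761743092397232118987]], [[], [0, 0,
  31486526273, 319367441396740930, 5148005288281895998559043, 120261828290129621715884366342980,
  1872689864607986831271693487921472895941], [0, 43892138719108177380285884570418711479653149510,
  461141442762026251413476386554044142556621420829731655,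
  6715634276218250284322736505990040062388795165909353800317768,
  110534307478026425966034987753782845971980282497039001741045044353865,
  1881748748091680700377775815227229312814339325724517283201708290132264608586,
  30795682276500808877951757977756531865652507503138046701086129229307846809983970251]], [[], [0, 0,
  33665579457, 487370340095408642, 5961481423536436984496579, 112541375598630622946970023727684], [0,
  1489068063589725969451414705771362978629, 40143436517839691441505412869103447185911646726,
  396864949620416694605080943757812051767621351229891207,
  6508810869683476958523476028631665851432332136584763120151176,
  108526906970686772480889109702642518192414836678833327758366691154633]], [[], [0, 0, 29803790849,
  326631095659688258, 6395764321974312599165187, 91286370765083076791939455046084], [0, 0,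
  1432789251774000401460237070171619234245, 23316876042722616267819755582236149302449988038,
  388167459145495695979484499041139552513317184573862343,
  6465491028138012933723566599254069364789225925327669753371272]], [[], [0, 0, 27264329857,
  477103474104522818, 7828718455428954294526019], [0, 0, 96199694703934428185312346589380,
  1502152653497001009106093303546036076613, 27640329425051941811195394758437029037992306758]], [[], [0, 0, 0,
  23292139521, 449665094125539330], [0, 0, 0, 5325902890454943778607107, 95488596591829878906645282990148]]],
  [[[], [0, 0, 30873762753, 458447105897192322, 5535269967552145195176899, 95349283356263993090525438219204,
  1424734885934151714964226343401697723397]], [[], [0, 0, 28193743681, 321271382156608322,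
  6549168598413465387932483, 99397259351545020282167151307588, 1369007714250106623162660218281231104965]],
  [[], [0, 0, 26681905857, 317830736983165506, 4986005922408592150106755, 82947829622700920114005748693508]],
  [[], [0, 0, 28813332673, 495303135995996290, 5127231296883829591781571, 89997490958575134201626445607236]],
  [[], [0, 0, 28432234625, 321492637751021570, 5337900601852321662148611]]]], [[[[26223934849, 0, 0,
  405537816444867714, 8920388150344321607908419, 140980629715546903858770073572484,
  2219794991884487513423209495218567607493], [0, 0, 30429803606190923653562744228661329485761803270,
  583830289271912494697478918363160517157939787752205255,
  8322633079676974429526355848327909712417293592198552818465736,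
  159732478447397034262390422744150236445499674916992896055347858863113,
  1953606516116137735140482769098436494419830909141017758467254965422626940106], [0,
  44271109992871831867138631960821799638012249171899698277189374471796178566604311563,
  665773485522819358676999229079673863222523047143618505581490186771213334189985369584552908,
  9711550233008873207079520752903199880826064415116138700307806786443904599019559727909069507220429,
  171885775050949739876638491793699856971781614275916508452417091012152674213014221124638334269077871213518,
  2603823495964386397127629050649006338540247906017143908096813792146877874651055598392040050331411855882102514703,
  43978711521213883715863835427719292447833093828949108846959678105722859588026544484093497267300651513542223589389632720],
  [753740380127862025600522603102736939521823240537188693405613875207967151276983415735809067081177168427013962212480031621666001,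
  14479504957209179948310703121352151936890452831694226036903890309329056236381025378523251828832459165143641414190402543628718745652242,
  207864623855320067196009243964754575379813665525952510296732325826538799381132388481431976185139939407798450073416221957529859051234680818707,
  3301493174650922457237770111789526783221998892966176532042311969107905972073663924750851624272295820938967440880681064841417547449959102304378063956,
  53847815698908731557854113014042657579411350074320816113493658476062213594162418614256897271964324432412478435758563190435817941145563669798100466274772053,
  903534745934305788358409741246806426257806913893093899856127500813442549302837731643828218161974583748597759203312277861165583792807861877197322746803825729025238,
  22560187434339368136115806757067553061813574338533444467408893706437567303590483038944177989952381021842129080943825863278920861792872775914212159497054575401175495869655]],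
  [[0, 0, 0, 30680738753, 442863850640210882, 9239961958351924391996355], [0, 0,
  100182730619549839788627316388676, 2069200340409265118066203587933869773573,
  38346530054896758028234450151635254633114637062, 476064380418208050916600982950085880362958685578091335],
  [0, 9869134545436380626899712371235925114003293058735331250430856,
  151186703382783826236147231388642876975269815598940195113007988128521,
  2256045782588861129109365802219918273186459196421826683912118907918098950922,
  33735999086317467317021214287939417309192636859022004157703714806580813162821055243,
  534323886440850753784300553495224628494916225359579166073713350336558533987826930516022220], [0,
  10050243037687235448040153264492678708557504243249328458562318362627585742169843133897344445463501,
  151769304877200310899878195457940764656572384730362620204207030278281853036565320078391322588551195737038,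
  2487916069843745078394264222873525563090572434240568283004812789511676766004904790274726791181868562666385341391,
  41160727236138803233630970078718793148629682863162275752752615328393615800629674534835936584317934945170605711641611280,
  682228765091128451931951048266690950550716657573477580664075853670420424232550493803419113386571001353956173095797467493016593]],
  [[0, 0, 0, 28388117249, 475498425901685570, 6173072093011337277242243], [0, 0,
  138335372180606257717079329993348, 2165229115661502336309557348826763604485,
  25038234114188933730936421423033609300106340998, 404400221154309446471416566883756678787878308180921095],
  [0, 6713189809435955479534345475536542812938754879071014879312712,
  114195169303606662668804234637380632872868750305642758883384304141001,
  1961433965635449047615734458566952186934977972349238748630085964558132912714,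
  31112811588210705793097419751994183236795647741410123026531748713603252025933122251,
  518627242095876884415666870174074071841892069087928081574469388050207192838513495748365132], [0,
  8639931750535386025233740257707623650255732834152252276478094698966037470067067141358413332132813,
  149753888914284863616146586898880166130416800504353815536294539498858276477749464183011896054212292389646,
  2432653927212415303673307453364319623176487765706715920412378678089013740298228777075725150623418844000693455631,
  40755942760142123387876324820743655993829546217622114659439031099342382888267078950693243366717942327302721091552162576,
  690935545076109977317423778354259627822769372174601483379999881212187673564885984642172556761183793178262357955257948735538001]],
  [[0, 0, 0, 30328455681, 440126759744225858], [0, 0, 5601934525779034459636227,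
  85404705297255856751959703435780, 1438044993412545816446488260918184778245], [0, 0,
  24753267785154279475002137904365231055529851398, 395959912115030003466937054654723232446769546326413831,
  6579727102277168616490762930019416424309443613698757277370888], [0, 0,
  110502579408469467630800309492561645285876906696302209990945860579913,
  1865928859146950038597785401309256044736118967722426502281872685134940197386,
  30830340320774398524064015602098138325364772615165950298806058647413060900287765067]], [[0, 0, 0,
  33214679489, 339569292524821058], [0, 0, 5003498590371797307087299, 84368945483510806322099320564100,
  1394596498959065843498907458999361128901], [0, 0, 23537275514006863273924667731482804938509666694,
  388877794442310266783814011042471778351253830794322311,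
  6501772863538074267219536393063636405591653630514574670971336], [0, 0,
  109237546369330376824524139841187246730688980138028287563678234864201,
  1831657374540712311466439333051639419813420671539214096770590844772506249674,
  30484458493420089250199311636706292578015452758285381202855549651459573380910918283]], [[0, 0, 0,
  32065880193], [0, 0, 0, 437451748194578498], [0, 0, 0, 7307188776127820118882307], [0, 0, 0,
  114950415288456353593309341563012]], [[0, 0, 0, 27187167489], [0, 0, 0, 321325299515600962], [0, 0, 0,
  5243080887385516568664131], [0, 0, 0, 85335582954258516728256045148420]]], [[[], [0, 0, 29214591937,
  438344426479516546, 6081994642212233169195907, 94739926035666278388111705504708,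
  2281318633403776991810639519682789495941], [0, 40721452656021143597370567755659185381706210182,
  495581772846164116155009821453987942847979011216456583,
  7336151683535339716154345548738577412601346943262544248863624,
  116488643881608419531668702309580120294446350381205013207226656633737,
  1853899336218128528530014944376006242823229272356307274594275149933180638218,
  30739244641368233412134637779279223277271019032365948080794809962598129047713997899]], [[], [0, 0,
  26690188033, 326777357034822402, 5031096742758474275926787, 123186093214209965554486914562820], [0,
  1652937701067176870993469098353586711237, 23917809292057613076327201882160133853925792518,
  389829507374648411047149394129135831171536237564646151,
  6533225815851143730476639975062995482065655115490462600559368,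
  113748864510521946905788164888425593902470440585825291293386007458569]], [[], [0, 0, 32488292801,
  492643166547685826, 6184641304104574581311939, 85149457488725544530242191325828], [0,
  1411183780060720828176381141013137130117, 25237892623131291335715592725918099056730560966,
  413583704769613745921036759580202217341945466393260487,
  6765223457019404734274657343024915179146268001839201272988104,
  109377118650614959252151556987638482105469389663777855992553151742601]], [[], [0, 0, 26279147841,
  535924218962196610, 6315194222907259765000451], [0, 0, 88070105269738160155748911976772,
  1816794204474807221111882887027584178309, 24408245980050654337744138766092977806437161222]], [[], [0, 0,
  33462560897, 351913263406930050, 5420044077211250973520003], [0, 0, 92205647711273166899224888881284,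
  1410248191603632335170070670879777718405, 25370295044451517977407734764854629455701909638]], [[], [0, 0, 0,
  22413180929], [0, 0, 0, 323592331860340738]]], [[[], [0, 0, 27497888705, 482196279468657538,
  6067347372100871982388099, 88432980727904652800119993236356, 1434566150904866997674288813108629803973], [0,
  28110627017350125013601374684165732790289353670, 527023924806158182102925924408804157979036192161262407,
  6623581881265058856755326391624388790318580495562510310136712,
  109073022207629018276533685667481274589706983692272484588683385893769,
  1846040183221877243641363831469461805852144421918047198881118539567495039946,
  30800643224653606845328277875114847706100472176718185383701197145461038799453264907]], [[], [0, 0,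
  28745986817, 368607940127615682, 5926151321027807437269699, 84492701134938458001646369219268], [0,
  1723955583433443660306197720109424622277, 23552694737850191813107062876519229626783644358,
  386492441578643312197930265525086606582772193658401543,
  6456089940498118621484798143372736089539471287237856113482504,
  108457680101394249617066408794101467953077344600996592219700729762569]], [[], [0, 0, 29703487873,
  502168778858131970, 5453761135072097431146883, 82043126921291827923783387310788], [0,
  1372408190439164098036010620644586062533, 25960935407418187064297701389226856176927095174,
  387193642729538205470867986888424049810155820729276935,
  6662164622573723917037038705019731469640264225012820101777800,
  108319419093342502161609997032122956571259172646395126918929970387657]], [[], [0, 0, 28564881473,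
  447613500225802306, 5748393123252470022578243], [0, 0, 107137970323748210232552975300676,
  1928696097030569308247204772857626812421, 28889100399908309636537580301589870979705262150]], [[], [0, 0,
  29294717057, 349785780663617538, 5445402394405307114610819], [0, 0, 88852038390573069321436442740868,
  1450984839792073879047708221192127199237, 24582462263177765527503214725376229668261789830]]]],
  [[[[26704006401, 0, 0, 438077614887492738, 7816789128865594091549763, 140707048251742024619322992927812],
  [0, 0, 1769125948641848065240935608640748714949, 34436348514317586942008725266988033528788439942,
  455360096450532297923218376874898184604884361592880071,
  9366109034506668847828708452373539733637048215229596714361864], [0,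
  148032345750696592530755532945525939839226127714768878296464034061257,
  2228958355013601045614669552924306450853810820314318136866364095928730516362,
  36514979342370817070302727899394749855231483315635134060213220725996149151370785675,
  993606575395895064023414097004738765930920014024580776103363708707530262884542309805253452,
  10089242367249027582849715267369110937949410016851349765539890260558266411034743372866165734075405],
  [205466888365579319534871474087541512602141646274220406919550824664769622572176600481470412448982316491790,
  3002110187515446874640103931347976473472811975701558165117660878162896272581795828905109010776339769364684100559,
  44219981474506931488781082506903706818261529184811841081965040088373026601578432319767510038974717289769486145597092816,
  737422417879581284568386590810024074832367841580997183237099939352704955239588683455808429793460679101202562088774437805527953,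
  11739239110414605903000034522248589148801529772447587515625485553247432224127947680238053192946027918788809063727094328491087574645714,
  192219165707213702548053015402790131524168139349121909993366760604440037906995127609471043474718252620979338995206063140481509602354905267283]],
  [[0, 0, 0, 25966877633, 390563396037643202, 9567550046067563283559363], [0, 0,
  139004869874814798841419283237636, 1758052551415370935569361522978034309957,
  29777700589480959539986632250061270777975231302, 464857489321694021180144951669340440976879714412909383],
  [0, 7436008179200738675255004292338549483686408897208035037623176,
  134577906405441127199237533322200272335392280551667361738996640164617,
  2566202082554677285283916229378570421026378276938085610028940374474468831946,
  32844985565625581222157800048214619360753816112905828111008051337645909902564823883,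
  559029960043591790366481729889662368513120582945443719603568296861994663757451955600131020], [0,
  10213298664344551289114538087374671470302995514717557337501920143228078939079250693666066032532301,
  171560079834853863750311913354546584485453087657945529502801230626097742878565619974960579111387310773006,
  2874389840338511779548004369107252649711985106238870878867567874131539753506188315835407870638242406530002039503,
  43653875835745383109485811243770987815044874366559603248129983273109051136787601059659684587286236175593830007104824144,
  696177197030030856692123876246150869351296803903876528905947076742913100890218548830267516969557362973346644089933620997688209]],
  [[0, 0, 0, 31332629185, 351204732443876098], [0, 0, 5621382566681161018739395,
  97182080274706773277775011412548, 1402159244175180308033811371526802082565], [0,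
  26530671328138252357425731928395027805014555398, 414757843010204467296166023290858604240326770807403143,
  6916783407342907520508422704776518601451363899131533004698248,
  117194127396497369348320581433356067491549479820598080667171548887689], [0,
  1933947940586641274536701819611099113225141788521351494983016539233941873418,
  30835399017713233427965789443854088845150058298207190025180042588194205750984547083,
  532362337714602789103122309355683867574275308738177267848207320686460235853405192893407884,
  8660602578319909971415998987591812941571554755327382407622220617908533988305695211410462539350925]], [[0, 0,
  0, 31457542593, 455287724575816194], [0, 0, 7396056866153887128873347, 99793158026854907507089515747716,
  1832892750674708130399988344298484730245], [0, 0, 30446600215344397927952798322754744398754781574,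
  430361336242043323560321493287827369054902281906575751,
  7319973849386580142893581335004866574430753820007846314289544], [0, 0,
  141204905430258173760870529602376629763089884776865893666813203915145,
  1953694919528425313209977138576386399385312364043570627519243419483447769482,
  34044095692922989836983662058576461486982496727328770938169555935797893023052761483]], [[0, 0, 0,
  31113773313], [0, 0, 447562623919997122, 9081777544191223068493955], [0, 0,
  107059468453693642821293018697924, 2491130752521976978905260248918778845317], [0, 0,
  31276339721165654267126673573660317946682605766, 446745135544037039363937605701698008357127671528620231]],
  [[0, 0, 0, 28395483393], [0, 0, 0, 519369166292068418], [0, 0, 0, 6029457679723981720232003], [0, 0, 0,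
  125705989041149235575920153911364]]], [[[], [0, 0, 26685246337, 481388961301443458,
  7326383208061673630352259, 101146634283944758920198039897028], [0, 2500120830397164826186983716324323930949,
  31583611589226484290468763740005853758890013510, 538188143797095770567482199682769989182087510759711559,
  7875636316670533623582695535516448471012765202758048473082696,
  121126575656075139712176469662104190936142850159089807272579521977289],
  [2145827446961945164826595188792190992159793376699978157424632304740526271562,
  39285515198919481456977852202687637838821105103485415188751027527858305239166671819,
  571583432567341144490341204446836904230163629747294320379105970217888352363728939338226636,
  9057524242557171108567121514084770677163542750832593973982204257373110334487554911809069282128845,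
  148538187968018075816579158629055869607732510585371617320608760445709737522733256137028738257719268609038,
  2427506462581323635323364784453179420225133481829352894342861620480806469240957466975187978272793281176969331727]],
  [[], [0, 0, 32853811777, 475792451548836418, 8669429807012803389008579, 85087446621522983455088402578244],
  [0, 1553711672311876207188159950857163000517, 26487967422242364123284297015146643750387038854,
  412171485206432635460303584346546573717235132680036999,
  7016820901855817958428551017920835432116437012344300223920776,
  115083446229146491275767698126445904766629270390051963424028221651721], [0,
  2109192555320703569666089234323427815770853116473525647806333669788753308426,
  32774685476519653897921744657117126591853558741624451646564242670407323900934058699,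
  533488661980643850199345263691329434251485647926509258471791148567821033697242477795558092,
  8762010341764591221607268026612432306946169279432101652664761421572374026708583078587717176855245,
  145184619443743309403031809698025339817559211208910457760167532805140370196890434929183498100526385832846]],
  [[], [0, 0, 26489418177, 480602229479885186, 6217431753114620979331523], [0,
  103058871422493261263709035420100, 1489835236603901066757596534113449656773,
  26590120254337478813215895703543102582456725894, 437022172440607420737514782770082252338352441437299143],
  [0, 8366968750608498734418085877248222998820909400049667954457032,
  121612962252302014850251665087934431080147946476827418532219996404169,
  1961683281452879103978895577413967487751986171351967987314060829620674664842,
  32221766835765252767984485272786759768435192164276651884134381507701395403601291723]], [[], [0, 0,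
  28323252481, 357698166438121730, 7709966501809157754851523], [0, 0, 97414193016761757795388216377604,
  1556124318981403421156576218138548175109, 26207057829198212332730168173235516563022608646], [0, 0,
  457401892149345513478522218859684317062089488136513735,
  7036003858306909619097736795021225903356565861514725688555784,
  133129179353597642112280228157205795816917493782329639293793737924873]], [[], [0, 0, 29733023809,
  522424559595786242], [0, 0, 8621650677589750795694083, 108811987255633428699905458044932], [0, 0,
  1706498929123207854812825726963708668037, 30277659228365076718595145970263786418514874438]], [[], [0, 0, 0,
  23586473985], [0, 0, 0, 335611024777062402], [0, 0, 0, 5827739941520568678406211]]], [[[], [0, 0,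
  32812710785, 352072308739191682, 5066177435264318873004867, 84257482666930233858828780266372], [0,
  2265472049640514973431469781346435390213, 27048993116140186957462704404868354983444458246,
  411082853627220791016259332901579466513491712543857415,
  6577107302960043308251417667050041881029112864956985264603976,
  113284214982258635983186217867003164506148240394390382605018917602185]], [[], [0, 0, 31292291649,
  415718710970915394, 5682101070572390216741443, 85802895442276243181140089897732], [0,
  1515960756913064655921846577899813862021, 30213763623579975421519027062802682714690025926,
  402998781460557549431850721134411626483726346321512967,
  7005159407882687198297473738675864868845746214523220319267272,
  110411973949461460133112034423832896017802455688762087513699821486729]], [[], [0, 0, 29253503169,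
  433527868617771202, 8787060764624513136439491], [0, 135152264766177426940955248672964,
  2078372382836957582632897980131883833477, 35090559485857824355829545534602687636642093190,
  449827940521457391142010436321240658143615020569917639]], [[], [0, 0, 27971330113, 569031677298364418,
  8721951109769186035595395], [0, 0, 104873437033986429968184728418308,
  1674375791123583295409429825540250470405, 30345705435001846736524957801512026314680193094]], [[], [0, 0,
  32651708417, 383182564176259074], [0, 0, 5777450857554722355585027, 86800192317501525532859898867716]]],
  [[[], [], [0, 31898983233, 353495352202668866, 5038676256543400519359235, 82026821101327684107695014013764,
  1364502108712079800755428788695712689029]], [[], [], [0, 26405237249, 311313893547119106,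
  5047937406527821971614211, 82324158890913573052123467858436, 1565844932088154922984774159318507766213]],
  [[], [], [0, 28595222785, 527477721329768514, 6070456150474382315806787,
  135606579627105892210363906383940]], [[], [], [0, 0, 23245185025, 336203078077763586,
  5849870843849850396481603]]]], [[[[26244357441, 0, 0, 453230365326738562, 7373244499794502387823747,
  129651389124793600036307474015428], [0, 0, 2032625120478865807160706029749207454597,
  36428522103579478977348423301779879859016338310, 494863934439791461744006217639745435498703321308027911,
  12147269648218186187548195983746117552483869362161629133966344], [0,
  145453250556461543833997929352758886828483039709403571436236918268873,
  2418419509646285206961401159027933186917396211681509778831453841850242208586,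
  41485926149445520700593910103276534001344734668421505947945717369327664447561417547,
  713777327446406817407379271189396397075878648549973104797878994206617852448753115687451532,
  9851558761061552923270660314880495239883048118546272231222812413280541825624015823759059690433613],
  [170348836059884538002909833797378663855694571246409105138112448372144083247115022216615900251222605470862,
  2868795105057349774343961961020342340704907876079043275657713401498727082069833900617169321480991144069846080463,
  44932117917600590588962897000108619207347721522551067068287285392672957141301491266272347091424694688063650980973138832,
  744646262942069711107836891470062289026083196849772968448628405364869666208759173444260155764095782166224123045890533441090449,
  13033657587184088461649476964402668184155727878539638046407436659450380980149828684085290717048007088392313639406559892112200417522642,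
  203403739338352136740823806940099964048146840974074504494631145569751759621780539866393916225594597483096243580668911643283313673616792407251],
  [3439700267160823335087144442751752908546299426903112163063140407352749376936240119492017175571824923903470574265191830225558063793158897458761454740,
  56389878671450104783516754352734534330775905400612388009998214675049929658450335736021374879081900906102859058912522346666144495367569389176136656943328341,
  941677710586541043957377439767598208400577958872911886012084681679538123925827171058267218290258568875232524727201880163247505053755773313451747535059021938682966,
  15127782094925010884328459449974051612596695766952118468268131700347115646078460065470223089280605212095521412310015140839325735604214616509768051986118802473651604399255,
  254081914553518888845639458384956288284319745504090966983760191243021414695791681501644410609634411232788369666695816102375377317236514433587085619030666603320647479907369899224,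
  5733166383531537509056092765590640777381193463010722317140467963955777296627011662477536023405556971816624612171075701813210827833149445247647399709200307053797313733541013396336032985]],
  [[0, 0, 0, 32548359105, 491332896733744066], [0, 0, 7490033880933278230774595,
  126629624352683485027597017248580, 1514789446680562833735625205303441101701], [0,
  30443905040415643267791369256975498820437807942, 482472454543888465124012703819917990741257779790316295,
  7282661444885968279347090979739342062044314826542264305267464,
  135381517012285169413334699344451991784062834755831610006143381269257], [0,
  2174808298261605438670070391563436413542613829325205410658396637992181599050,
  36531678900921848786645704365922027683607690816016410297350648187155522713393312523,
  555364327214771410599887036015657808231359335302137834147157269697722317521686123486309196,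
  8745974778796369665349835001925480371553953818331240671987746289170721997150391263274825926808525], [0,
  174439405248010834727324580253697015946816446207748608075265599581542588926231032038594249080219814257550,
  2454051413515456604190286354624393637738106012251149687490114210666065825852285018713071144123623000793324807119,
  41626389455440377992332714482883238883392170051830211814780832032493316131075489896983737161186462893919744956930218960,
  681498552343658143102061564300573250170252634529926193678981977310011839911057629756927529956525518155537660261840871419440145]],
  [[0, 0, 0, 27768699649, 495101850666926978], [0, 0, 9191651433541644086086339,
  88885166037578450950638072644292, 1738845133235120023552078718838579720901], [0,
  26345933201069902897210614750573581581952326342, 633089849311784324182166107114604130403964089796889031,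
  7993471916838711283113207623458756960882984426661651359396360,
  113331189175668784304902141712278720942317288398049741804028674632393], [0,
  1944040239286879380146907782822758662146792206139134023407897745607640003338,
  31774487548767478101414987034480492748309783737778532095734545408602153710756825739,
  520890876815610209417991436482589046898559205292072405749460750151563515037778001838115532,
  8920753466660485228626347474983804744353630686663558568006493587958280036306179755018359841776397], [0,
  145536664318494974293962394953025776300976292860854473007379210418144854496198999731498876008553749719950,
  2422778115825824765725218612350952847345300834742074686251202745802408675354997070977521005204488829768397583183,
  40563227859875944375499054724824734549411798607619618068357784431561853403890178405713412232897316631116200965613419344,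
  683979690327678684899952353726810419695777751792825676780224693421476794281714219641852766538182722549514506648583852427817873]],
  [[0, 0, 0, 28071938561], [0, 0, 493558427685093762, 6351952317815115675707779], [0, 0,
  98865968733222416847231220797828, 1585477191639110173133222518529824737669], [0, 0,
  30905795973699917418813173017332765270384216454, 430517902058977256989055109864389864999272390753843591],
  [0, 0, 7084446074903336224494765621123458495910761533188253347533320,
  113846565943721965686423506506082072325517691147988753288678200449545]], [[0, 0, 0, 26114081217], [0, 0,
  469472070779662658, 6591790787297529719329091], [0, 0, 108281904062456664391467539816708,
  1798459177068081597534581058488574241029], [0, 0, 24814937989773103628653423371542381042811787590,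
  413562054700177965607772884322133035781750304619249991], [0, 0,
  8058648901062285611164170551099889638440922090857434404565384,
  115427073326766450081919341433664346200748666854192075287869641972169]]], [[[], [0, 0, 34186734401,
  450123038097800066, 6110429661205427672091523, 89973633161130362285062339177476], [0,
  1615739966415963141672373317496836336453, 25302804824105124079329456669581930934450486086,
  410585526513663902842696265152108065086793824222872391,
  7091024352559213229342498319208833829765591336200881059287880,
  114257377292162728367329246406721737227006920899336829181751486333897],
  [1995550340967466709622185931055516663358333924740704028572176229605684739018,
  32257836204031547913586258234105779287055125794746061497414471853786237592573961099,
  542750518475620512610891815344283332245780282309772409871305971058775702151809558091483980,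
  9023403832726968066849878814269540800915610252204885139296170961644282432455241089250543280409421,
  147254425350824126481455558824837952333323144996904453507196034601394653920519886355039575719766820088782,
  2417374064727520494297232285636463278224808716926094916224999622319452485862890342266679420112568517966080218191]],
  [[], [0, 0, 33887324737, 456179008434459330, 7293642811668077222648515], [0,
  90170338565608632663424641428164, 1570987921662192079127775607628853879365,
  24383195824943118697140947617056160541766517382, 400457045071359837508797990083932010739919725793004231],
  [0, 6974864207565577452420567756707634136480751332037884578187976,
  114163544879951484519101442958040428287938474810264410291085828520585,
  1958758447485173021338455855953248623534215935197601396844151570862036535882,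
  31627434977808994281230387145055429449891147039555004052770501599847314541704315659]], [[], [0, 0,
  32292057665, 467264535466641986, 4968302981751273817182851], [0, 85727391227466105005409006025284,
  1394750646091028435680399388096412891717, 23257149664733485064860423673376216771365827142,
  390129023607088373145036491598987536952610402612005447], [0,
  6557079858005961479891332548403391235129040681199068498764424,
  110070711712870667022101996409177026638713203408197155140487829281353,
  1830978417208669294134632599860082968656702856827582474785152125978769072714,
  30602910202450760749872000879693853656429912374856909438667074062221741072654715531]], [[], [0, 0,
  26100201793, 370834382085179650], [0, 0, 8557247140112534322096259, 141230202850280663467965481703556], [0,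
  0, 1522907904530502867433070685090865977605, 24560371291445890444983417954069671441370081542]], [[], [0, 0,
  27140833345, 389955053851646018], [0, 0, 9466414546618464695244803, 116626117429888497707931949481988], [0,
  0, 1648608365611265089132174499757207867461, 36423358315966034508165211326349507518496663558]]], [[[], [0,
  0, 25827330945, 350866042698085186, 5731189826996047440483139, 103755268117942562196639708261252], [0,
  1782003636903497622929267221001049377477, 26430889961965751971958904442618163201281209030,
  460496040120968549930792527253236385833077212724996743,
  7359119211716855340224860957967407980905993437812579722939016,
  110028494256518866173430755309627966761962631953294939714922622624649],
  [1931982023062716288400131956080483032566454748395841888765216568469614111626,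
  32328219731984778670192197348735549854817507306871901506100258402553541288329569099,
  539010942046081814324212399989351707044929288730985450706801137830854910774006967560164108,
  8741243791063446753064076121314862147825167424988961295759481672853933479228180380411771404436237,
  146689123647397218561657901013981346456413002127721494198396781074153546375789168824488309212430202163982,
  2426772816947745914759477174643800040434787907734908044795556384164800779220753977977558103401342717658579272655]],
  [[], [0, 0, 30716504577, 315545608246792706, 6347354905919423076370947], [0,
  128673632169333574900190052807108, 2053401031266105367363496597283342172549,
  25829165212873121736324299679785347622157627782, 409251496525779720350582009362980883288581924625246663],
  [0, 7494508903626039240244790898097110326870167136138079076844040,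
  115479241696007993243272390444251653626515025549461094445704280185353,
  1856033055152337194399126964780366188255634400457830805295961726095574004234,
  31448463837846836118403974517204954139718581169937756402649374968658356885800235531]], [[], [0, 0,
  31438874881, 442174138356666626, 7312862033344237871962563], [0, 90447393837149611450572261126468,
  1498344606041495600532770188739909853445, 26637874056486360170548182439645473070290077958,
  411552857363133822776435645737738565758309361115519303], [0,
  6814759020832622679148502373958614637180533570074426537392584,
  114110425281187927851216465549974461147180875559235994336287859173641,
  1973413639274061365194801594348522764732416194669649962521205986831775840522,
  32453767082517910175830294402825168255414442863663246221907379769098080619222858123]], [[], [0, 0,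
  28108302529, 350071232185356482], [0, 0, 5019690843949604351965379, 83178811311625270149011413930180], [0,
  0, 1425963653216454813121275445038860830917, 24249870285926462363067227683989693716053244102]], [[], [0, 0,
  28045240513, 326921544766447810], [0, 0, 5135040058875489255376963, 84513059109562981807481822079044], [0,
  0, 1408671356711191439529621091983028379845, 23768604917191387266703161933495695354703702214]]], [[[], [],
  [0, 31668216513, 297004682257777346, 4900025071619175671179971, 83944631931056220536640819129028,
  1667956281952985995858541326391208753989]], [[], [], [0, 27248054529, 460915609441046722,
  8558197798800545797308611, 120044504787108256878806525900996]], [[], [], [0, 30063155329,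
  532198865521567746, 6981969167922328918458371, 112403374025744994220500638148740]], [[], [], [0, 0,
  22058903553, 327233811867772930]]], [[[], [], [0, 27820108481, 385464066740402754,
  5378655988077328145793603, 81485870305217172450252353739460, 1392626507605112579077108825646265965253]],
  [[], [], [0, 30574481793, 296362051227441538, 4904724369337917494847875, 83819764440135785217198648099204]],
  [[], [], [0, 26549299521, 303486273930520706, 5080544896932803983685763,
  83446554236501188136492485032260]]]]]

/-- Packed factors of the blocks of the second kind, even part; see `dataP`. -/
def dataQp : List (List (List (List (List ℕ)))) :=
  [[], [], [], [[[[30972108161, 0, 0, 576122290299900994, 7354000660556240263363779,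
  124075003862800197401733757238532, 2382514076922644372757569396091325687173], [0, 0,
  37426725154780938714768522416879609074125317126, 593285011126134201168331094793362135282397003270112263,
  8203976995236080807155314782949711295220193890948802335374472,
  131296821255495348548603938371800981129899504619118035614482467626249], [0, 0,
  2590331190639322915197694194850039340327976580960593971023814062064113826826,
  55720833452616164839309970866563201969770846249416929931822335886746649356920400779,
  552949582295091724506514456087317959385080266939323876557750614959248708112928834796416012,
  9919942010310653411735415373475099532508273992113968916733180620160985261918081594140871896808589,
  157870948138756833931803128422098775080435594675204229078100159779118196033154628148964195660531076384014],
  [0,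
  2528280766784581446367740343191802328256467544668922454542047223347730482225140371984148280652573809595800699983,
  43685250113264393103618793280391797297388198968616221282621490505105408411035762609060670603022692741014519821605002192,
  681753467923917996958727446115233777061745271062004799618187924534661660041574915625440867411708281080321943308483201222278161,
  11607071568572295216505778826513291853490607765481409987791411224855847839977330088512802436442824863056643730951681175280955930809426,
  194032197942132749735519333040025222510951941196844280019011860246118177333257308495060458138069243058165303505633899091487003791519087750355]],
  [[0, 0, 0, 28476550145, 498697818681037890, 9154792731324897914627075], [0, 0,
  120079520406426185665267548777348, 1925049355438565826594280636989121192837,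
  32484393695760572358793893379504909925708657606, 424811508379079063970711333768419245934910107248964743],
  [0, 0, 9113965852521730337177721128863786612440956759080002899803016,
  120386495524338819757057661774050831154670269423907416938642461473737,
  2934207032784492513346325120472119335267245804983301305415100683899328115530,
  30895462629625095962804278598439523341071330994562268372477491769797684328663747723], [0,
  592078881391470771028825408909966004745067087003159854200593150151188577039752423006886796,
  8923524829632546441946166407689690140348475070583191162422450828517160882017145735848625751649165,
  156567550556139832029377468379119818126234355027996919136649876173044698705427531133878393092426836548430,
  2530714176766172124431788898819680380460417033151117120630166179906764310235802988427061731759828137803576826831,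
  41911303643161476748771230373556089990479119474442648447677378501936794359367877793006618542459537878028215037209662544]],
  [[0, 0, 0, 31997608641, 511908174544536322, 8366771422176017199600451], [0, 0,
  113710328353144090121162355258052, 1896443023093838087662795054922969121477,
  25976803485853977238556003561257976246631299910], [0, 0,
  456157382380332644116097338272023173428218813762048775,
  7959652718660734768201118056821183041154315580191086626386568,
  119663180417702428349855741813818593127135811285862832917660703163145,
  1960643471800219830358486758242524631605174479796133510646236319832815909706], [0,
  33057297140581998406176588410148488885563516473520593471052849157686589339788819211,
  547833265400714431353322568441449690195406246861021758831334769610120114081234085245663948,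
  9000687770683131396438576319452830292586018333414322876608837187346163479338917487773517985219277,
  157231654916135407758788842873923882568076335840474623629853458885741478341344488575848863292433926253326]],
  [[0, 0, 0, 27578372737, 540951508719610434], [0, 0, 5702486130064123760978563,
  90695013031381870723953128983172, 1794347721570379440699425258041008902789], [0, 0,
  29092864467819966020715029503247538350824114758, 441312458001409714564893328802079587806445782181552711,
  6935635429487325293793117730034583647167827603561271012354632], [0,
  120860323848579153177002963042537746792417615879432580701705722102345,
  1940082084603308474992888586974541439885457062037941227379974473270630474314,
  31925100298124329700257665257478297815794662508612232521767578198770185802959585867,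
  641367735289852188337346283331401545343853198217074024909382764559321042394575507543339596]], [[0, 0, 0,
  26884450689, 458153905151605250], [0, 0, 9545275101934179857717571, 123697187439726748015811940313476], [0,
  0, 1650908060903836697976207399422169252229, 28973210165197406563171792425123821696506595654,
  569547083676304489657001754774628286511106432745230663], [0, 0,
  9189386148716741317455077225778185175543983797660461267581256,
  132139125980323214279627134838908717916247402242751915006229004439881]]], [[[], [0, 0, 32074933313,
  351147825815069762, 7347575950035913365908675, 95239659332131711685071662243012], [0, 0,
  2312346820899972489497475398539093410757, 35348947995286856502593803950872468811367048134,
  490881474200770346184018047618434872674944602169867271,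
  7825483617196503684644250983476113064735782167298627689759816,
  109715192958561635348999415365004072050371136281530245252280409210185], [0,
  1852138092892071754258929510668728272612733108389434865848852067797550548106,
  33522542762518240131102312327169925979073588837717292276456923618947481726989188107,
  540361277043671826505746130666337489672954115602375743942826698230262292059713557923390412,
  9052252282912183656019776691029895746795371485172521939670591945294967780515602136665226468432973,
  146498644708058329800502425929913118642580083706332489536707283746389247977507374621406509482864113587406]],
  [[], [0, 0, 32411921153, 524747268550454018, 6984918387588050676767555, 134286131278069040169163664782212],
  [0, 0, 1681922792013531758767173453335173985093, 34257063355586389823620734598909934496113734342,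
  422280007046541050513544995227380571452998331033197383,
  8713368588037233604449958493616136149613419546506701569766216], [0,
  113088682143087306940993870492089787288877214876944419609879225350985,
  2027520524124475142427198097867655910434413405045528082951218295115920753418,
  31791034734885944077055873733968056122025198390388340781185446017746481386571889419,
  545677691767628251452190997086800597262291039938229170789689377255400593460387039200602956,
  9445218944344909206108750107407059203660187690204869608855172181350661169159397487484747249736589]], [[],
  [0, 0, 31023387265, 341008889103303298, 6586512934315738917853827], [0, 0,
  101534637988027295229336119556740, 1597425634307115137452601315527104393861,
  26135445780144143498116020057991105275203801734, 465284104987272862769225937311582860594916502663412359],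
  [0, 7146944284590622650093629845049432326601398757488771705051784,
  114039514467914134318674895254647772606951206944292358756840678769289,
  1855663374898221404291546928643733349367979085574672024579092864109087046282,
  34040733878527856627006887137416714042292567592755012240071241557550136531601666699]], [[], [0, 0,
  31424498049, 516321054719918466, 8043628679833079334480387], [0, 0, 161691937781550956793061279498628,
  1921298393595763955270306726464940699973, 30095815671273888980126226157982468839092488582], [0,
  442369712560997068445694164076534206540458359505500615,
  9246005011475761493284475363911165068118914704905352497291592,
  138229524385184778623204073782636922568447221839281516156902103185737,
  2419922998661998138359546056533978973768079068036468938701539770210381074890]]], [[[], [], [0, 0,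
  32788611969, 501140723987997506, 6085864392395256702278531, 97940503547085939488512086533060,
  2507134698294069789637074180047383380933], [0, 25877171345768306486251253064880408517813386182,
  422624007569956933019574700135869451161500965365760903,
  7585833520545090160639510203352899026922454493195942525944648,
  117678857404444532661018998510275308826738198457559808552580465654665,
  1965988866642367404304166526228191013295024809549617638132103642248001680330]], [[], [], [0, 0, 26098680577,
  367740768915622594, 6186480889424472814852803, 121503830582117376314245452266180], [0,
  1486417896341861388068731791640537307909, 23782265313222302928581842472272731695705985798,
  407075592120028708874814668382693693282270992902654663,
  7211303761895359850707370736743120321590791157013812712399560,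
  128219598389909473550535383960539022198223463920337969839147376247561]], [[], [], [0, 0, 29512266177,
  506218962777051522, 6142938619898597960133059, 131523551903668949706076423268932], [0,
  1631217602142095205266312990470154332613, 32589869831509973739996783392087416071015070086,
  463126689596386421547953723943542163544384389638064519,
  9190354700999944307762122967720123335618993634388420843084232]]], [[[], [], [], [0, 26212156353,
  377570023694113666, 5369505194017142487538563, 89117626939272245004055976358788,
  1549836612916967065168076556599186905989]], [[], [], [], [0, 32338426497, 488895435591649858,
  7470415759234983563233923, 100512140591920436637845872142980, 1667606650565497934525522748268445575941]]]],
  [[[[32303338945, 0, 0, 457070265469273474, 6447694363100144937483651, 133314899934898742204787805658564],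
  [0, 0, 2027472855744403656314068611567370181765, 32364317813345277381027564558835424082677058758,
  462619957650064903741326349122693584562179439939910983], [0, 0,
  8388655694027724703093627154556231732770743331094237470882952,
  144566720046934304453768059036876671388571532121851830393530742604873,
  3157134115767466799157469409669390610934565142540721278493873908995976516682,
  37500102314916643877968442073036304432449174308896310969470754996351111883814116747], [0,
  651408791359477137820599266752656079665553233915504737581835530780022427556887317019386956,
  12579154673751006084004386442718904024653099120363808095941260586637636162292209136683630339697613,
  155944542111842508095635331635845605354787434430039356416543435417007502218534801699544986975053769061454,
  2442639814254919447802739822626729003085296031656970438389581444152761899157723914886675893292702271604002458959],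
  [0,
  42166637527758496582878645817991545935660295193693192530344970726607220406702033759011600856403763123221083835378320528,
  691911636224997069023039814858260498354863754601559174651098032070821766419989576450505013377086548891425507263910958156690513,
  11461369689909279467456704221520927013083321704725995155570894546267409404741566208697962258503753043876854017235795866088201204784210,
  192404419561990189600351743705473231325170225005497689436851961220443772201841751292042434121799376199591810069269918839724250637154745275539,
  3208197396212908044494132374737672982492266492330308761225450380855500139987058094031228992184409521444845244280095303274428458873750182233529710036]],
  [[0, 0, 0, 32960392321, 351132676634660098], [0, 0, 5571400072782298035227715,
  95268446794823956697421182438468, 1829053075197122527979125950786395472965], [0, 0,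
  25479163635158574605731915833338524959372882950, 476150864007901786096805879848869026270028172588719047,
  7171498708657674152600157779711157765804792736600704444052552], [0,
  118163933761189639502141065361469089926324900873670048865732565933065,
  2081094468230700014693233448947931861718073050591511365556195741902142073738,
  31432101009234361249791429588881299427425937877529980424057136493729572520818596875,
  535548250794822375787128085206989665441133877963605950064048473573965509810215242210858060], [0,
  9328971403670121536319721925853967602536759952876275619831500883560174001561179306584938862001165,
  145872766088501700535673876058999482205694804547928681934033957527505927035924500172004853313661784097806,
  2467331621821220624029916718024251295430021079452806479124208025698350799985476932634377353995038073521674945487,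
  41413781152464417416733111822225742643083870268094854797132014077775456934795279480746507650014384162674719460316179472]],
  [[0, 0, 0, 29553709889, 560192986514469762], [0, 0, 7352914491006262466497283,
  135764386954486160470035393194820], [0, 0, 1788588108508591816060629160536403196677,
  30404070131448470267877602535089508964794993414, 519697130152711378094497404844312012854413087266825031],
  [0, 7021504908834084206150304309795086168261356359929856248849224,
  122092111663466444503943307374671717215213113045096524482436435610313,
  1975305360002043821326847839674554924201721789437328402411095390822321333002], [0,
  32177957687675183254980372201995510735489821822479710685434329888759867418982992715,
  538763975523298551790622228751414638863357208187536707238290055646919960197478073314347788,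
  8831194142439035561212421653206560019024285459923579224480583868180582373316099717992384518228749,
  152910279374890047446514177599590931738748532712947444461476153466611252559340838251768030383919977892686]],
  [[0, 0, 0, 29599957889], [0, 0, 503924636683217602, 5283833266202746381693763], [0, 0,
  89814537358216203924649919996676, 1456800056906983530043124567151970106117], [0,
  25450155006676933957481409634727690302558964422, 394979334545265336478733631522464542604861274906727111,
  6958307119790966995543816724509022945999091582795698014851784], [0, 0,
  111865250007327715757893701675658522795858627388898781748580032094921,
  1853097433969307846627307819173099670797470852872312282181134778658295186122]], [[0, 0, 0, 26373714689], [0,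
  0, 559766137077072322], [0, 0, 6006433145155201105832515, 105913655462889579442586953124356], [0, 0,
  1588127213598471080394132650108770437573], [0, 0, 26634531092794968758811959083621472980437848582,
  403727381674894520568772851730846650780967185054247495]]], [[[], [0, 0, 30632471681, 424891115087770754,
  6236265530240863662963971], [0, 0, 125438058078523445463650812439556,
  1594975060725210731416603586289888074757, 24440877670958765309584554172225579500147213446,
  462999770792882916133625540865355832645364647345450119], [0,
  7621636286950716010981907525742440318552043918106195262065672,
  129980109492627889468232706119788154188923829016181948804674987420681,
  2250711784661162404551534169100395090103304498035687044986193657589708422090,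
  32675892656193684736903057800001354700402968615321358154777285151507117098824668299], [0,
  559537964998789030019538468468278906257062051416434978106339085216940650663027997198525452,
  9017525888308415848691565157647995600485602401694444386140141880517114443576885244760318396044237,
  151722191848559739632418638982834675405209380789514779289107255450721403240601908591035871920031739528078,
  2493476929356706037019050134098771246822727937340812061410016713676597365835077205898268213263674048389775168527,
  40889573822482103322600302556585715258652070099071318191057836256913723750486423202567706701621028898338478085877759248]],
  [[], [0, 0, 31104314113, 465419919240717314, 7403734017767311518741571], [0, 0,
  96411683131166035038476085967748, 1536163646244783776222022421480373674885,
  24904298816414093221510819530550624062027043782], [0,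
  470343632030824209617223434655788443958127769562911559,
  7863392806683531146585621770162660826826015760691100047358664,
  114037534774623414981658712849254288064661110349262583566960572826505,
  1828204777170193769632586263987248968689280185827496110751448517334557127754], [0,
  31252742598192610126998794146578791856569005067507978977979561019293969696608748491,
  539267309112937538068234947504075842684824330699720233729194656668207780925838382330860364,
  8770707427681004080186694073896705460110452447441258021818668217614183197976606606344860100035405,
  146578205897722153707500541347999438367125541798612641666263094865732792001975877951635512652263190803406]],
  [[], [0, 0, 28600417089, 342807724727098114], [0, 0, 7170657345229832346081987,
  90251309938382269922850445580996, 2036532205659593470560484061261833835141], [0,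
  24458830982480333421734721263159831206955225862, 396480664100721625465593056739258772432198491099200263,
  6543246033981822536043698925974001901356106904120833674593032], [0,
  109238523441908555890995997479427056883064239371616776691506846962505,
  1979052147565157809994216213044479559056997714897442975231886937000931474058,
  31027925070065339179334567902217725183308963488532603529183401653396615730032435915,
  539405967772983562658745793167267777724720230472930954301415479468992156891138265181201164]], [[], [0, 0,
  25996089793, 459138174375033410], [0, 0, 8745585099456613590219139, 154599952463562529333754646890884], [0,
  1713935890081679134551128980829897071045, 30195795761060723310635013876704832787489692038,
  594832890336869339143577181865841035110094069770615175], [0, 0,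
  10362911436186961396684675081578301364607932583769314862244232,
  131710137996978046573379020176193611242062078724531697862792742236553]]], [[[], [], [0, 0, 34275175297,
  400773508402482178, 8941130869679964375073667, 137459515480000515762975578796996], [0,
  1657343914125914539473866923321028756357, 31671652159342251918094112952730963183418194758,
  447295898676722466726807766398976450432388271756477255,
  6942176849126519626353921811261890480592465115392497358937096], [0,
  111435207206713279195513776147915556651232887172099961231979700077449,
  1841786764708455013357566368582295189695278497116066084005855967192637795274,
  31314789070164878171721084274633399170809664060714204846025957211622995087435201355,
  533698891871499101826573858848973852502844496618143632475526907016605799232352738987668364,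
  8627491574812639860877792579237177208227783680601818393762388262256534844417492220055035351495821]], [[],
  [], [0, 0, 28157948673, 309568558231870210, 8945956883750388690662147], [0,
  95347801680288563211475263845060, 1590230894028765585772733168001610691269,
  24173549098121389629630672339015138494861812486, 390938649596328161386280281732039627621495757739297671],
  [0, 6548438882389122879286586925979263267766286463132947532847944,
  112226451159219393354369640891294379048481372881199240586114481283785,
  1847174873690736722840081146825440332371567297151702710099805227196724841162,
  30820537796122683369100950606695046010258812207524284031782403620779400266241248075]], [[], [], [0, 0,
  30871488961, 485659965197619650, 7564083638249082997232195], [0, 133852861281242076377065933939140,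
  1695736574401652984911320556689608681861, 27762891261616432856766302289366267615686992326], [0,
  424516465728801697444513992094636851066375240079575559,
  8174666480962509903760157107030300110492875172544796169998728,
  127987569625020321276729603257716167864520639479347892908839807545737,
  2129096986962416384821620665968144217672632959877793866606267662826855164426]]], [[[], [], [], [0,
  32449491713, 363415390844877570, 5976487748372242558122755, 119402649741230003065146942874372], [0,
  1604316788279051443942293451615100572421, 24418664215775399652476669850190301929825026822,
  424235630522302571074515940666494406774057717643461383,
  7125103199066534615076120994290182460308366716437082970254088,
  136959014514255007414484598075444575838257781651155807784552982182729]], [[], [], [], [0, 27889539585,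
  461530273267139010, 6194620018814046301813251, 130706753437958339501429696445060], [0,
  1601996652591938258683253962751019115013, 34438310922883549772357001601215156378225236422,
  466056362448394420185392648800726053284948338277435847,
  8883159854274729965236875643416451251709287163156572161874440]]], [[[], [], [], [], [0, 29484952321,
  370030701737806594, 7561871642161381803920131, 85465753596440966824972705803012,
  1414964904384720672731617593069277604805]]]], [[[[27726478721, 0, 0, 511280959739368770,
  8002329379796985032826243], [0, 0, 95847899054408063243348896236804,
  1935723008139654702376905300943512501445], [0, 0, 36664656417408378913665355688743019500650458118,
  513587547470703596554063595559727799349886102628314247,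
  7533486366359322252167336122587848295550092884243358799328520], [0,
  149983131834686495294292584795817098987884745639969861951202578017289,
  2091091826569505635687855862777876319878589340389051270266318776273806554122,
  37129994495853527092390793766616590394837216398408217567044847567533958526859848843], [0,
  613832453584028084320414692403372232379812921841935734919762342775004681299333324421067788,
  10253075664293787483535183545470959191781439385318039071605086263924920341080414029272469437744077,
  151216389578555617831448205148396844923818475835902897819589719891696983803200821129595274161201682621454,
  2473275505493869006155826752884912786746933493310791353648652681702022873607465430456419834238355551313210438927],
  [43276574414759159272645055759010265631951477632306722418120183952151161412869614385785727694865524309204403530060973136,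
  721930776082293354477202999569644303159212858536919572616701328702020308744941970388069766210667082355740076087157820279559121,
  11399412428287553279937176355885182934428142675306952914637195831201340547595090393186704855488885367208028076418265719594210368766994,
  195087794765403623026086841835489488333280900168439149948696726971128986427790556063623044393450560136507276855314636844902623218061925209171]],
  [[0, 0, 0, 33235201089], [0, 0, 500415461113574402, 6843212763098479987244227], [0, 0,
  110336351172548287952076859446212, 1489989867381533570268666421833624855621], [0,
  33555923423372287313558577635039170887020563334, 465116664389138271685994002118035269668587221983886279,
  7424398788317711344160424985646647746079561280756786406970504], [0,
  130190232592110728599836421313757097562069832250343308801250838985673,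
  2002920545860758074845391484116897773591286283629125647336544600393271608202,
  33686840724848724273822957709575932513787787255493603472010649640339904259212098507],
  [560165327627721232567201056002852219487106099105099691572788602013628682825932518084813836,
  9154460514268391885949224625800625622119513873826598060583283106338462002188592714760813369529229,
  150051798995181315064151848430729062337117485881849757485347417557428355081312149601816375172302729204622,
  2502330124911699804198935073774257259859124134598290281363085898542032190453151931927514752250686173941292792911]],
  [[0, 0, 0, 31261492097], [0, 0, 493021140160389954], [0, 0, 7280595949243793672712963,
  116212379022645555111560780321604], [0, 1970588842664674474206134210480929940229,
  29624371380107908780811314867862342376815885062], [0,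
  456448863943325105670619545906005556632374880935220039,
  7845706253936488013048745660886014970143420485202332898036424,
  115564395312313571815713799787566045356001179371269319110633252913993], [0,
  1937425987317557048452577850561147081430270603499758186600673964799536040714,
  31967697257750835675108696023882470473400095978660643227052737113220031474466732811]], [[], [0, 0,
  28447034113], [0, 0, 355570988629420802], [0, 7119481547596512152255171, 94749885576475072757251850601220],
  [0, 0, 1527721162136943656598176955979203072709], [0, 26612758643283947285394678408052478730380110534,
  396041619557162205623128946639642644648585728229706503]], [[], [], [0, 0, 32838208065], [], [0, 0,
  333896734202812994]]], [[[], [0, 0, 32600243201, 535853925273187458], [0, 0, 5767774954714329430293507,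
  92110983926408328809403871316996, 1478460212927618976413714480969699771525], [0,
  30384315039613967623254637335092024982977821574, 431449101158910310582463401917123796154182354715587527,
  7769452400753953728183886067330204324123335653350318434137096], [0,
  138132544479950641981708507015355367652260550296526838170952659772297,
  2212881385487010949859918581393955204826706630757913669464076298312866155402,
  32840878540680761175292004763532905971777743048543292387135922597606485253829172107,
  532897783305202331296515999329533593858430069527560129150122035151906718647942973304190028],
  [10792611341121662114785936007800499490671130251327187327827217068754274895704934906756811584295821,
  151339560160015169818194307834392977590910637779630962722874058662191613142531710471831277906649616413646,
  2503885976629279950863769282931800420879653228136450969804739383022060267721997189261314903234280894930455593871,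
  41670298222232738182269428674265057889812212220741092001916702943699122460577329488575169944529144237371534532099703824]],
  [[], [0, 0, 25856879425, 435702427911646082], [0, 0, 8015473142230422699418307,
  146296587070041895067341019325188], [0, 1953501791525774636912309647935629660869,
  33745259057473141601685965565213793657043145414, 485447706370692434656905962639835153131216478239544135],
  [0, 7385246541821651129728296967643381268364190493202182667111176,
  125919002792877533234438615624584612762025892295236199819577605098185,
  1940574267743326893654266851078077947690654338033393844914670182599784727306],
  [33739110104393683730080706234759593028977293831364344125265054306650326806786358027,
  563525113116602187590355726117998600128631274376276499760014004380413170980502172540400332,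
  9080749392910613638199170923950106881945294610958011172418026470170291911567217198046367241351885,
  165950804679895109978541588633063117060824915447172549378967083814572977255021030711666596342603270488846]],
  [[], [0, 0, 26442771137], [0, 0, 467306936392088194, 6800024297843499266142851], [0,
  103485611913894927287299910457988, 1602898643556173154415155312211884370565], [0,
  25701373210574376482061440180004831770475803270, 405534253468422441438858066070321278668911531733029511,
  7094115362282711658230006489725815460512603901745430988581512], [0,
  113772042759121170999451816020082688322672791673336159240012557085321,
  1865734316512393716177381700581314592247197296977753320686166543961434176138]], [[], [0, 0, 32329949761],
  [0, 0, 451757394001846722], [0, 7854202648931179418386883, 122071122646775063888731250477508], [0, 0,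
  1782255353257094834850166942588831818117], [0, 29066994725447002605622689987327013042237364678,
  451719441375859052575328279706976722425135690841577927]]], [[[], [], [0, 0, 33155398337, 540338419435633410,
  9224129409191117669018435], [0, 116642447200012088726971434414788, 1968788752760885682386127445588543115973,
  26401661017139025328993899668545215527047019334], [0,
  460507542717967363449173816074337120856825742251967239,
  8037444478907975743119534555173985918570545780053863170859656,
  120807500392461445565225226026522678514920711563631256956821389679369,
  1970357894818583008666757855135335671494808179329394076237380171030536547146],
  [33387869076990105993373862150003553901100607945610984394556124697550449199379886859,
  548523823831380662332439418400085523245184749572656861245271976695437894611135799477848780,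
  8979733794474091741486206452708314705318009868228178339863683300905171021168167632805464625150669,
  151021930340289257728990625205100517515999443705415843023677531585305941370354029103674798054961833767758]],
  [[], [], [0, 0, 28586128001, 418179689497879170], [0, 5823278290230369185055363,
  92293222695172727292497342141060, 1853108298931367942308333680097205258885], [0,
  26382937276555887472508900505131227388559559302, 416700814555513006638868382933136936977280642223481479,
  6708172456316151971806129282860221676230886815008932852998792],
  [122045267136663235107153342964669199126168467576661069629139433065033,
  1884698373931761130318723687989917747144935662457427513925565015360305091210,
  31230771104575381059361135848896594806665512154852697162102854899743968443034718859,
  659124700777748622163630440554985908373456834370882190967411557036536727911690179007728204]], [[], [], [0,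
  0, 28138434945, 492100468740839938], [0, 7389088144955531734706563, 129525515554335227619543961557380], [0,
  1697746309501628311128750467659962554757, 29687912024041405779006090467402278337263141190,
  490416083207275728563200262088172030259634766908569991], [0,
  9620356066390386981660514760626930365581249523161331450161480,
  121794443071517916164525864340498610716353276145505485997305030988169]]], [[[], [], [], [0, 32371653249,
  347746010410246786, 6653720777757614036738691], [0, 104681404292885320742361230340740,
  1596255747031022775470795335800080904837, 26565502835639625464467223210870259112753828486,
  460062754454241367583555584852402349385826774202327687],
  [7212214804109912360759972005553025756564434038257466661102216,
  114057602139029533718802072064377154017974871737606552060387071812233,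
  1858574186450396437316334959588108436202657491277273443178292642827713735306,
  34760414284706972467866928031939066101295974902218326215907367314361430120834851467]], [[], [], [], [0,
  33597174145, 548715963862446466, 8586732514155408865544707], [0, 161357161834858934148218591844740,
  1976791877738555422770760917228967915845, 30552888426602979403818710686062256302515315078],
  [448879560351825679718128500371514379206386458084921799,
  9436461248100521812532213186783906131668874817531187367993672,
  140920605563580895025232643342310363411597402843113539218966356457801,
  2544943606024755627805448002630812559625198115346873615427790699072032317898]]], [[[], [], [], [], [0,
  30407877057, 522245787689947522, 6310833400044914255311299, 142154062255166350100673814917700],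
  [1511171203402533472359828650342708115973, 34044802932443368179983248987992264593937312134,
  427699936103342855211836952643758585625267907473082823,
  9885939863928477467148765241128491122628924784493002057011656]]]], [[[[29156281857, 0, 0,
  465538622814189058], [0, 0, 6418849376301580621104579], [0, 0, 156858586494354831079592272331908,
  1537997833968334539510580995636119041477], [0, 31082522082610159861029108656136661290439502982,
  484750655727659245210382086683781987174894133965497543], [0,
  10838195732965652453511728856519851470370731150284705377692744,
  131213999975816967281808123722279657866405066235465882713092584758345,
  2010383900980898442846084609146912941569160847212602421401428502339660045578],
  [53035437646280621675893402076210612747394905212940515718926015799727923931773652043,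
  654698925163072154350833771123252901764010828580568115262351834199374660957788935746425932,
  8880557486398790965912981539639011187918796590299418987747860176465689974569554933080185166355597],
  [152742065893505456450893742958917294736026394215931140992775468186478777886584892789264569375216275977486,
  2483662755647627104668998765009971562744107239635768062296867209844958468713561195690470889596273398366601753679,
  40561674276711931166888782183505475160832518997223783783237248711329419184318255622508073312258587639539286633005472848,
  682803878166522163268798628361049600658630948474444338211014885555010134128276143444649982422417495838573226577096265514204433]],
  [[], [0, 0, 30130462017], [0, 0, 324427944312442050], [0, 7034341237421370380284931,
  85555762215446484530719811749124], [0, 2563980291177761602951575621363442936837,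
  29493980506350247066566199437192041047948561414], [516186190116805048551415921195794440231723176063464519,
  7344140460579231359747335293316139082169711304461929302340616,
  115687229901158516108752425367877612220825779168904165804803833021577], [0,
  1923033260502067106872144133408816302482915190016001636435953651915721409546,
  32523151812205237566074574763687263333977922089453963852694748088940836579429266443]], [[], [], [0, 0,
  34034865089], [0, 469717954744316802], [0, 6774993226270754285435843, 104829607944912463294995061085124],
  [0, 1653897386112227567809340319496512033669], [0, 25917749529882009637086405027958020513262629830,
  399887876555927313789030374669217326133485866456857543]], [[], [], [], [0, 33616620481], [], [0,
  320602986546566082]]], [[[], [0, 0, 29615033601], [0, 0, 388168039031757954, 7976310721608772787676291], [0,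
  145762959184445179069063363918852, 2046039100974335488963052429995984395269], [0,
  34042834430573347153424545977867300796261737414, 521344560590028002189060961912126301656312311353912263,
  7232669054164634893309173233619395081752623399023651451534536],
  [133873384523683598232239997906038886577386455594141009560100705709065,
  2074228945955734507207763773159125157483202208153187814679955883832546931658,
  33954552028127352808636483578559920692584714611303092638751361319603577508705625099],
  [540715631181183864770826091936600692646864359694031991950747991270572546358509173928279180,
  8694986713830895930406251190035913040638567538963595048694102563385716618461569870334077932100685,
  146151093580828670474568654407463154879364320861706855592978997228724925835559457020672617333906732125198,
  2461406941844698547525214555495354507516600158432627486592111383791525298530737062924904382584013973889994081423]],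
  [[], [0, 0, 29123456129], [0, 0, 496165089055986562], [0, 8379386129167576686375683,
  87706073735723607000326885647364], [0, 2123194853197014625042042162618075876165,
  29197885657430593358590264487099161678607909702], [411318102021458620046263136686801907546294116981511175,
  6561658944672702272108284197159815307233648705749559619615688,
  111754062721593654670480699564979763359451917265999239551994526217161], [0,
  1861199002618820793295549125208596597631246686235143566767450414018459575178,
  31571836692637114587997856625123337033329829002522580724872964480711787940725257035]], [[], [], [0, 0,
  31425055489], [0, 407610153900047106], [0, 6200029512119996666641155, 111441649961282465604885171081988],
  [0, 1464842284398892430636701823450873223941], [0, 25083306353929806864752759454501953570059547398,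
  401038493670789682661190405226299538792247113482926855]], [[], [], [], [0, 29876679297], [], [0,
  342042670337520258]]], [[[], [], [0, 0, 27923796801, 538038375996980098], [0, 9016945064025464132930243,
  120225027424276885044081384088388], [0, 1779369853838708752558877794889343128325,
  30053149180054331200203741778852165103583408902, 661778652787321282504684946102133082541791035877473095],
  [7698376637502089279191644485688227911865969158949735153072904,
  122488382621952948212176141566795975873745473027067200628548949445321,
  1966916936822182710113658320856681274705363064816996807999234749460597537546],
  [32357826216260136055120072580985055177798180598451804215265267850360215267833611083,
  542842791029391313120656894785753655123372129336847968148058192774724703937059110790818572,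
  8866900331790757352860013718168628264732291052752338926774242077809880809014213829919295181568781,
  152381357737855681470477321397647927396282704877985989381659849373124410157070877699911212436816591405902]],
  [[], [], [0, 0, 32831959809], [0, 522370323218678466, 6101928092586957003084483], [0,
  115880428727920507176476493451908, 1679135363922814500250634353608736389765],
  [26619593826796057361322956447092913483490148998, 406237738018245779818430937270355495265689328620274311,
  7284532518287969117243160503702348945534490508564796137259656], [0,
  111121044866280174763401978680089803829067087220699850976906691826377,
  1847776188212003255654620938625080602433188520007123654529490237426013481674]], [[], [], [0, 0,
  28500265665], [0, 511045565967063490], [0, 7423288405911028358519299, 125350007942091203203935214754244],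
  [0, 1571253219771366949390925608708479312325], [0, 25998486193851977892077817484670426725600049670,
  422054337796953287442092678564499429391691118399054343]]], [[[], [], [], [0, 29206960961,
  353747393927160642], [0, 5674860520174083725099715, 89432817168488575690618735205060,
  1435795592472461462235664628026557580101], [26658680327801173771210732938160826350180004550,
  410014855398710792080072108301970445464573956049951431,
  6646173811550893410168830984606596971568943784837627386225352],
  [109151260274027647889349127746921040706551128981153537255532060382025,
  1934905774765298266769923726362512161794745203354933536568033694445729774218,
  31539657368792230751121636250775812877785967936727837348442092110682688385098508939,
  528095263496638493706686013145454592900279237102711784620563563436015298417377903365145420]], [[], [], [],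
  [0, 33621019009, 561322526387341826], [0, 8320729469920701069339011, 146544300050307982701541661041028],
  [1934425146937947147628642389901891453317, 29649326788642031771987310348169387629719492998,
  575644649996822454603565504835033412068963159247950215], [0,
  8780030529424881279824148311089210565376975558023778104791432,
  128458286694959248697039997091075742645421341126823124635258161760649]]], [[[], [], [], [], [0, 25909392001,
  321133544792693378, 7726847979421362759064131], [89663431171797382780434307154564,
  1666504754464487816462395806720426133893, 23428093898406685684295517871485997692778504838],
  [387990525793956423555830550866210702067028574883281607,
  6814746005489713135065938278495107161744393187581699684307464,
  112963251568103557034368195935753383704702784306309192140225543430665,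
  1843243682693139263874687753647875428815679792333255042818270552861959908042]]]], [[[[31440842241], [], [0,
  0, 449235701241056706], [0, 8658133749259494769896643], [0, 160654061388492430941595908027460,
  2669578459778898746439217770911423685829], [36028330866661164584242972395788983778730863750,
  443873455415115626936412342009351803039157177997784263],
  [9231821764751613255210402043049118757916791048494634330758344,
  184087315592434440951173218436076644932500090756810047486599820882953,
  1957990137164551180086918141499356397626129386669018616317152267027261521098],
  [35867151378347142354825312221589137474141639746621869299595841080694503846543551627,
  510481691009976343839397469910717697330569822849122700631166378720599251557435293537475724]], [[], [], [],
  [0, 27768706369], [0, 438693205996010690], [8931717147880813373064323, 131027137779447018333959749497988],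
  [0, 2507813643476829321550160264899503676485], [24948004903354098885326498135608753444230237318,
  418272290725388805590781745673305218102313074316944519]], [[], [], [], [], [0, 26155754561], [], [0,
  395762748943604738]]], [[[], [], [0, 0, 34146114881], [0, 356462658181166274], [0,
  6844321212763748024470595, 94077007102367377819810661682372], [1688890054899251949559818641737902451717,
  32206646838595609085171862478466411221682854918], [429434650228894449877664577094194661277598052303971399,
  7230051536089441931039810126111444236300759663272408987515848,
  112354363339384825603423429013804915186267437288136414544348914031753],
  [2020777509622923598917298257178258449682227482545616003602920040296482575370,
  31250665573068900994057473447258631051164808413740348217926209055469257893940716619]], [[], [], [], [0,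
  27311741953], [0, 510751933110029186], [7539259074094561617626051, 99802613366433885421034241954756], [0,
  1740147115643156674452860250764022686597], [24984896595321778176561854685505051528396157894,
  398195642390486755322796036325550715200470818113956807]], [[], [], [], [], [0, 33207225281], [], [0,
  320180945696680898]]], [[[], [], [0, 0, 26216596545], [0, 345719996682761218], [0,
  5167497692849837379955651, 146186913658277606390192122471364], [1559577359844603776595038239565912777605,
  33857924675861851489406840573250949564139674374], [405067489991697068396382622601723754080859323942663111,
  6635922908060628914896723408885065774819373694794574588541832,
  109693736650010576374006371220758621920335553044506642353483568030665],
  [1853556615668598598890664510633724345035594406563531202116714477234577384330,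
  31846368865499196011372214832372734299103935940984824897441002931760217210906370827]], [[], [], [], [0,
  28507159297], [0, 353035412273582850], [7687572676016951582540483, 93689435303211685919585288106756], [0,
  1453327548096644426742736271449303892741], [27146166258852250947110095481240419456831271622,
  397231144733786905487989440778433007894991151443317511]], [[], [], [], [], [0, 27102724737], [], [0,
  310508982685553282]]], [[[], [], [], [0, 28491058049], [0, 554025643312034434, 5104931510409760509365187],
  [87447934533244155926057792439044, 1513552026420455234881517821280757365445],
  [23258595122075403038614122417970689536639654726, 385985665129042639640875198265277561939502288724259655,
  6472528250308539910152838521954272538297564572931725835989896],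
  [116213200235950890222899571363638727179893618828684493696167982430857,
  1841269566134456824515881386628854678499236376574676857773980999389040779978]], [[], [], [], [0,
  33283785281], [0, 468682656523819458], [8352799680749605403593155, 127370762678982722035214648127940], [0,
  1557364634802666824984484430694654798277], [31620029896596183735688668803924581882593669574,
  450640214077938841932683860668115666548972259473482183]]], [[[], [], [], [], [0, 28221137281,
  515607923841704450], [7477689655217950327951747, 130121883322008612838082952565124],
  [1696738193508258713402215375467871158661, 29759218864727761609769551687151288316337586502,
  496615500119920746513267571450740117182040234145339783],
  [11067231847909261464942544687470696628730668274652832117190984,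
  135833322172839568130654499134179377457304828524574106901409155354953]]]], [[[[28531113601], [], [], [], [0,
  487520315237223746], [8047551967866330409872643], [124265335053380269292447944881412,
  1916870421621924915876315329908177835205], [24050037133758001799235549242807987974825227462],
  [427473267348848204564469239740704421200254345804309767,
  6443922676991300870000449004758069076500692295748237641917704]], [[], [], [], [], [], [28105760065], [],
  [470856832275387650]]], [[[], [], [], [], [0, 31364095233], [453902955955211458],
  [7923809776819629054647427, 115394645196735998064315287436420], [2213593604420168036846404776371262327877],
  [29413258770758484919594416536789036704897033286, 396991000181523415171662649781742439074543014295864519]],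
  [[], [], [], [], [], [26417532033], [], [491068046618891266]]], [[[], [], [], [], [0, 26383228033],
  [530912037851689922], [7128598836751467424418755, 88986297487063197474565840219204],
  [1391039461604955174006538442994992503813], [24075316407969658768841288219610813527179002822,
  388257340813206676744166307218440908020439785780304967]], [[], [], [], [], [], [33354480641], [],
  [494422954113573762]]], [[[], [], [], [], [0, 25967586305], [443381582956299074],
  [6160875726711975193871171, 104976668249280376704446318025540], [1408534745411846963642916211116570620741],
  [23966766339918496526537325249803617151325592390, 385477839189056770224053423924485125225132717453269959]],
  [[], [], [], [], [], [29142305409], [], [312102383065395842]]], [[[], [], [], [], [0, 26734040001],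
  [340376776015546946], [6234085047420335913296387, 83762480457353432957918054130372],
  [1407678818005041359551481557006085919301], [22985106124307869319854774080843787728616864518,
  384044699751114621067653442647447600663943671741823815]]]], [[[[28229140225], [], [], [], [], [],
  [575345061137184002], [], [5469426287857131007689987]]], [[[], [], [], [], [], [], [30818419969], [],
  [546373359219819714]]], [[[], [], [], [], [], [], [27768636545], [], [490604346169119810]]], [[[], [], [],
  [], [], [], [26785989633], [], [445188057992168386]]], [[[], [], [], [], [], [], [27662025473], [],
  [394871416264614658]]]]]

/-- Packed factors of the blocks of the second kind, odd part; see `dataP`. -/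
def dataQm : List (List (List (List (List ℕ)))) :=
  [[], [], [], [[[[0, 0, 0, 575516220275557570, 8672608399063076780901699, 134935866218355200571432899708228,
  1998327584664429719602447531707688027589], [0, 0, 44893061986618305742426224806357526098267341894,
  550600911259765060415852457800846887055517301449163911,
  7214047708273235348655141180871951570098230766153593515934984,
  133413234894329859805636502951211168627662313597509428085796236166473], [0, 0,
  1949158314321203924866012124258295383172247671593592306087012736109352322186,
  51195006538162418362484790796293935544054595316784035645196275247706816981720105995,
  533235269699624625054841836301165766376069047383120532905725434743369357244424891597325452,
  8904590585056710706728367922677861015941478189460142532246348788434245139139307857301420044715149,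
  144185285110111403601703272792214364695146963736525384571066869421641815866056268142357668817290716513742]],
  [[0, 0, 0, 28453813313, 379844330434671682, 6912479690465026720072771], [0, 0,
  118663841897456523672935699966852, 2086498804523559710221937330596069497733,
  24901260828404488005395843237739386397354413062, 409883730550010863086588890352536330910314390181600391],
  [0, 0, 6742190748003072656136700789847121283097818657525704808246216,
  119825544589972241840496191764640691122101473978056421753939891362633,
  1900093367601898330902400283890694328467635569592801338943675067612266691466,
  30913265561215453469756408570460265760953199733994274435667552589208720071102587979]], [[0, 0, 0,
  29390107457, 434917588904010562, 7267857256511850058529667], [0, 0, 108731508936271801029757015241476,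
  1555664802701374856211034025069488261893, 28682121952018966039813703875695111223170175814], [0, 0,
  406265737977072193582870181814528186240117485104648903,
  6775078870422065174235260631135194720394164581982865785764552,
  115857205793885779431008133953781781252044421814870026753350382093001,
  1941931320657730351906798610003640246710335434667561229053428978401956633418]], [[0, 0, 0, 32140808705,
  493115870629915202], [0, 0, 6822705574354104062900739, 139002167199055851941192331942340,
  1875756308415970176367630710012801989125], [0, 0, 30483718150181153834014631506619690495058835910,
  434892946367441298032837939771559384640425338841954759,
  8339017416097609340501547084200765334726015364551217640618440]], [[0, 0, 0, 32113193409,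
  561735972206256642], [0, 0, 8758776063919669500653955, 102455495083273833058791225074052], [0, 0,
  1666840957330091184589521910141315041669, 28624129392941131907041659351109544543475261766,
  464248210261705199894462728713765204094468417670846855]]], [[[], [0, 0, 27006249985, 445802709211202562,
  5649556779228862263127107, 116205641403278629689729427233860], [0, 0,
  1672609920412579044305940603585168466885, 35005110145809350142429108297769210584598352710,
  441816538049078445850383212076346328358841113134511047,
  6713327788187883916304674393858266081621630835967114530376712,
  120621121327051670048746497853461861925040730864606388447289587268681]], [[], [0, 0, 33141054273,
  343962900943862594, 6248418187714529200427843, 133572109434934237260068240622468], [0, 0,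
  1584256344956414942749262993092393816837, 24432800895728358865658933115360477557790176006,
  403442298828788981511347390301241037745489942747484935,
  7291103062326409137951423473750659443383686224308670902164232]], [[], [0, 0, 26706707009,
  566208071942681090, 8552817690411935171263043], [0, 0, 104540623645413320276306874763716,
  1641419313326862362960922445677197353413, 30040847432306261861214877941890920942097506758,
  523922054359047294091563333430160308143657391531768391]], [[], [0, 0, 28129606017, 384358540698859906,
  7860242099657640451199491], [0, 0, 104910894061996735405632423328068,
  1627633107889206938332123738433760780613, 28730000709403337412422728559762495553301412166]]], [[[], [], [0,
  0, 28429616065, 327267499353410498, 5560260032650054759115715, 99759984009131717318076033141700,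
  1569924443457718594245867292293446556677]], [[], [], [0, 0, 29021080193, 483065962072746562,
  5663960827175245197687427, 106117744011095732762337268904580]], [[], [], [0, 0, 30787871169,
  485408530497972674, 5882715971258017399146947, 102278668353838004062704814928452]]]], [[[[0, 0, 0,
  571991460874814786, 7070476122735933866902915, 134446278681862207366048841205252], [0, 0,
  2510322625231066333244458301025557677189, 27474543869665054732478075254164805721448776966,
  446139799533447412390246100914290855242283231788139847], [0, 0,
  8474182746664645428495235422670061268264991991614705357554824,
  131284737428080502178960142927636824166880415431172668605404706505801,
  2273772249703136181483007236944292066637661236025981860734823089149942170826,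
  31913473968736082418938185984310144009710999005986144744546972073733457459359516107], [0,
  597869741460995160897748018531275087183945512434711197713748694268301701171289057010910284,
  10882241833928161186678623670158368966081718501006225086484937010284670276802607653147955555206093,
  152421480384881485923913100001408710258249419133729853952451560262806676898586010899520829159428115661902,
  2450028321409791881334071694578608386231610457212750317013964528847995191680347254506146615240974484766292182287]],
  [[0, 0, 0, 29266154625, 450951230212357250], [0, 0, 8740692000463109203495811,
  89958186287425249516944866380932, 1463105775591144641832352018662442036421], [0, 0,
  32420210991186172015731959263074290344508431238, 505639939239947528800027576167547364553755418111335303,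
  6750914541584857487506592246380274481671370363059701478124552], [0,
  110659069582047242092414985055205729993388032309513586448344499346441,
  1924952376476484984958278763917606291417834443066710405247467269210368039818,
  30984929988680811723086598912231669501240534611638691957482526882205985439586053131,
  522263856713808141784891426409441245321699983986312509648148257805721393299160654670906444]], [[0, 0, 0,
  31151018945, 462376043102702466], [0, 0, 5347025402456138678334467, 89519802209836864192712017110020], [0,
  0, 1497730094430613062494314202734411979653, 25578806616177207766885548351079968882864554822,
  425182501947139856872704558519043926771203198003462983], [0,
  6745607485307841667496624949412459275111806042214549670386440,
  109899823354769727430553354491358574991291568598985352848633108724553,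
  1843992520324095758813819309656310606795191213605803951603738646860768938890]], [[0, 0, 0, 33423354497], [0,
  0, 476360002138700354, 8678166199997476224512643], [0, 0, 125040408063595008406355138886148,
  2011154325774984065434739781176564070917], [0, 30320273679966815703985711236417864687213021702,
  481635835788562078351979613141647725448044623461085639,
  8650869517149138686951841085833030417394021168577291805039112]], [[0, 0, 0, 30492095041], [0, 0,
  487727843870503426], [0, 0, 5650249753900125256137155, 118844879315131384262867522423236], [0, 0,
  1688159392498166315483431929775497236869]]], [[[], [0, 0, 29138945153, 354967500555463810,
  5133210384655269227263235], [0, 0, 159246366687513743761840469767044,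
  1880125099615871619087905888928274637765, 24183509955801773092009257010770930697034607686,
  398229670816146943655446065782526880413991956588326087], [0,
  6885777918367200695421200639727615982848138172150899720993736,
  114833251294515982448103492802456571619362436480954952912833330090889,
  1851130220999564255252820895163619886393861392816461378228131277786328290250,
  31119509374750763219015158154189530753444544147805309820998991419690935169580264523]], [[], [0, 0,
  26563257217, 429947218192261954, 7901641222605233939352451], [0, 0, 103767233566437451746880143176516,
  1517816694559462804405799784236425743173, 29420063845123666684295454501863158470075743046], [0,
  413042082040691611725459185722866095134083463324732103,
  6680376784502968894114604744153426695500615975102976931545864,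
  117358690188028570398800324489280498019135070065584970350027103468233,
  2052389026230532863430037282220436243788350544553634292163375117189940544330]], [[], [0, 0, 28002226753,
  485917229274770050], [0, 0, 8505588829495048002142723, 122977564738051429887597275425284,
  1524171743863219041646759161835491570309], [0, 31370891439157307466847909535963579762860788230,
  454719449131003317274820825161455473075647316172229063,
  7955502751039797767817604380843360693287590308571897503523336]], [[], [0, 0, 31358503425,
  477263514492293698], [0, 0, 8015407485719771249111491, 92886662822573600375664758534596], [0,
  1612792068103285395942925195741139769797, 29074728516249094107357046582877688857424593286,
  450700820343550628646082145383018362429614629397410247]]], [[[], [], [0, 0, 30998043585, 415952115430275970,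
  5532273560636287938601987, 105025115533347542457276091802628], [0, 1476903168383124237690603655310819771269,
  25543705708608787748198928859159375375152210758, 422064705259988823559722731036509801730537316597441351,
  6478394639642127740219138135519435725436139560253820143414344]], [[], [], [0, 0, 32805747265,
  481917757278612034, 7804081029277859703403139], [0, 108201222507746315336955751688708,
  1577635362399291730526055460807930157573, 29130709192246932732740086141445453531447857670,
  509039034941516021349154811688623143584884210388134535]], [[], [], [0, 0, 34059696513, 447280674281904514,
  8916223095546014567754243], [0, 103472611834250268286792253137284, 1774737694093294437480860284791605197125,
  29097617296443154611158046602790074700253497734]]], [[[], [], [], [0, 27600329409, 473120433273356930,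
  5466958233908887625323203, 102165059335211553808576482476740]], [[], [], [], [0, 26668038657,
  538003401772411330, 5611475620273336141191683, 98318372532653760433700725641860]]]], [[[[0, 0, 0,
  474482543475819842, 7337946200630609609491907], [0, 0, 160175792203314761338978756985988,
  2188473073432519560437293256179869287685], [0, 0, 43240667005978530106213400431767936363552310342,
  550732804524920973446700141420118332762029931253204103,
  9235191719510287759177955592487846829758852892526162632246536], [0,
  134596375280678481536812657923182107473065794545187951087141261411401,
  2170874981252408648727497157118839790134898077732288231494551266737659053130,
  32147236550805822525137764430372701234379048646974925619714291175283902128240723083], [0,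
  605171984382794382974631015137304923256166514461996809102252495312456537170511101484336140,
  9119883897355189092406689495404471896463544596966603496798370991720557443624291937934553036882957,
  148674651507320223246767809737456614725345174274113388514463857980509296009273277435150261211766687007822,
  2473274362400875325055518831398770064089698516141975477917734703711720473698678882271409020477827229373129819343]],
  [[0, 0, 0, 29396352065], [0, 0, 455146857283400642, 6085993939465572186655811], [0, 0,
  118282795016998477470397491215236, 1637616108914280901504418643059307414533], [0,
  26190538433870615023884436093953658051570822022, 423529998607639800758040492426602162828098280352957319,
  6749513018487420560939183265923169654197971700703371347956744], [0,
  119602643914119785705608778523828896105946057441259797541223218586505,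
  2073763069469037256631545307995548584521746471003395753339008105064707949322,
  31938517654718651028695855897471040247698379743585257800537051147463986048260692875]], [[0, 0, 0,
  26302452865], [0, 0, 349768847850099714], [0, 0, 5732254634440551254006659,
  116879804902549044109339562552132], [0, 1429443625142097488285219957805859412869,
  24594519199242049578332918052726103947643003718], [0,
  426337087823091317478139563620895680725793394338564871,
  6593064391552317871760658048556851323178598376828534089030472,
  112401119050883258724224259267300602788840584314795254019290733458249]], [[], [0, 0, 26180391617], [0, 0,
  563981018697015874], [0, 5667663419750824355172995, 94755832810028899244786248114820], [0, 0,
  1648849155198653738806201283314724604421]], [[], [], [0, 0, 31757236865], [], [0, 0, 442644190011953794]]],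
  [[[], [0, 0, 28236113025, 455383126853372994], [0, 0, 7994435286911220060400515,
  89442614083604000414665859388484, 1432421082481613212369929398008513293509], [0,
  25136518307023506221440961152004096006952371142, 450934612617134761733541035874061308016755493060526983,
  6560576264530188685452342307082336956814428071528477312611400], [0,
  113688765172115852135534029486161534460977888048246248112301015571337,
  1877885702844144461033345331563109597510513605963592941921255025348269020042,
  31447001931884065819820462072861386660253386645164376216811585683249773343368121227,
  517823280192156182247069818395878037289756565094891755403384774467201597653936666361889868]], [[], [0, 0,
  31858043713, 570231739155813186], [0, 0, 5846623794078224198523715, 97947232761589826118753945871172], [0,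
  1612455695458027293721975071907749135109, 25472564913334354797247559284365934147736384262,
  422830853100821559959264100458014412300251402115562247], [0,
  6877559939418975563505766781488163407703936862442719959339720,
  113001985093391082614296839988884570010112084930472986228904954847945,
  1944116372056266158511397051588306290915723777249085334988403567729256127178]], [[], [0, 0, 29688570497],
  [0, 0, 565360178570340866, 8891271125381616911483459], [0, 100498837930322502320643528694276,
  1846946805974307507936758305713639549445], [0, 27488558125389032492680914751075313636241363462,
  454783115493788891512916533140081736844248599035390407,
  7669420283215958826416704653219406531544235358674777741081096]], [[], [0, 0, 30876109377], [0, 0,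
  433861152986569218], [0, 5377242488195596997495235, 104001117743887541204571184660932], [0, 0,
  1611775349791510715662637274228561619333]]], [[[], [], [0, 0, 29738120001, 394022493302467394,
  9108472733208906340907843], [0, 102085820880980105483054118585092, 1564337884953688955143972100994830836485,
  33276930464731020158751852931323028782462937862], [0,
  407542268092898184723391425506141920847672265860141767,
  6756462883422919831685797000972258107920994527048186512831176,
  115604762210008038926663821157226534252846888308781784814468446644937,
  2070135141274113159809060406394915970991221578181879904900263801119460567818]], [[], [], [0, 0, 33383129601,
  502567651474250306], [0, 7282908026498411430384131, 111679351573466957060787529089540,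
  1653971707308987673192387055792468214341], [0, 31608155377464825800398207663707320688877257158,
  437376265807265062308735513598532267574681619549075911,
  8577928878462831635653993738045435317828357784082572834632136]], [[], [], [0, 0, 31027880385,
  530966514836767234], [0, 9207659755756406188554627, 106608455567748993682981759797636], [0,
  1688097896395936250531224297960119370117, 29303322078884854994785969048149402008679651654,
  468492456356760281866359537978840103211715827560556935]]], [[[], [], [], [0, 27577023041,
  435195965759083074, 8953535161391282110712387], [0, 109695386321358424989023356826052,
  1708296425710438346057560014871236569541, 31278007993670148983175904762160933125862726086,
  535936328987229841523839663415306410064777423345703495]], [[], [], [], [0, 28869325185, 405734181379350914,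
  8079683412743126852364803], [0, 107995937144270421253152155054404, 1660955321789631516981207091202164361541,
  29196171219819426443652172348674964822288243014]]], [[[], [], [], [], [0, 32334311873, 474661563616678338,
  5995943245145348597782979, 101708142338277085069979324473924]]]], [[[[0, 0, 0, 448122473754396226], [0, 0,
  7870260633789065299232195], [0, 0, 130871125772876854712692782400772,
  1698667309283042492646092894428630877637], [0, 44575524404430210104239137371025527293672948870,
  458748898870175384197210308228728106405217943410443527], [0,
  8991145667821277126491147732457566617838224377603098895451272,
  134793699554090571573778059222814908381475102205141287351469777880201,
  2871656282903285431137313479203820600969170034008186007429445732928652838154],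
  [34502982791335636342511052014046215561230077135433399596769347905721955500980962443,
  553233944806719305144149991122377233134678805447182375585906449460837879251385392178398284,
  8931039491354788715052752782864586041169973705169831126727501390654151242843326369878864958588045]], [[],
  [0, 0, 26093151553], [0, 0, 478097265605502146], [0, 6574707227853428419650563,
  102633135431708703491352984564932], [0, 1622005921203085369909354964942592312325,
  23661508571617458947401357553218266527454131270], [422015834570775499802389128096792706043812215451913223,
  7513247471033726852877124984673074172828199918115136058491784,
  111357560138820899814657237688651769285618642303923837270674305862729]], [[], [], [0, 0, 28897610753], [0,
  442090497709358018], [0, 8756134410188530186734467, 89812690189234274980599915961284], [0,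
  1471402737046295739435206075359070819205]], [[], [], [], [0, 31425643329], [], [0, 313180726634177282]]],
  [[[], [0, 0, 28817341633], [0, 0, 435849707422977090, 5487842185235288312138947], [0,
  95258242749402866461047516357636, 1678377092440603826013331682236298472517], [0,
  29969771471245360510476967960962496445557513094, 413468383208147860683046780446309836734420305844857799,
  6836023922582332208366594241065930694426919037693647013293064],
  [121744795144164622671734571514973418255072639811508696716612345000841,
  1977508732432649278883054608018881064291857269381528208760540709597880437578,
  31778880204953539364473774161172426964287343377918344185114703941133386947737113483]], [[], [0, 0,
  27955635201], [0, 0, 348526176492200962], [0, 9357679640241962370759491, 100269223922121457048411709440964],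
  [0, 1543060976628243025112002172306698408773, 25060627083333279512306412045154724665889721158],
  [392440067803848427129542544639277511905713605336234951,
  6591623088458381500175522327052120486051867213245181780972360,
  110387728439547580011911199416519406117607804752252076891656409492361]], [[], [], [0, 0, 33520923329], [0,
  471733772349717122], [0, 5893166861559403285357187, 92731810349866513154146723478148], [0,
  1738126480857813651026873358447081269765]], [[], [], [], [0, 25811878593], [], [0, 523640825638982210]]],
  [[[], [], [0, 0, 32633533313, 438210168844987330], [0, 6129400771330511029447555,
  96136224376591660661254218877892], [0, 1820242272034439402107727898478823566085,
  25397387118023305093549654033363794471181292358, 403166714097894555712915008108071428007850684937202567],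
  [6775194617045103332112003153750893993461656383402918745860872,
  111483107223113708743007673879295225225627050526379853000386729657161,
  1996579341924411747587178583960545572895904266500971023214625661653139577610]], [[], [], [0, 0,
  33157831297], [0, 463038972236952130, 7627911211741765735883395], [0, 115822262596713230533714416169476,
  1853667423618488771938139382257028250117], [30451913972758773881088449187820839629857200646,
  504907371692441238037765071311511653179379166998038983,
  8737725985193630468322387268245987752040640923102920522660360]], [[], [], [0, 0, 31983292993], [0,
  465183282760002050], [0, 5600827440262701869818307, 114364774332828736307920031906244], [0,
  1722019171909798328926072172304087845253]]], [[[], [], [], [0, 28684370561, 470010401663365954], [0,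
  5314122340577147040142019, 84238516663715828861314994625284, 1380211891359277109313241032587070534469],
  [23210081768282932960507080078498141007610899206, 420098529981013587666724855692178368747105672305388039,
  6507092920389300291972032320975496540211544415748902028968712]], [[], [], [], [0, 32094654977,
  480486700210778690], [0, 7920981468839025505135043, 91337255107005816119343784509892],
  [1601570864736257786811009817576015778245, 27658919820518733685232638464338126137967382918,
  451745703067061143901079268350485248325869293508565447]]], [[[], [], [], [], [0, 32431663489,
  434825989685082498, 9195868797045929716906499], [103961414159424052364648313035140,
  1767117835362319100593113267152801202501, 28911041836939798348263720091656314959590482310]]]], [[[[], [],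
  [0, 0, 453401813194900994], [0, 5972158636468477427189059], [0, 136135984134502401668966644712644,
  2367667162203190852349187795984362505541], [40640264229857682376702670995454241200154870982,
  571376736527883056042039642023920162815429060400776391],
  [8487637412033446810430304714423459530499060388584145815602440,
  118696791666544701730370160986765126078680030086558033549087924552777,
  2066614168987275587669838511150898025035219624767783457009168740658664441034]], [[], [], [], [0,
  32545877185], [0, 527582117067340866], [8372472056604236321887363, 93365839287010919527809857016964], [0,
  1559353927087719030337945359146873623557]], [[], [], [], [], [0, 29128242369], [], [0,
  351000254652038274]]], [[[], [], [0, 0, 27542682817], [0, 410523039881909378], [0,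
  8639697967028234907003907, 106349198727614720348147011122308], [1699697467841534148862677102760171834373,
  24239479475643241810371783644563900035974167558], [402091960061142288817799284117356240580876237550050311,
  6727828978682468744625909623572570041243787018890149305228232,
  114912916865031389738774745657054331251538432255076166658196000713737]], [[], [], [], [0, 31106151425], [0,
  509565900105038786], [5708494731974605567214531, 95222246538169428247068224617348], [0,
  1645268582125951406486985758848129743685]], [[], [], [], [], [0, 29222495041], [], [0,
  334089390078431938]]], [[[], [], [0, 0, 25932774593], [0, 348260277562676226], [0,
  5639052494331803570629507, 88529971415150091140976924367876], [1522576556810161716076019225048531792709,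
  24436551947137716214582441959286277499371801414], [421859456861670131936024155474602916700751783938112263,
  6461599258054588505652677258262968468971436146306121370993608,
  109859200059266820372958197397305342525666590236183451270334544618377]], [[], [], [], [0, 27840840385], [0,
  463962215797203586], [5715284314634721800759939, 93920813430865692391053308080772], [0,
  1605865212445502316568231612724210954757]], [[], [], [], [], [0, 31322514177], [], [0,
  393416534241663682]]], [[[], [], [], [0, 31639880385], [0, 569526878156691970, 8826468295949038867864131],
  [101161048830092646012863122041348, 1933236447835148729218452920115681602053],
  [24999351765926283704213469587723866031084802630, 447264100879343821518033088950769215461175173496775111,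
  7046124472273317226124006401706355186366397311149682703473224]], [[], [], [], [0, 29760141889], [0,
  545953718583429570], [5974495152648959318806915, 128828585642446167081322878284164], [0,
  1589103673554672157728983360888608606597]]], [[[], [], [], [], [0, 31891212737, 575582229472389634],
  [7526506500668304204626371, 93658382380057057158527754348996], [1652267640753676276952416568716790710661,
  31583099485834856863449620766667574418616670534, 464774532286275076685283112691666280787807865635836295]]]],
  [[[[], [], [], [], [0, 558540310498510146], [7593028921739004073739587], [156029157004594165783268463478020,
  1911572120936572338063270877453661242629], [30423902230919116836823935008824058562224325830]], [[], [], [],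
  [], [], [31509413121], [], [455047745603314818]]], [[[], [], [], [], [0, 28875951297], [533167469225811074],
  [7597426982302892679574595, 131335946477722909798255424982148], [1432719689604929527754691113254447770693]],
  [[], [], [], [], [], [30329296065], [], [465770158899162178]]], [[[], [], [], [], [0, 30130832385],
  [327382466071063554], [5792379433632339622996931, 93091828244828962588626947642308],
  [1799755133501620422223153183197077166917]], [[], [], [], [], [], [32538090497], [], [290255909760140226]]],
  [[[], [], [], [], [0, 27230098113], [396515703891944066], [6529622796182803070960195,
  94469355950284911570154687175300], [1597425784438651706630369398068755558917]], [[], [], [], [], [],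
  [28300315585], [], [314015786584765186]]], [[[], [], [], [], [0, 25788617537], [306598340501349122],
  [4874677523259501995072195, 84728006137229233478017971401412],
  [1498036787434815176033330446080731038149]]]], [[[[], [], [], [], [], [], [463131013631968642], [],
  [8123318235091782657377539]]], [[[], [], [], [], [], [], [31584369921], [], [510150064520289410]]], [[[],
  [], [], [], [], [], [30696955009], [], [439478533783192642]]], [[[], [], [], [], [], [], [33670800321], [],
  [419675373799029570]]], [[[], [], [], [], [], [], [31531119425], [], [489438864393470722]]]]]
/-- The modulus for signed arithmetic performed on natural numbers. -/
@[irreducible] def modulus : ℕ := Nat.pow 2 512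

/-- `force n f = f n`, arranged so that kernel reduction evaluates `n` first. -/
def force {α : Type} (n : ℕ) (f : ℕ → α) : α :=
  Nat.rec (f 0) (fun m _ => f (Nat.succ m)) n

/-- The entry of a list at a given position, or `d` past its end. -/
def nth {α : Type} (d : α) (l : List α) : ℕ → α :=
  List.rec (fun _ => d) (fun a _ ih n => Nat.rec a (fun m _ => ih m) n) l

/-- The first `n` base `2 ^ 24` digits of a number, scaled by `s` and shifted by `off`. -/
def digitList (s off n : ℕ) : ℕ → List ℕ :=
  Nat.rec (fun _ => []) (fun _ ih y =>
    force (Nat.add (Nat.mul (Nat.mod y 16777216) s) off) fun v =>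
      v :: force (Nat.div y 16777216) ih) n

/-- Unpack a row: six bits of length, five bits of exponent, then 24-bit offset digits.
Entry `x` of the result stands for the integer `x - modulus`. -/
def unpackRow (x : ℕ) : List ℕ :=
  force (Nat.mod (Nat.div x 64) 32) fun e =>
  force (Nat.pow 2 e) fun s =>
  force (Nat.sub modulus (Nat.mul 8388608 s)) fun off =>
  digitList s off (Nat.mod x 64) (Nat.div x 2048)

/-- The sum `∑ kᵢ * f gᵢ` over two lists of numbers `kᵢ` and objects `gᵢ`. -/
def zipSum {α : Type} (f : α → ℕ) (ks : List ℕ) : List α → ℕ :=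
  List.rec (fun _ => 0) (fun k _ ih gs =>
    List.rec 0 (fun g gs' _ => Nat.add (Nat.mul k (f g)) (ih gs')) gs) ks

def dotN (a b : List ℕ) : ℕ := zipSum (fun x => x) a b

def mapL {α β : Type} (f : α → β) (l : List α) : List β :=
  List.rec [] (fun a _ ih => f a :: ih) l

/-- Like `mapL`, but evaluates every entry before it is stored. -/
def mapF {α : Type} (f : α → ℕ) (l : List α) : List ℕ :=
  List.rec [] (fun a _ ih => force (f a) fun v => v :: ih) l

/-- The list `[f i, f (i + 1), …, f (i + n - 1)]`. -/
def tab {α : Type} (f : ℕ → α) (n : ℕ) : ℕ → List α :=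
  Nat.rec (fun _ => []) (fun _ ih i => f i :: force (Nat.succ i) ih) n

/-- Like `tab`, but evaluates every entry before it is stored. -/
def tabF (f : ℕ → ℕ) (n : ℕ) : ℕ → List ℕ :=
  Nat.rec (fun _ => []) (fun _ ih i => force (f i) fun v => v :: force (Nat.succ i) ih) n

def eN (k : ℕ) : ℕ → ℕ → ℕ → ℕ → ℕ :=
  Nat.rec (fun _ _ _ _ => 1) (fun _ ih p q r s =>
    Nat.mod (Nat.add
      (Nat.rec 0 (fun p' _ => Nat.rec 0 (fun s' _ =>
         Nat.mul (Nat.mul p s) (ih p' q r s')) s) p)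
      (Nat.rec 0 (fun q' _ => Nat.rec 0 (fun r' _ =>
         Nat.mul (Nat.mul q r) (Nat.mul (Nat.sub modulus 1) (ih p q' r' s))) r) q)) modulus) k

def eList (p q r s : ℕ) : List ℕ :=
  [eN 0 p q r s, eN 1 p q r s, eN 2 p q r s, eN 3 p q r s, eN 4 p q r s, eN 5 p q r s, eN 6 p q r s]

def rowOf (b : List (List ℕ)) (i j : ℕ) : List ℕ := unpackRow (nth 0 (nth [] b i) j)

def zB (data : List (List (List (List (List ℕ))))) (w i j i' j' : ℕ) : List (List ℕ) :=
  mapL (fun bk => mapF (fun b => dotN (rowOf b i j) (rowOf b i' j')) bk) (nth [] data w)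

def bilin (z : List (List ℕ)) (e e' : List ℕ) : ℕ := zipSum (fun zl => dotN e' zl) e z

def half (n : ℕ) : ℕ := Nat.div n 2

def gN (N11 N10 N01 N00 m11 m10 m01 m00 : ℕ) : ℕ :=
  force (Nat.sub N11 m11) fun n11 => force (Nat.sub N10 m10) fun n10 =>
  force (Nat.sub N01 m01) fun n01 => force (Nat.sub N00 m00) fun n00 =>
  force (Nat.add (Nat.add m11 m10) (Nat.add m01 m00)) fun w =>
  force (half (Nat.add m11 m10)) fun i => force (half (Nat.add m11 m01)) fun i' =>
  force (half (Nat.add n11 n10)) fun j => force (half (Nat.add n11 n01)) fun j' =>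
  Nat.mod (bilin (zB dataP w i j i' j') (eList m11 m10 m01 m00) (eList n11 n10 n01 n00)) modulus

def even2 (x y : ℕ) : Bool := Nat.beq (Nat.mod (Nat.add x y) 2) 0

def gTab (N11 N10 N01 N00 : ℕ) : List (List (List (List ℕ))) :=
  tab (fun m11 => tab (fun m10 => Bool.rec [] (tab (fun m01 => Bool.rec [] (tabF (fun m00 =>
    gN N11 N10 N01 N00 m11 m10 m01 m00) (Nat.succ N00) 0) (even2 m11 m01))
    (Nat.succ N01) 0) (even2 m11 m10)) (Nat.succ N10) 0) (Nat.succ N11) 0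

/-- The coefficients of `(1 + c * X) * l + c * a`, modulo `modulus`. -/
def krStep (c : ℕ) (l : List ℕ) : ℕ → List ℕ :=
  List.rec (fun a => force (Nat.mod (Nat.mul c a) modulus) fun v => [v]) (fun b _ ih a =>
    force (Nat.mod (Nat.add b (Nat.mul c a)) modulus) fun v => v :: ih b) l

/-- The coefficients of `(1 - X) ^ n1 * (1 + X) ^ n0`, modulo `modulus`. -/
def krN (n1 n0 : ℕ) : List ℕ :=
  Nat.rec (Nat.rec [1] (fun _ ih => krStep 1 ih 0) n0)
    (fun _ ih => krStep (Nat.sub modulus 1) ih 0) n1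

def ppAux (a1 a0 b1 b0 c1 c0 d1 d0 : ℕ) : ℕ :=
  force (Nat.add a1 a0) fun a => force (Nat.add b1 b0) fun b =>
  force (Nat.add c1 c0) fun c => force (Nat.add d1 d0) fun d =>
  zipSum (fun g => zipSum (fun g => zipSum (fun g => dotN (krN d1 d0) g) (krN c1 c0) g) (krN b1 b0) g)
    (krN a1 a0) (gTab a b c d)

def ppN (c0 c1 c2 c3 c4 c5 c6 c7 : ℕ) : ℕ := ppAux c6 c5 c7 c4 c2 c1 c3 c0

def rep (t i : ℕ) : ℕ := Nat.rec i (fun _ _ => Nat.sub t i) (Nat.sub (Nat.mul 2 i) t)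

def sgnN (t i : ℕ) : ℕ :=
  Nat.rec (Nat.rec 0 (fun _ _ => 1) (Nat.sub t (Nat.mul 2 i))) (fun _ _ => Nat.sub modulus 1)
    (Nat.sub (Nat.mul 2 i) t)

def qAux (p1 p2 p3 p4 q1 q2 q3 q4 : ℕ) : ℕ :=
  force (Nat.add p1 p2) fun i => force (Nat.add p1 p3) fun i' =>
  force (half (Nat.add q1 q2)) fun j => force (half (Nat.add q1 q3)) fun j' =>
  force (Nat.add i (Nat.add p3 p4)) fun t => force (half t) fun h =>
  force (rep t i) fun ri => force (rep t i') fun ri' =>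
  Nat.mod (Nat.add (bilin (zB dataQp h ri j ri' j') (eList p1 p2 p3 p4) (eList q1 q2 q3 q4))
    (Nat.mul (Nat.mul (sgnN t i) (sgnN t i'))
      (bilin (zB dataQm h ri j ri' j') (eList p1 p2 p3 p4) (eList q1 q2 q3 q4)))) modulus

def qN (c0 c1 c2 c3 c4 c5 c6 c7 : ℕ) : ℕ := qAux c7 c6 c5 c4 c3 c2 c1 c0

/-- The weight of a quadruple of words as a function of its eight cell sizes, modulo `modulus`. -/
def bN (c0 c1 c2 c3 c4 c5 c6 c7 : ℕ) : ℕ :=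
  Nat.add
    (Nat.mul 2 (Nat.add (ppN c0 c1 c2 c3 c4 c5 c6 c7)
      (Nat.add (ppN c0 c1 c4 c5 c2 c3 c6 c7) (ppN c0 c2 c4 c6 c1 c3 c5 c7))))
    (Nat.add
      (Nat.add (qN c0 c1 c2 c3 c4 c5 c6 c7)
        (Nat.add (qN c0 c1 c4 c5 c2 c3 c6 c7) (qN c0 c2 c4 c6 c1 c3 c5 c7)))
      (Nat.add (qN c0 c1 c7 c6 c2 c3 c5 c4)
        (Nat.add (qN c0 c2 c7 c5 c1 c3 c6 c4) (qN c0 c4 c7 c3 c1 c5 c6 c2))))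

/-- Tests whether a residue modulo `modulus` represents a nonpositive integer. -/
def nonposN (x : ℕ) : Bool :=
  Nat.ble (Nat.div modulus 2) (Nat.mod (Nat.add x (Nat.sub modulus 1)) modulus)

def allL (l : List ℕ) (f : ℕ → Bool) : Bool :=
  List.rec true (fun a _ ih => Bool.rec false ih (f a)) l

def imp (a b : Bool) : Bool := Bool.rec true b a

/-- The distances allowed in an even code of length 18 and minimum distance at least 6. -/
def dists : List ℕ := [6, 8, 10, 12, 14, 16, 18]

/-- Tests `f` on `0, …, n`. -/
def upto (n : ℕ) (f : ℕ → Bool) : Bool :=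
  Nat.rec (f 0) (fun m ih => Bool.rec false ih (f (Nat.succ m))) n

/-- Tests `f (x - y)`, provided that `y ≤ x`. -/
def subb (x y : ℕ) (f : ℕ → Bool) : Bool := imp (Nat.ble y x) (force (Nat.sub x y) f)

def keyN (a b c d e f : ℕ) : ℕ :=
  Nat.add f (Nat.mul 32 (Nat.add e (Nat.mul 32 (Nat.add d (Nat.mul 32 (Nat.add c
    (Nat.mul 32 (Nat.add b (Nat.mul 32 a)))))))))

/-- Tests whether a tuple of six distances is minimal under seven coordinate permutations
induced by permuting the four words. -/
def minimalKey (a b c d e f : ℕ) : Bool :=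
  force (keyN a b c d e f) fun k =>
  Bool.rec false
    (Bool.rec false
    (Bool.rec false
    (Bool.rec false
    (Bool.rec false
    (Bool.rec false
    (Nat.ble k (keyN a e d c b f)) (Nat.ble k (keyN a d e b c f)))
    (Nat.ble k (keyN d b f a e c))) (Nat.ble k (keyN b a c d f e)))
    (Nat.ble k (keyN e f c d a b))) (Nat.ble k (keyN c b a f e d)))
    (Nat.ble k (keyN a c b e d f))

/-- Tests `f` on all cell sizes with six prescribed pairwise distances. -/
def cellCheck (f : ℕ → ℕ → ℕ → ℕ → ℕ → ℕ → ℕ → ℕ → Bool) (A B bc C bd cd : ℕ) : Bool :=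
  subb (Nat.add A B) bc fun p2 => subb (Nat.add A C) bd fun q2 => subb (Nat.add B C) cd fun r2 =>
  force (half p2) fun p => force (half q2) fun q => force (half r2) fun r =>
  upto p fun s => subb p s fun c6 => subb q s fun c5 => subb r s fun c3 =>
  subb A (Nat.add c6 q) fun c4 => subb B (Nat.add c6 r) fun c2 => subb C (Nat.add c5 r) fun c1 =>
  subb 18 (Nat.add A (Nat.add c1 (Nat.add c2 c3))) fun c0 => f c0 c1 c2 c3 c4 c5 c6 s

def quadCheck (f : ℕ → ℕ → ℕ → ℕ → ℕ → ℕ → ℕ → ℕ → Bool) (A : ℕ) : Bool :=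
  allL dists fun B => imp (Nat.ble A B) (allL dists fun bc => imp (Nat.ble B bc)
    (allL dists fun C => imp (Nat.ble B C) (allL dists fun bd => imp (Nat.ble A bd)
    (allL dists fun cd => imp (Nat.ble A cd) (imp (minimalKey A B bc C bd cd)
    (cellCheck f A B bc C bd cd))))))

/-- The amount by which the weights attached to a pair of distinct words fall below zero. -/
def pairGap : ℕ := 540431456580168900015336522020

def quadLeaf (c0 c1 c2 c3 c4 c5 c6 c7 : ℕ) : Bool := nonposN (bN c0 c1 c2 c3 c4 c5 c6 c7)

def quadAll : Bool := allL dists (quadCheck quadLeaf)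

def tripleLeaf (c0 c1 c2 c3 : ℕ) : Bool :=
  nonposN (Nat.add (bN c0 c1 c2 c3 0 0 0 0)
    (Nat.add (bN c0 c1 c3 c2 0 0 0 0) (bN c0 c2 c3 c1 0 0 0 0)))

def tripleAll : Bool :=
  allL dists fun B => allL dists fun C => allL dists fun bc =>
  subb (Nat.add B C) bc fun p2 => force (half p2) fun p =>
  subb C p fun c1 => subb B p fun c2 => subb 18 (Nat.add B c1) fun c0 => tripleLeaf c0 c1 c2 p

def pairLeaf (d : ℕ) : Bool :=
  force (Nat.sub 18 d) fun c =>
  nonposN (Nat.add (Nat.add (Nat.mul 4 (bN c d 0 0 0 0 0 0)) (Nat.mul 3 (bN c 0 0 d 0 0 0 0))) pairGap)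

def pairAll : Bool := allL dists pairLeaf

def diagCheck : Bool :=
  nonposN (Nat.add (bN 18 0 0 0 0 0 0 0)
    (Nat.add (Nat.mul (Nat.sub modulus 1) (Nat.mul 673 pairGap)) 1))

theorem force_eq {α : Type} (n : ℕ) (f : ℕ → α) : force n f = f n := by
  cases n <;> rfl

theorem nth_eq {α : Type} (d : α) (l : List α) (n : ℕ) : nth d l n = l.getD n d := by
  induction l generalizing n with
  | nil => rfl
  | cons a l ih => cases n with
    | zero => rfl
    | succ n => exact ih n

theorem mapL_eq {α β : Type} (f : α → β) (l : List α) : mapL f l = l.map f := by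
  induction l with
  | nil => rfl
  | cons a l ih => exact congrArg (f a :: ·) ih

theorem mapF_eq {α : Type} (f : α → ℕ) (l : List α) : mapF f l = l.map f := by
  induction l with
  | nil => rfl
  | cons a l ih =>
    have h : mapF f (a :: l) = force (f a) (fun v => v :: mapF f l) := rfl
    rw [h, force_eq, ih]; rfl

theorem tab_succ {α : Type} (f : ℕ → α) (n i : ℕ) : tab f (n + 1) i = f i :: tab f n (i + 1) := by
  have h : tab f (n + 1) i = f i :: force (i + 1) (tab f n) := rfl
  rw [h, force_eq]

theorem tabF_eq (f : ℕ → ℕ) (n i : ℕ) : tabF f n i = tab f n i := by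
  induction n generalizing i with
  | zero => rfl
  | succ n ih =>
    have h : tabF f (n + 1) i = force (f i) (fun v => v :: force (i + 1) (tabF f n)) := rfl
    rw [h, force_eq, force_eq, ih, tab_succ]

theorem zipSum_nil {α : Type} (f : α → ℕ) (gs : List α) : zipSum f [] gs = 0 := rfl

theorem zipSum_nil_right {α : Type} (f : α → ℕ) (ks : List ℕ) : zipSum f ks [] = 0 := by
  cases ks <;> rfl

theorem zipSum_cons {α : Type} (f : α → ℕ) (k : ℕ) (ks : List ℕ) (g : α) (gs : List α) :
    zipSum f (k :: ks) (g :: gs) = k * f g + zipSum f ks gs := rfl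

/-- Coefficient list `l` applied to the values `h s, h (s + 1), …`. -/
def listSum {R : Type} [CommRing R] (l : List ℕ) (s : ℕ) (h : ℕ → R) : R :=
  match l with
  | [] => 0
  | a :: l => a * h s + listSum l (s + 1) h

theorem zipSum_tab {R : Type} [CommRing R] {α : Type} (f : α → ℕ) (g : ℕ → α) (ks : List ℕ) (n s : ℕ)
    (hn : ks.length ≤ n) :
    ((zipSum f ks (tab g n s) : ℕ) : R) = listSum ks s (fun j => (f (g j) : R)) := by
  induction ks generalizing n s with
  | nil => simp [zipSum_nil, listSum]
  | cons k ks ih =>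
    obtain ⟨n, rfl⟩ : ∃ m, n = m + 1 := ⟨n - 1, by simp at hn; omega⟩
    rw [tab_succ, zipSum_cons, listSum]
    push_cast
    rw [ih n (s + 1) (by simpa using hn)]

/-- `∑ (-1)^i h (i + j)` over subsets with `i` elements of an `n1`-set and `j` of an `n0`-set. -/
def signedSum {R : Type} [CommRing R] : ℕ → ℕ → (ℕ → R) → R
  | 0, 0, h => h 0
  | 0, n0 + 1, h => signedSum 0 n0 h + signedSum 0 n0 (fun j => h (j + 1))
  | n1 + 1, n0, h => signedSum n1 n0 h - signedSum n1 n0 (fun j => h (j + 1))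

theorem signedSum_add {R : Type} [CommRing R] (n1 n0 : ℕ) (g h : ℕ → R) :
    signedSum n1 n0 (fun j => g j + h j) = signedSum n1 n0 g + signedSum n1 n0 h := by
  induction n1 generalizing g h with
  | zero =>
    induction n0 generalizing g h with
    | zero => simp only [signedSum]
    | succ n ih => simp only [signedSum, ih]; ring
  | succ n ih => simp only [signedSum, ih]; ring

theorem signedSum_sub {R : Type} [CommRing R] (n1 n0 : ℕ) (g h : ℕ → R) :
    signedSum n1 n0 (fun j => g j - h j) = signedSum n1 n0 g - signedSum n1 n0 h := by
  induction n1 generalizing g h with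
  | zero =>
    induction n0 generalizing g h with
    | zero => simp only [signedSum]
    | succ n ih => simp only [signedSum, ih]; ring
  | succ n ih => simp only [signedSum, ih]; ring

theorem signedSum_succ_left {R : Type} [CommRing R] (n1 n0 : ℕ) (h : ℕ → R) :
    signedSum (n1 + 1) n0 h = signedSum n1 n0 h - signedSum n1 n0 (fun j => h (j + 1)) := by
  rw [signedSum]

theorem signedSum_succ_right {R : Type} [CommRing R] (n1 n0 : ℕ) (h : ℕ → R) :
    signedSum n1 (n0 + 1) h = signedSum n1 n0 h + signedSum n1 n0 (fun j => h (j + 1)) := by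
  induction n1 generalizing h with
  | zero => rw [signedSum]
  | succ n ih => simp only [signedSum_succ_left, ih]; ring

theorem signedSum_cast {R : Type} [CommRing R] (n1 n0 : ℕ) (h : ℕ → ℤ) :
    ((signedSum n1 n0 h : ℤ) : R) = signedSum n1 n0 (fun j => (h j : R)) := by
  induction n1 generalizing h with
  | zero =>
    induction n0 generalizing h with
    | zero => simp only [signedSum]
    | succ n ih => simp only [signedSum, Int.cast_add, ih]
  | succ n ih => simp only [signedSum, Int.cast_sub, ih]

theorem modulus_eq : modulus = 2 ^ 512 := by
  unfold modulus
  rfl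

theorem modulus_pos : 0 < modulus := by
  rw [modulus_eq]
  exact Nat.pow_pos (by norm_num)

theorem cast_modulus : ((modulus : ℕ) : ZMod modulus) = 0 := ZMod.natCast_self _

theorem cast_sub_one : ((Nat.sub modulus 1 : ℕ) : ZMod modulus) = -1 := by
  have : Nat.sub modulus 1 + 1 = modulus := Nat.sub_add_cancel modulus_pos
  have h : ((Nat.sub modulus 1 + 1 : ℕ) : ZMod modulus) = 0 := by rw [this, cast_modulus]
  push_cast at h
  linear_combination h

theorem cast_mod (n : ℕ) : ((Nat.mod n modulus : ℕ) : ZMod modulus) = n := ZMod.natCast_mod n modulus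

theorem krStep_nil (c a : ℕ) : krStep c [] a = [Nat.mod (c * a) modulus] := by
  have h : krStep c [] a = force (Nat.mod (c * a) modulus) fun v => [v] := rfl
  rw [h, force_eq]

theorem krStep_cons (c b a : ℕ) (l : List ℕ) :
    krStep c (b :: l) a = Nat.mod (b + c * a) modulus :: krStep c l b := by
  have h : krStep c (b :: l) a = force (Nat.mod (b + c * a) modulus) fun v => v :: krStep c l b := rfl
  rw [h, force_eq]

theorem krStep_length (c a : ℕ) (l : List ℕ) : (krStep c l a).length = l.length + 1 := by
  induction l generalizing a with
  | nil => rw [krStep_nil]; rfl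
  | cons b l ih => rw [krStep_cons, List.length_cons, ih, List.length_cons]

theorem listSum_krStep (c a s : ℕ) (l : List ℕ) (h : ℕ → ZMod modulus) :
    listSum (krStep c l a) s h = c * a * h s + listSum l s h + c * listSum l (s + 1) h := by
  induction l generalizing a s with
  | nil => rw [krStep_nil]; simp [listSum, cast_mod]
  | cons b l ih =>
    rw [krStep_cons, listSum, listSum, listSum, ih, cast_mod]
    push_cast
    ring

theorem listSum_shift {R : Type} [CommRing R] (l : List ℕ) (s : ℕ) (h : ℕ → R) :
    listSum l s (fun j => h (j + 1)) = listSum l (s + 1) h := by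
  induction l generalizing s with
  | nil => rfl
  | cons a l ih => simp only [listSum, ih]

theorem krN_length (n1 n0 : ℕ) : (krN n1 n0).length = n1 + n0 + 1 := by
  induction n1 with
  | zero =>
    induction n0 with
    | zero => rfl
    | succ n ih =>
      have h : krN 0 (n + 1) = krStep 1 (krN 0 n) 0 := rfl
      rw [h, krStep_length, ih]; omega
  | succ n ih =>
    have h : krN (n + 1) n0 = krStep (Nat.sub modulus 1) (krN n n0) 0 := rfl
    rw [h, krStep_length, ih]; omega

theorem listSum_krN (n1 n0 : ℕ) (h : ℕ → ZMod modulus) :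
    listSum (krN n1 n0) 0 h = signedSum n1 n0 h := by
  induction n1 generalizing h with
  | zero =>
    induction n0 generalizing h with
    | zero =>
      have e : krN 0 0 = [1] := rfl
      rw [e]; simp [listSum, signedSum]
    | succ n ih =>
      have e : krN 0 (n + 1) = krStep 1 (krN 0 n) 0 := rfl
      rw [e, listSum_krStep, ← listSum_shift, ih, ih, signedSum]
      simp
  | succ n ih =>
    have e : krN (n + 1) n0 = krStep (Nat.sub modulus 1) (krN n n0) 0 := rfl
    rw [e, listSum_krStep, ← listSum_shift, ih, ih, signedSum, cast_sub_one]
    simp [sub_eq_add_neg]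

theorem zipSum_krN {α : Type} (f : α → ℕ) (g : ℕ → α) (n1 n0 : ℕ) :
    ((zipSum f (krN n1 n0) (tab g (Nat.succ (n1 + n0)) 0) : ℕ) : ZMod modulus) =
      signedSum n1 n0 (fun j => (f (g j) : ZMod modulus)) := by
  rw [zipSum_tab _ _ _ _ _ (by rw [krN_length]), listSum_krN]

/-- The integer polynomial whose values are computed modulo `modulus` by `eN`. -/
def eZ : ℕ → ℕ → ℕ → ℕ → ℕ → ℤ
  | 0, _, _, _, _ => 1
  | k + 1, p, q, r, s => p * s * eZ k (p - 1) q r (s - 1) - q * r * eZ k p (q - 1) (r - 1) s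

theorem eN_cast (k p q r s : ℕ) : ((eN k p q r s : ℕ) : ZMod modulus) = (eZ k p q r s : ℤ) := by
  induction k generalizing p q r s with
  | zero =>
    have h : eN 0 p q r s = 1 := rfl
    rw [h]; simp [eZ]
  | succ k ih =>
    have h : eN (k + 1) p q r s = Nat.mod (Nat.add
      (Nat.rec 0 (fun p' _ => Nat.rec 0 (fun s' _ =>
         Nat.mul (Nat.mul p s) (eN k p' q r s')) s) p)
      (Nat.rec 0 (fun q' _ => Nat.rec 0 (fun r' _ =>
         Nat.mul (Nat.mul q r) (Nat.mul (Nat.sub modulus 1) (eN k p q' r' s))) r) q)) modulus := rfl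
    have h1 : ((Nat.rec 0 (fun p' _ => Nat.rec 0 (fun s' _ =>
         Nat.mul (Nat.mul p s) (eN k p' q r s')) s) p : ℕ) : ZMod modulus) =
         p * s * (eZ k (p - 1) q r (s - 1) : ℤ) := by
      cases p with
      | zero => simp
      | succ p => cases s with
        | zero => simp
        | succ s => exact (Nat.cast_mul _ _).trans (by rw [ih]; simp)
    have h2 : ((Nat.rec 0 (fun q' _ => Nat.rec 0 (fun r' _ =>
         Nat.mul (Nat.mul q r) (Nat.mul (Nat.sub modulus 1) (eN k p q' r' s))) r) q : ℕ) :
         ZMod modulus) = - (q * r * (eZ k p (q - 1) (r - 1) s : ℤ)) := by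
      cases q with
      | zero => simp
      | succ q => cases r with
        | zero => simp
        | succ r =>
          refine (Nat.cast_mul _ _).trans ?_
          rw [show Nat.mul (Nat.sub modulus 1) (eN k p q r s) = Nat.sub modulus 1 * eN k p q r s from rfl,
            Nat.cast_mul, cast_sub_one, ih]
          simp
    rw [h, cast_mod]
    refine (Nat.cast_add _ _).trans ?_
    rw [h1, h2, eZ]
    push_cast
    ring

theorem eZ_flip (k p q r s : ℕ) : eZ k s r q p = eZ k p q r s := by
  induction k generalizing p q r s with
  | zero => rfl
  | succ k ih => rw [eZ, eZ, ih (p - 1) q r (s - 1), ih p (q - 1) (r - 1) s]; ring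

theorem eZ_swap (k p q r s : ℕ) : eZ k p r q s = eZ k p q r s := by
  induction k generalizing p q r s with
  | zero => rfl
  | succ k ih => rw [eZ, eZ, ih (p - 1) q r (s - 1), ih p (q - 1) (r - 1) s]; ring

theorem eZ_abs_le (k p q r s : ℕ) (hp : p ≤ 18) (hq : q ≤ 18) (hr : r ≤ 18) (hs : s ≤ 18) :
    |eZ k p q r s| ≤ 2 ^ (10 * k) := by
  induction k generalizing p q r s with
  | zero => simp [eZ]
  | succ k ih =>
    rw [eZ]
    have h1 := ih (p - 1) q r (s - 1) (by omega) hq hr (by omega)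
    have h2 := ih p (q - 1) (r - 1) s hp (by omega) (by omega) hs
    have a1 : (p : ℤ) * s ≤ 18 * 18 := mul_le_mul (by exact_mod_cast hp) (by exact_mod_cast hs)
      (by positivity) (by norm_num)
    have a2 : (q : ℤ) * r ≤ 18 * 18 := mul_le_mul (by exact_mod_cast hq) (by exact_mod_cast hr)
      (by positivity) (by norm_num)
    have b1 : |(p : ℤ) * s * eZ k (p - 1) q r (s - 1)| ≤ 18 * 18 * 2 ^ (10 * k) := by
      rw [abs_mul, abs_of_nonneg (by positivity : (0 : ℤ) ≤ p * s)]
      exact mul_le_mul a1 h1 (abs_nonneg _) (by norm_num)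
    have b2 : |(q : ℤ) * r * eZ k p (q - 1) (r - 1) s| ≤ 18 * 18 * 2 ^ (10 * k) := by
      rw [abs_mul, abs_of_nonneg (by positivity : (0 : ℤ) ≤ q * r)]
      exact mul_le_mul a2 h2 (abs_nonneg _) (by norm_num)
    have : (0 : ℤ) ≤ 2 ^ (10 * k) := by positivity
    rw [show 10 * (k + 1) = 10 * k + 10 by ring, pow_add]
    refine (abs_sub _ _).trans ?_
    linarith

theorem zipSum_eq {α : Type} (f : α → ℕ) (d : α) (hd : f d = 0) (ks : List ℕ) (gs : List α) :
    zipSum f ks gs = ∑ i ∈ Finset.range ks.length, ks.getD i 0 * f (gs.getD i d) := by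
  induction ks generalizing gs with
  | nil => rfl
  | cons k ks ih =>
    rw [List.length_cons, Finset.sum_range_succ']
    cases gs with
    | nil => rw [zipSum_nil_right]; simp [hd]
    | cons g gs => rw [zipSum_cons, ih]; simp [add_comm]

/-- The integer vector represented by a list of residues. -/
def rowVec (l : List ℕ) (t : ℕ) : ℤ := (l.map fun x : ℕ => (x : ℤ) - modulus).getD t 0

theorem rowVec_cast (l : List ℕ) (t : ℕ) :
    ((rowVec l t : ℤ) : ZMod modulus) = (l.getD t 0 : ℕ) := by
  unfold rowVec
  by_cases h : t < l.length
  · simp [h]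
  · simp [not_lt.1 h]

theorem rowVec_of_le (l : List ℕ) (t : ℕ) (h : l.length ≤ t) : rowVec l t = 0 := by
  unfold rowVec
  simp [h]

theorem dotN_cast (a b : List ℕ) (h : a.length ≤ 64) :
    ((dotN a b : ℕ) : ZMod modulus) = ((∑ t ∈ Finset.range 64, rowVec a t * rowVec b t : ℤ) : ZMod modulus) := by
  have h1 : ∑ t ∈ Finset.range 64, rowVec a t * rowVec b t =
      ∑ t ∈ Finset.range a.length, rowVec a t * rowVec b t := by
    symm
    apply Finset.sum_subset (Finset.range_subset_range.2 h)
    intro t _ ht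
    rw [rowVec_of_le a t (by simpa using ht), zero_mul]
  rw [h1, dotN, zipSum_eq _ 0 rfl]
  push_cast
  exact Finset.sum_congr rfl fun t _ => by rw [rowVec_cast, rowVec_cast]

theorem digitList_zero (s off y : ℕ) : digitList s off 0 y = [] := rfl

theorem digitList_succ (s off n y : ℕ) :
    digitList s off (n + 1) y = (y % 16777216 * s + off) :: digitList s off n (y / 16777216) := by
  have h : digitList s off (n + 1) y = force (y % 16777216 * s + off) fun v =>
      v :: force (y / 16777216) (digitList s off n) := rfl
  rw [h, force_eq, force_eq]

theorem digitList_length (s off n y : ℕ) : (digitList s off n y).length = n := by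
  induction n generalizing y with
  | zero => rfl
  | succ n ih => rw [digitList_succ, List.length_cons, ih]

theorem mem_digitList {s off n y x : ℕ} (h : x ∈ digitList s off n y) :
    off ≤ x ∧ x < off + 16777216 * s ∨ x = off := by
  induction n generalizing y with
  | zero => simp [digitList_zero] at h
  | succ n ih =>
    rw [digitList_succ, List.mem_cons] at h
    rcases h with rfl | h
    · rcases Nat.eq_zero_or_pos s with rfl | hs
      · right; simp
      · left
        have := Nat.mul_lt_mul_of_pos_right (Nat.mod_lt y (by norm_num : 16777216 > 0)) hs
        omega
    · exact ih h

theorem unpackRow_eq (x : ℕ) : unpackRow x =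
    digitList (2 ^ (x / 64 % 32)) (modulus - 8388608 * 2 ^ (x / 64 % 32)) (x % 64) (x / 2048) := by
  simp only [unpackRow, force_eq]
  rfl

theorem unpackRow_length (x : ℕ) : (unpackRow x).length ≤ 64 := by
  rw [unpackRow_eq, digitList_length]
  omega

theorem rowVec_unpackRow_abs_le (x t : ℕ) : |rowVec (unpackRow x) t| ≤ 2 ^ 60 := by
  unfold rowVec
  by_cases h : t < (unpackRow x).length
  · have hm := List.getElem_mem h
    have e : ((unpackRow x).map fun x : ℕ => (x : ℤ) - modulus).getD t 0 =
        ((unpackRow x)[t] : ℤ) - modulus := by simp [h]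
    rw [e]
    generalize (unpackRow x)[t] = y at hm
    rw [unpackRow_eq] at hm
    have hm := mem_digitList hm
    have hs : 2 ^ (x / 64 % 32) ≤ 2 ^ 31 := Nat.pow_le_pow_right (by norm_num) (by omega)
    have hM : (2 : ℕ) ^ 60 ≤ modulus := by
      rw [modulus_eq]
      exact Nat.pow_le_pow_right (by norm_num) (by norm_num)
    generalize 2 ^ (x / 64 % 32) = s at hm hs
    rw [abs_le]
    generalize modulus = M at *
    omega
  · have e : ((unpackRow x).map fun x : ℕ => (x : ℤ) - modulus).getD t 0 = 0 := by
      simp [not_lt.1 h]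
    rw [e]; simp

/-- Entry `t` of row `(i, j)` in block `(w, k, l)` of a table. -/
def entry (data : List (List (List (List (List ℕ))))) (w k l i j t : ℕ) : ℤ :=
  rowVec (rowOf (((data.getD w []).getD k []).getD l []) i j) t

theorem entry_abs_le (data : List (List (List (List (List ℕ))))) (w k l i j t : ℕ) :
    |entry data w k l i j t| ≤ 2 ^ 60 := rowVec_unpackRow_abs_le _ _

/-- The Gram matrix of the rows of a block. -/
def gram (data : List (List (List (List (List ℕ))))) (w k l i j i' j' : ℕ) : ℤ :=
  ∑ t ∈ Finset.range 64, entry data w k l i j t * entry data w k l i' j' t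

theorem gram_comm (data : List (List (List (List (List ℕ))))) (w k l i j i' j' : ℕ) :
    gram data w k l i j i' j' = gram data w k l i' j' i j :=
  Finset.sum_congr rfl fun _ _ => mul_comm _ _

theorem gram_abs_le (data : List (List (List (List (List ℕ))))) (w k l i j i' j' : ℕ) :
    |gram data w k l i j i' j'| ≤ 2 ^ 126 := by
  refine (Finset.abs_sum_le_sum_abs _ _).trans ?_
  have : ∀ t ∈ Finset.range 64, |entry data w k l i j t * entry data w k l i' j' t| ≤ 2 ^ 120 := by
    intro t _
    rw [abs_mul, show (2 : ℤ) ^ 120 = 2 ^ 60 * 2 ^ 60 by norm_num]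
    exact mul_le_mul (entry_abs_le _ _ _ _ _ _ _) (entry_abs_le _ _ _ _ _ _ _) (abs_nonneg _)
      (by positivity)
  refine (Finset.sum_le_card_nsmul _ _ _ this).trans ?_
  simp

theorem rowOf_nil (i j : ℕ) : rowOf [] i j = [] := by
  rw [rowOf, nth_eq, nth_eq, List.getD_nil, List.getD_nil, unpackRow_eq]; rfl

theorem zB_getD (data : List (List (List (List (List ℕ))))) (w i j i' j' k l : ℕ) :
    ((((zB data w i j i' j').getD k []).getD l 0 : ℕ) : ZMod modulus) = (gram data w k l i j i' j' : ℤ) := by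
  have e : ((zB data w i j i' j').getD k []).getD l 0 =
      dotN (rowOf (((data.getD w []).getD k []).getD l []) i j)
        (rowOf (((data.getD w []).getD k []).getD l []) i' j') := by
    have h0 : dotN (rowOf [] i j) (rowOf [] i' j') = 0 := by rw [rowOf_nil]; rfl
    simp only [zB, mapL_eq, mapF_eq, nth_eq]
    rw [← List.getD_map (l := (data.getD w []).getD k [])
        (f := fun b => dotN (rowOf b i j) (rowOf b i' j')), h0,
      ← List.getD_map (l := data.getD w [])
        (f := fun bk => List.map (fun b => dotN (rowOf b i j) (rowOf b i' j')) bk), List.map_nil]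
  have hlen : (rowOf (((data.getD w []).getD k []).getD l []) i j).length ≤ 64 := unpackRow_length _
  rw [e, dotN_cast _ _ hlen]
  rfl

/-- The bilinear expression evaluated by `bilin`. -/
def form (data : List (List (List (List (List ℕ))))) (w i j i' j' p q r s p' q' r' s' : ℕ) : ℤ :=
  ∑ k ∈ Finset.range 7, ∑ l ∈ Finset.range 7,
    gram data w k l i j i' j' * (eZ k p q r s * eZ l p' q' r' s')

theorem eList_getD (p q r s k : ℕ) (hk : k < 7) : (eList p q r s).getD k 0 = eN k p q r s := by
  interval_cases k <;> rfl

theorem bilin_cast (data : List (List (List (List (List ℕ))))) (w i j i' j' p q r s p' q' r' s' : ℕ) :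
    ((bilin (zB data w i j i' j') (eList p q r s) (eList p' q' r' s') : ℕ) : ZMod modulus) =
      (form data w i j i' j' p q r s p' q' r' s' : ℤ) := by
  have h0 : dotN (eList p' q' r' s') [] = 0 := zipSum_nil_right _ _
  have len (p q r s : ℕ) : (eList p q r s).length = 7 := rfl
  rw [bilin, zipSum_eq _ [] h0, form, len]
  push_cast
  refine Finset.sum_congr rfl fun k hk => ?_
  rw [eList_getD _ _ _ _ _ (Finset.mem_range.1 hk), dotN, zipSum_eq _ 0 rfl, len]
  push_cast
  rw [Finset.mul_sum]
  refine Finset.sum_congr rfl fun l hl => ?_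
  rw [eList_getD _ _ _ _ _ (Finset.mem_range.1 hl), zB_getD, eN_cast, eN_cast]
  ring

theorem form_swap (data : List (List (List (List (List ℕ))))) (w i j i' j' p q r s p' q' r' s' : ℕ) :
    form data w i' j' i j p r q s p' r' q' s' = form data w i j i' j' p q r s p' q' r' s' := by
  unfold form
  refine Finset.sum_congr rfl fun k _ => Finset.sum_congr rfl fun l _ => ?_
  rw [gram_comm, eZ_swap k p q r s, eZ_swap l p' q' r' s']

theorem form_abs_le (data : List (List (List (List (List ℕ)))))
    (w i j i' j' p q r s p' q' r' s' : ℕ) (hp : p ≤ 18) (hq : q ≤ 18) (hr : r ≤ 18) (hs : s ≤ 18)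
    (hp' : p' ≤ 18) (hq' : q' ≤ 18) (hr' : r' ≤ 18) (hs' : s' ≤ 18) :
    |form data w i j i' j' p q r s p' q' r' s'| ≤ 2 ^ 256 := by
  have hterm : ∀ k ∈ Finset.range 7, ∀ l ∈ Finset.range 7,
      |gram data w k l i j i' j' * (eZ k p q r s * eZ l p' q' r' s')| ≤ 2 ^ 246 := by
    intro k hk l hl
    have hk' : (2 : ℤ) ^ (10 * k) ≤ 2 ^ 60 :=
      pow_le_pow_right₀ (by norm_num) (by have := Finset.mem_range.1 hk; omega)
    have hl' : (2 : ℤ) ^ (10 * l) ≤ 2 ^ 60 :=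
      pow_le_pow_right₀ (by norm_num) (by have := Finset.mem_range.1 hl; omega)
    rw [abs_mul, abs_mul, show (2 : ℤ) ^ 246 = 2 ^ 126 * (2 ^ 60 * 2 ^ 60) by norm_num]
    exact mul_le_mul (gram_abs_le _ _ _ _ _ _ _ _)
      (mul_le_mul ((eZ_abs_le k p q r s hp hq hr hs).trans hk')
        ((eZ_abs_le l p' q' r' s' hp' hq' hr' hs').trans hl') (abs_nonneg _) (by positivity))
      (by positivity) (by positivity)
  refine (Finset.abs_sum_le_sum_abs _ _).trans ?_
  refine (Finset.sum_le_card_nsmul _ _ (7 * 2 ^ 246) fun k hk => ?_).trans (by norm_num)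
  refine (Finset.abs_sum_le_sum_abs _ _).trans ?_
  exact (Finset.sum_le_card_nsmul _ _ _ (hterm k hk)).trans (by norm_num)

/-- Binary words of length 18. -/
abbrev Word := Fin 18 → Bool

/-- The coordinatewise sum of two words. -/
def diff (a b : Word) : Word := fun i => xor (a i) (b i)

/-- The number of coordinates in `A` where `x` takes value `s` and `y` takes value `t`. -/
def cell (A : Finset (Fin 18)) (x y : Word) (s t : Bool) : ℕ := (A.filter fun i => x i = s ∧ y i = t).card

def cellThree (A : Finset (Fin 18)) (x y z : Word) (s t r : Bool) : ℕ :=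
  (A.filter fun i => x i = s ∧ y i = t ∧ z i = r).card

/-- Cell sizes of a quadruple of words, relative to the first one. -/
def cnt (a b c d : Word) (s t r : Bool) : ℕ := cellThree Finset.univ (diff a b) (diff a c) (diff a d) s t r

/-- The sign `(-1)^s`. -/
def boolSign (s : Bool) : ℤ := if s then -1 else 1

theorem cell_empty (x y : Word) (s t : Bool) : cell ∅ x y s t = 0 := rfl

theorem cell_insert {A : Finset (Fin 18)} {k : Fin 18} (hk : k ∉ A) (x y : Word) (s t : Bool) :
    cell (insert k A) x y s t = cell A x y s t + if x k = s ∧ y k = t then 1 else 0 := by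
  unfold cell
  rw [Finset.filter_insert]
  split_ifs with h
  · rw [Finset.card_insert_of_notMem (by simp [hk])]
  · rfl

theorem cellThree_insert {A : Finset (Fin 18)} {k : Fin 18} (hk : k ∉ A) (x y z : Word) (s t r : Bool) :
    cellThree (insert k A) x y z s t r =
      cellThree A x y z s t r + if x k = s ∧ y k = t ∧ z k = r then 1 else 0 := by
  unfold cellThree
  rw [Finset.filter_insert]
  split_ifs with h
  · rw [Finset.card_insert_of_notMem (by simp [hk])]
  · rfl

/-- Signed sum over four independent subset sizes. -/
def signedSumFour {R : Type} [CommRing R] (a1 a0 b1 b0 c1 c0 d1 d0 : ℕ) (h : ℕ → ℕ → ℕ → ℕ → R) : R :=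
  signedSum a1 a0 fun i => signedSum b1 b0 fun j => signedSum c1 c0 fun k => signedSum d1 d0 fun l => h i j k l

theorem signedSum_zero {R : Type} [CommRing R] (n1 n0 : ℕ) :
    signedSum n1 n0 (fun _ => (0 : R)) = 0 := by
  simpa using signedSum_sub n1 n0 (fun _ => (0 : R)) (fun _ => 0)

theorem signedSum_neg {R : Type} [CommRing R] (n1 n0 : ℕ) (h : ℕ → R) :
    signedSum n1 n0 (fun j => -h j) = -signedSum n1 n0 h := by
  simpa [signedSum_zero] using signedSum_sub n1 n0 (fun _ => (0 : R)) h

theorem sum_powerset_sign (S : Finset (Fin 18)) (x y z : Word) (h : ℕ → ℕ → ℕ → ℕ → ℤ) :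
    ∑ u ∈ S.powerset, (∏ i ∈ u, boolSign (z i)) *
      h (cell u x y true true) (cell u x y true false) (cell u x y false true) (cell u x y false false) =
    signedSumFour
      (cellThree S x y z true true true) (cellThree S x y z true true false)
      (cellThree S x y z true false true) (cellThree S x y z true false false)
      (cellThree S x y z false true true) (cellThree S x y z false true false)
      (cellThree S x y z false false true) (cellThree S x y z false false false) h := by
  induction S using Finset.induction_on generalizing h with
  | empty => simp [signedSumFour, signedSum, cell_empty, cellThree]
  | insert k S hk ih =>
    rw [Finset.sum_powerset_insert hk, ih]
    have key : ∀ u ∈ S.powerset, (∏ i ∈ insert k u, boolSign (z i)) *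
        h (cell (insert k u) x y true true) (cell (insert k u) x y true false)
          (cell (insert k u) x y false true) (cell (insert k u) x y false false) =
        boolSign (z k) * ((∏ i ∈ u, boolSign (z i)) *
        h (cell u x y true true + if x k = true ∧ y k = true then 1 else 0)
          (cell u x y true false + if x k = true ∧ y k = false then 1 else 0)
          (cell u x y false true + if x k = false ∧ y k = true then 1 else 0)
          (cell u x y false false + if x k = false ∧ y k = false then 1 else 0)) := by
      intro u hu
      have hku : k ∉ u := fun h => hk (Finset.mem_powerset.1 hu h)
      rw [Finset.prod_insert hku, cell_insert hku, cell_insert hku, cell_insert hku, cell_insert hku,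
        mul_assoc]
    rw [Finset.sum_congr rfl key, ← Finset.mul_sum,
      ih (fun i j k' l => h (i + if x k = true ∧ y k = true then 1 else 0)
          (j + if x k = true ∧ y k = false then 1 else 0)
          (k' + if x k = false ∧ y k = true then 1 else 0)
          (l + if x k = false ∧ y k = false then 1 else 0))]
    simp only [cellThree_insert hk]
    cases x k <;> cases y k <;> cases z k <;>
      simp [boolSign, signedSumFour, signedSum_succ_left, signedSum_succ_right, signedSum_add,
        signedSum_neg, sub_eq_add_neg]

/-- The summand of the first certificate part attached to a coordinate set with cell sizes `m`
and complementary cell sizes `n`. -/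
def gateForm (m11 m10 m01 m00 n11 n10 n01 n00 : ℕ) : ℤ :=
  if (m11 + m10) % 2 = 0 ∧ (m11 + m01) % 2 = 0 then
    form dataP (m11 + m10 + (m01 + m00)) ((m11 + m10) / 2) ((n11 + n10) / 2)
      ((m11 + m01) / 2) ((n11 + n01) / 2) m11 m10 m01 m00 n11 n10 n01 n00
  else 0

/-- The first certificate part as a function of four words. -/
def ppW (a b c d : Word) : ℤ :=
  ∑ u ∈ (Finset.univ : Finset (Fin 18)).powerset, (∏ i ∈ u, boolSign (diff a c i)) *
    gateForm (cell u (diff a b) (diff c d) true true) (cell u (diff a b) (diff c d) true false)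
      (cell u (diff a b) (diff c d) false true) (cell u (diff a b) (diff c d) false false)
      (cell uᶜ (diff a b) (diff c d) true true) (cell uᶜ (diff a b) (diff c d) true false)
      (cell uᶜ (diff a b) (diff c d) false true) (cell uᶜ (diff a b) (diff c d) false false)

theorem cell_compl (u : Finset (Fin 18)) (x y : Word) (s t : Bool) :
    cell uᶜ x y s t = cell Finset.univ x y s t - cell u x y s t := by
  have h : cell u x y s t + cell uᶜ x y s t = cell Finset.univ x y s t := by
    unfold cell
    rw [← Finset.card_union_of_disjoint, ← Finset.filter_union, Finset.union_compl]
    exact Finset.disjoint_filter_filter disjoint_compl_right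
  omega

theorem cell_eq_add (S : Finset (Fin 18)) (x y z : Word) (s t : Bool) :
    cell S x y s t = cellThree S x y z s t true + cellThree S x y z s t false := by
  unfold cell cellThree
  rw [← Finset.card_union_of_disjoint, ← Finset.filter_or]
  · congr 1
    ext i
    cases h : z i <;> simp [h]
  · apply Finset.disjoint_filter.2
    rintro i _ ⟨_, _, h⟩ ⟨_, _, h'⟩
    simp [h] at h'

theorem gN_cast (N11 N10 N01 N00 m11 m10 m01 m00 : ℕ) :
    ((gN N11 N10 N01 N00 m11 m10 m01 m00 : ℕ) : ZMod modulus) =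
      (form dataP (m11 + m10 + (m01 + m00)) ((m11 + m10) / 2) ((N11 - m11 + (N10 - m10)) / 2)
      ((m11 + m01) / 2) ((N11 - m11 + (N01 - m01)) / 2) m11 m10 m01 m00
      (N11 - m11) (N10 - m10) (N01 - m01) (N00 - m00) : ℤ) := by
  simp only [gN, force_eq]
  rw [cast_mod, bilin_cast]
  rfl

theorem zipSum_boolRec {α : Type} (f : α → ℕ) (ks : List ℕ) (gs : List α) (b : Bool) :
    zipSum f ks (Bool.rec [] gs b) = if b = true then zipSum f ks gs else 0 := by
  cases b
  · exact zipSum_nil_right f ks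
  · rfl

theorem even2_eq (x y : ℕ) : even2 x y = true ↔ (x + y) % 2 = 0 := by
  unfold even2
  exact Nat.beq_eq ▸ Iff.rfl

theorem ppAux_cast (a1 a0 b1 b0 c1 c0 d1 d0 : ℕ) :
    ((ppAux a1 a0 b1 b0 c1 c0 d1 d0 : ℕ) : ZMod modulus) =
      (signedSumFour a1 a0 b1 b0 c1 c0 d1 d0 (fun i j k l => gateForm i j k l
        (a1 + a0 - i) (b1 + b0 - j) (c1 + c0 - k) (d1 + d0 - l)) : ℤ) := by
  simp only [ppAux, force_eq, signedSumFour]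
  rw [signedSum_cast]
  refine (zipSum_krN _ _ a1 a0).trans (congrArg _ (funext fun i => ?_))
  rw [signedSum_cast]
  refine (zipSum_krN _ _ b1 b0).trans (congrArg _ (funext fun j => ?_))
  rw [signedSum_cast, zipSum_boolRec]
  by_cases hj : (i + j) % 2 = 0
  · rw [if_pos ((even2_eq _ _).2 hj)]
    refine (zipSum_krN _ _ c1 c0).trans (congrArg _ (funext fun k => ?_))
    rw [signedSum_cast, dotN, zipSum_boolRec]
    by_cases hk : (i + k) % 2 = 0
    · rw [if_pos ((even2_eq _ _).2 hk), tabF_eq]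
      refine (zipSum_krN _ _ d1 d0).trans (congrArg _ (funext fun l => ?_))
      rw [gN_cast, gateForm, if_pos ⟨hj, hk⟩]
      rfl
    · rw [if_neg (fun h => hk ((even2_eq _ _).1 h))]
      simp [gateForm, hk, signedSum_zero]
  · rw [if_neg (fun h => hj ((even2_eq _ _).1 h))]
    simp [gateForm, hj, signedSum_zero]

/-- Evaluate a function of eight cell sizes at the cells of a quadruple of words. -/
def atCells {α : Type} (f : ℕ → ℕ → ℕ → ℕ → ℕ → ℕ → ℕ → ℕ → α) (a b c d : Word) : α :=
  f (cnt a b c d false false false) (cnt a b c d false false true)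
    (cnt a b c d false true false) (cnt a b c d false true true)
    (cnt a b c d true false false) (cnt a b c d true false true)
    (cnt a b c d true true false) (cnt a b c d true true true)

theorem cellThree_diff (a b c d : Word) (s t r : Bool) :
    cellThree Finset.univ (diff a b) (diff c d) (diff a c) s t r = cnt a b c d s r (xor t r) := by
  unfold cnt cellThree diff
  congr 1
  ext i
  simp only [Finset.mem_filter, Finset.mem_univ, true_and]
  cases a i <;> cases b i <;> cases c i <;> cases d i <;> revert s t r <;> decide

theorem ppN_cast (a b c d : Word) :
    ((atCells ppN a b c d : ℕ) : ZMod modulus) = (ppW a b c d : ℤ) := by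
  unfold atCells ppN ppW
  rw [ppAux_cast]
  simp only [cell_compl]
  rw [sum_powerset_sign Finset.univ (diff a b) (diff c d) (diff a c)
    (fun i j k l => gateForm i j k l
      (cell Finset.univ (diff a b) (diff c d) true true - i)
      (cell Finset.univ (diff a b) (diff c d) true false - j)
      (cell Finset.univ (diff a b) (diff c d) false true - k)
      (cell Finset.univ (diff a b) (diff c d) false false - l))]
  simp only [cell_eq_add _ (diff a b) (diff c d) (diff a c), cellThree_diff]
  rfl

/-- Sign of `t - 2 * i`. -/
def sgnZ (t i : ℕ) : ℤ := if t < 2 * i then -1 else if 2 * i < t then 1 else 0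

theorem sgnN_cast (t i : ℕ) : ((sgnN t i : ℕ) : ZMod modulus) = (sgnZ t i : ℤ) := by
  unfold sgnN sgnZ
  rcases h : Nat.sub (Nat.mul 2 i) t with _ | m
  · have h' : 2 * i - t = 0 := h
    rw [if_neg (by omega)]
    rcases g : Nat.sub t (Nat.mul 2 i) with _ | m
    · have g' : t - 2 * i = 0 := g
      rw [if_neg (by omega)]
      simp
    · have g' : t - 2 * i = m + 1 := g
      rw [if_pos (by omega)]
      simp
  · have h' : 2 * i - t = m + 1 := h
    rw [if_pos (by omega)]
    simpa using cast_sub_one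

theorem rep_eq (t i : ℕ) : rep t i = if t < 2 * i then t - i else i := by
  unfold rep
  rcases h : Nat.sub (Nat.mul 2 i) t with _ | m
  · have h' : 2 * i - t = 0 := h
    rw [if_neg (by omega)]
    rfl
  · have h' : 2 * i - t = m + 1 := h
    rw [if_pos (by omega)]
    rfl

/-- The second certificate part as a function of cell sizes. -/
def qForm (p1 p2 p3 p4 q1 q2 q3 q4 : ℕ) : ℤ :=
  form dataQp ((p1 + p2 + (p3 + p4)) / 2) (rep (p1 + p2 + (p3 + p4)) (p1 + p2)) ((q1 + q2) / 2)
      (rep (p1 + p2 + (p3 + p4)) (p1 + p3)) ((q1 + q3) / 2) p1 p2 p3 p4 q1 q2 q3 q4 +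
    sgnZ (p1 + p2 + (p3 + p4)) (p1 + p2) * sgnZ (p1 + p2 + (p3 + p4)) (p1 + p3) *
    form dataQm ((p1 + p2 + (p3 + p4)) / 2) (rep (p1 + p2 + (p3 + p4)) (p1 + p2)) ((q1 + q2) / 2)
      (rep (p1 + p2 + (p3 + p4)) (p1 + p3)) ((q1 + q3) / 2) p1 p2 p3 p4 q1 q2 q3 q4

theorem qAux_cast (p1 p2 p3 p4 q1 q2 q3 q4 : ℕ) :
    ((qAux p1 p2 p3 p4 q1 q2 q3 q4 : ℕ) : ZMod modulus) = (qForm p1 p2 p3 p4 q1 q2 q3 q4 : ℤ) := by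
  simp only [qAux, force_eq]
  rw [cast_mod]
  refine (Nat.cast_add _ _).trans ?_
  rw [show ∀ x y : ℕ, Nat.mul x y = x * y from fun _ _ => rfl, Nat.cast_mul,
    show ∀ x y : ℕ, Nat.mul x y = x * y from fun _ _ => rfl, Nat.cast_mul,
    bilin_cast, bilin_cast, sgnN_cast, sgnN_cast, qForm]
  push_cast
  rfl

/-- The support of the difference of two words. -/
def supp (a b : Word) : Finset (Fin 18) := Finset.univ.filter fun i => diff a b i = true

/-- The second certificate part as a function of four words. -/
def qW (a b c d : Word) : ℤ :=
  qForm (cell (supp a b) (diff a c) (diff a d) true true) (cell (supp a b) (diff a c) (diff a d) true false)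
    (cell (supp a b) (diff a c) (diff a d) false true) (cell (supp a b) (diff a c) (diff a d) false false)
    (cell (supp a b)ᶜ (diff a c) (diff a d) true true) (cell (supp a b)ᶜ (diff a c) (diff a d) true false)
    (cell (supp a b)ᶜ (diff a c) (diff a d) false true) (cell (supp a b)ᶜ (diff a c) (diff a d) false false)

theorem cell_supp (a b c d : Word) (s t : Bool) :
    cell (supp a b) (diff a c) (diff a d) s t = cnt a b c d true s t := by
  unfold cell cnt cellThree supp
  rw [Finset.filter_filter]

theorem cell_supp_compl (a b c d : Word) (s t : Bool) :
    cell (supp a b)ᶜ (diff a c) (diff a d) s t = cnt a b c d false s t := by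
  unfold cell cnt cellThree supp
  congr 1
  ext i
  simp

theorem qN_cast (a b c d : Word) :
    ((atCells qN a b c d : ℕ) : ZMod modulus) = (qW a b c d : ℤ) := by
  unfold atCells qN qW
  rw [qAux_cast]
  simp only [cell_supp, cell_supp_compl]

/-- Positive semidefiniteness of an integer kernel on a finite set. -/
def Psd {τ : Type} (S : Finset τ) (K : τ → τ → ℤ) : Prop :=
  ∀ f : τ → ℤ, 0 ≤ ∑ u ∈ S, ∑ v ∈ S, f u * f v * K u v

theorem psd_one {τ : Type} (S : Finset τ) : Psd S fun _ _ => 1 := by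
  intro f
  simp only [mul_one]
  rw [← Finset.sum_mul_sum]
  exact mul_self_nonneg _

theorem Psd.scale {τ : Type} {S : Finset τ} {K : τ → τ → ℤ} (hK : Psd S K) (g : τ → ℤ) :
    Psd S fun u v => g u * g v * K u v := by
  intro f
  refine (hK fun u => f u * g u).trans_eq ?_
  exact Finset.sum_congr rfl fun u _ => Finset.sum_congr rfl fun v _ => by ring

theorem Psd.sum {τ ι : Type} {S : Finset τ} (I : Finset ι) {K : ι → τ → τ → ℤ}
    (hK : ∀ i ∈ I, Psd S (K i)) : Psd S fun u v => ∑ i ∈ I, K i u v := by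
  intro f
  have h : ∑ u ∈ S, ∑ v ∈ S, f u * f v * ∑ i ∈ I, K i u v =
      ∑ i ∈ I, ∑ u ∈ S, ∑ v ∈ S, f u * f v * K i u v := by
    simp only [Finset.mul_sum]
    rw [Finset.sum_comm]
    rw [Finset.sum_congr rfl fun v _ => Finset.sum_comm]
    rw [Finset.sum_comm]
    exact Finset.sum_congr rfl fun i _ => Finset.sum_comm
  rw [h]
  exact Finset.sum_nonneg fun i hi => hK i hi f

theorem Psd.add {τ : Type} {S : Finset τ} {K L : τ → τ → ℤ} (hK : Psd S K) (hL : Psd S L) :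
    Psd S fun u v => K u v + L u v := by
  intro f
  simp only [mul_add, Finset.sum_add_distrib]
  exact add_nonneg (hK f) (hL f)

theorem Psd.sum_nonneg {τ : Type} {S : Finset τ} {K : τ → τ → ℤ} (hK : Psd S K) :
    0 ≤ ∑ u ∈ S, ∑ v ∈ S, K u v := by
  simpa using hK fun _ => 1

theorem cell_erase {A : Finset (Fin 18)} {a : Fin 18} (ha : a ∈ A) (x y : Word) (s t : Bool) :
    cell (A.erase a) x y s t = cell A x y s t - if x a = s ∧ y a = t then 1 else 0 := by
  have h := cell_insert (Finset.notMem_erase a A) x y s t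
  rw [Finset.insert_erase ha] at h
  omega

/-- `eZ` at the cell sizes of two words on a coordinate set. -/
def eCell (k : ℕ) (A : Finset (Fin 18)) (x y : Word) : ℤ :=
  eZ k (cell A x y true true) (cell A x y true false) (cell A x y false true) (cell A x y false false)

/-- Antisymmetric sign of an ordered pair of bits. -/
def bitSign (s t : Bool) : ℤ := (if s then 1 else 0) - if t then 1 else 0

theorem two_mul_eCell (k : ℕ) (A : Finset (Fin 18)) (x y : Word) :
    2 * eCell (k + 1) A x y = ∑ a ∈ A, ∑ b ∈ A,
      bitSign (x a) (x b) * bitSign (y a) (y b) * eCell k ((A.erase a).erase b) x y := by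
  have hsum : ∀ (s t : Bool), ∑ a ∈ A, (if x a = s ∧ y a = t then (1 : ℤ) else 0) = cell A x y s t :=
    fun s t => by rw [Finset.sum_boole]; rfl
  set P := eZ k (cell A x y true true - 1) (cell A x y true false) (cell A x y false true)
    (cell A x y false false - 1) with hP
  set Q := eZ k (cell A x y true true) (cell A x y true false - 1) (cell A x y false true - 1)
    (cell A x y false false) with hQ
  have key : ∀ a ∈ A, ∀ b ∈ A,
      bitSign (x a) (x b) * bitSign (y a) (y b) * eCell k ((A.erase a).erase b) x y =
      (if x a = true ∧ y a = true then 1 else 0) * ((if x b = false ∧ y b = false then 1 else 0) * P) +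
      (if x a = false ∧ y a = false then 1 else 0) * ((if x b = true ∧ y b = true then 1 else 0) * P) -
      (if x a = true ∧ y a = false then 1 else 0) * ((if x b = false ∧ y b = true then 1 else 0) * Q) -
      (if x a = false ∧ y a = true then 1 else 0) * ((if x b = true ∧ y b = false then 1 else 0) * Q) := by
    intro a ha b hb
    by_cases hab : a = b
    · subst hab
      cases x a <;> cases y a <;> simp [bitSign]
    · have hb' : b ∈ A.erase a := Finset.mem_erase.2 ⟨fun h => hab h.symm, hb⟩
      simp only [eCell, cell_erase hb', cell_erase ha, hP, hQ]
      cases x a <;> cases y a <;> cases x b <;> cases y b <;> simp [bitSign]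
  rw [Finset.sum_congr rfl fun a ha => Finset.sum_congr rfl fun b hb => key a ha b hb]
  simp only [Finset.sum_sub_distrib, Finset.sum_add_distrib, ← Finset.mul_sum, ← Finset.sum_mul, hsum]
  rw [eCell, eZ, ← hP, ← hQ]
  ring

theorem Psd.eCell_mul {τ : Type} {S : Finset τ} {K : τ → τ → ℤ} (hK : Psd S K) (X : τ → Word) (k : ℕ)
    (A : Finset (Fin 18)) : Psd S fun u v => eCell k A (X u) (X v) * K u v := by
  induction k generalizing A with
  | zero => simpa [eCell, eZ] using hK
  | succ k ih =>
    have h : Psd S fun u v => ∑ a ∈ A, ∑ b ∈ A,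
        bitSign (X u a) (X u b) * bitSign (X v a) (X v b) *
          (eCell k ((A.erase a).erase b) (X u) (X v) * K u v) :=
      Psd.sum A fun a _ => Psd.sum A fun b _ => (ih _).scale fun u => bitSign (X u a) (X u b)
    intro f
    have h2 : 2 * ∑ u ∈ S, ∑ v ∈ S, f u * f v * (eCell (k + 1) A (X u) (X v) * K u v) =
        ∑ u ∈ S, ∑ v ∈ S, f u * f v * ∑ a ∈ A, ∑ b ∈ A,
        bitSign (X u a) (X u b) * bitSign (X v a) (X v b) *
          (eCell k ((A.erase a).erase b) (X u) (X v) * K u v) := by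
      rw [Finset.mul_sum]
      refine Finset.sum_congr rfl fun u _ => ?_
      rw [Finset.mul_sum]
      refine Finset.sum_congr rfl fun v _ => ?_
      simp only [← mul_assoc, ← Finset.sum_mul]
      rw [← two_mul_eCell]
      ring
    have h3 := h f
    beta_reduce at h3 ⊢
    omega

/-- The number of coordinates of `A` in the support of `x`. -/
def wt (A : Finset (Fin 18)) (x : Word) : ℕ := (A.filter fun i => x i = true).card

theorem cell_add_left (A : Finset (Fin 18)) (x y : Word) :
    cell A x y true true + cell A x y true false = wt A x := by
  unfold cell wt
  rw [← Finset.card_union_of_disjoint, ← Finset.filter_or]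
  · congr 1
    ext i
    cases h : y i <;> simp [h]
  · apply Finset.disjoint_filter.2
    rintro i _ ⟨_, h⟩ ⟨_, h'⟩
    simp [h] at h'

theorem cell_swap (A : Finset (Fin 18)) (x y : Word) (s t : Bool) : cell A y x t s = cell A x y s t := by
  unfold cell
  simp only [and_comm]

theorem cell_add_right (A : Finset (Fin 18)) (x y : Word) :
    cell A x y true true + cell A x y false true = wt A y := by
  rw [← cell_add_left A y x, cell_swap A x y true true, cell_swap A x y false true]

theorem cell_total (A : Finset (Fin 18)) (x y : Word) :
    cell A x y true true + cell A x y true false + (cell A x y false true + cell A x y false false) =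
      A.card := by
  rw [cell_add_left]
  have h : cell A x y false true + cell A x y false false = (A.filter fun i => ¬ x i = true).card := by
    unfold cell
    rw [← Finset.card_union_of_disjoint, ← Finset.filter_or]
    · congr 1
      ext i
      cases h : y i <;> simp [h]
    · apply Finset.disjoint_filter.2
      rintro i _ ⟨_, h⟩ ⟨_, h'⟩
      simp [h] at h'
  rw [h, wt, Finset.card_filter_add_card_filter_not]

theorem psd_form {τ : Type} (S : Finset τ) (X : τ → Word) (A B : Finset (Fin 18))
    (data : List (List (List (List (List ℕ))))) (w : ℕ) (i j : τ → ℕ) :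
    Psd S fun u v => form data w (i u) (j u) (i v) (j v)
      (cell A (X u) (X v) true true) (cell A (X u) (X v) true false)
      (cell A (X u) (X v) false true) (cell A (X u) (X v) false false)
      (cell B (X u) (X v) true true) (cell B (X u) (X v) true false)
      (cell B (X u) (X v) false true) (cell B (X u) (X v) false false) := by
  have h : Psd S fun u v => ∑ k ∈ Finset.range 7, ∑ l ∈ Finset.range 7, ∑ t ∈ Finset.range 64,
      entry data w k l (i u) (j u) t * entry data w k l (i v) (j v) t *
        (eCell k A (X u) (X v) * (eCell l B (X u) (X v) * 1)) :=
    Psd.sum _ fun k _ => Psd.sum _ fun l _ => Psd.sum _ fun t _ =>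
      Psd.scale (((psd_one S).eCell_mul X l B).eCell_mul X k A) fun u => entry data w k l (i u) (j u) t
  simp only [mul_one, ← Finset.sum_mul] at h
  exact h

theorem prod_boolSign_diff (u : Finset (Fin 18)) (a c : Word) :
    ∏ i ∈ u, boolSign (diff a c i) = (∏ i ∈ u, boolSign (a i)) * ∏ i ∈ u, boolSign (c i) := by
  rw [← Finset.prod_mul_distrib]
  refine Finset.prod_congr rfl fun i _ => ?_
  unfold diff
  cases a i <;> cases c i <;> rfl

theorem ppW_eq (a b c d : Word) : ppW a b c d =
    ∑ u ∈ (Finset.univ : Finset (Fin 18)).powerset,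
      ((if wt u (diff a b) % 2 = 0 then 1 else 0) * ∏ i ∈ u, boolSign (a i)) *
      ((if wt u (diff c d) % 2 = 0 then 1 else 0) * ∏ i ∈ u, boolSign (c i)) *
      form dataP u.card (wt u (diff a b) / 2) (wt uᶜ (diff a b) / 2)
        (wt u (diff c d) / 2) (wt uᶜ (diff c d) / 2)
      (cell u (diff a b) (diff c d) true true) (cell u (diff a b) (diff c d) true false)
      (cell u (diff a b) (diff c d) false true) (cell u (diff a b) (diff c d) false false)
      (cell uᶜ (diff a b) (diff c d) true true) (cell uᶜ (diff a b) (diff c d) true false)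
      (cell uᶜ (diff a b) (diff c d) false true) (cell uᶜ (diff a b) (diff c d) false false) := by
  unfold ppW gateForm
  refine Finset.sum_congr rfl fun u _ => ?_
  rw [prod_boolSign_diff, cell_total, cell_add_left, cell_add_right, cell_add_left, cell_add_right]
  by_cases h1 : wt u (diff a b) % 2 = 0 <;> by_cases h2 : wt u (diff c d) % 2 = 0 <;> simp [h1, h2]

theorem sum_ppW_nonneg (C : Finset Word) :
    0 ≤ ∑ a ∈ C, ∑ b ∈ C, ∑ c ∈ C, ∑ d ∈ C, ppW a b c d := by
  have h : Psd (C ×ˢ C) fun u v : Word × Word => ppW u.1 u.2 v.1 v.2 := by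
    simp only [ppW_eq]
    exact Psd.sum _ fun u _ => (psd_form (C ×ˢ C) (fun v => diff v.1 v.2) u uᶜ dataP u.card
      (fun v => wt u (diff v.1 v.2) / 2) (fun v => wt uᶜ (diff v.1 v.2) / 2)).scale fun v =>
        (if wt u (diff v.1 v.2) % 2 = 0 then 1 else 0) * ∏ i ∈ u, boolSign (v.1 i)
  have := h.sum_nonneg
  simpa only [Finset.sum_product] using this

theorem qW_eq (a b c d : Word) : qW a b c d =
    form dataQp ((supp a b).card / 2) (rep (supp a b).card (wt (supp a b) (diff a c)))
        (wt (supp a b)ᶜ (diff a c) / 2)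
        (rep (supp a b).card (wt (supp a b) (diff a d))) (wt (supp a b)ᶜ (diff a d) / 2)
    (cell (supp a b) (diff a c) (diff a d) true true) (cell (supp a b) (diff a c) (diff a d) true false)
    (cell (supp a b) (diff a c) (diff a d) false true) (cell (supp a b) (diff a c) (diff a d) false false)
    (cell (supp a b)ᶜ (diff a c) (diff a d) true true) (cell (supp a b)ᶜ (diff a c) (diff a d) true false)
    (cell (supp a b)ᶜ (diff a c) (diff a d) false true)
    (cell (supp a b)ᶜ (diff a c) (diff a d) false false) +
    sgnZ (supp a b).card (wt (supp a b) (diff a c)) * sgnZ (supp a b).card (wt (supp a b) (diff a d)) *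
    form dataQm ((supp a b).card / 2) (rep (supp a b).card (wt (supp a b) (diff a c)))
        (wt (supp a b)ᶜ (diff a c) / 2)
        (rep (supp a b).card (wt (supp a b) (diff a d))) (wt (supp a b)ᶜ (diff a d) / 2)
    (cell (supp a b) (diff a c) (diff a d) true true) (cell (supp a b) (diff a c) (diff a d) true false)
    (cell (supp a b) (diff a c) (diff a d) false true) (cell (supp a b) (diff a c) (diff a d) false false)
    (cell (supp a b)ᶜ (diff a c) (diff a d) true true) (cell (supp a b)ᶜ (diff a c) (diff a d) true false)
    (cell (supp a b)ᶜ (diff a c) (diff a d) false true)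
    (cell (supp a b)ᶜ (diff a c) (diff a d) false false) := by
  unfold qW qForm
  rw [cell_total, cell_add_left, cell_add_right, cell_add_left, cell_add_right]

theorem sum_qW_nonneg (C : Finset Word) :
    0 ≤ ∑ a ∈ C, ∑ b ∈ C, ∑ c ∈ C, ∑ d ∈ C, qW a b c d := by
  refine Finset.sum_nonneg fun a _ => Finset.sum_nonneg fun b _ => ?_
  have h : Psd C (qW a b) := by
    rw [show qW a b = fun c d => qW a b c d from rfl]
    simp only [qW_eq]
    exact (psd_form C (diff a) (supp a b) (supp a b)ᶜ dataQp ((supp a b).card / 2)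
        (fun c => rep (supp a b).card (wt (supp a b) (diff a c)))
        (fun c => wt (supp a b)ᶜ (diff a c) / 2)).add
      ((psd_form C (diff a) (supp a b) (supp a b)ᶜ dataQm ((supp a b).card / 2)
        (fun c => rep (supp a b).card (wt (supp a b) (diff a c)))
        (fun c => wt (supp a b)ᶜ (diff a c) / 2)).scale fun c =>
          sgnZ (supp a b).card (wt (supp a b) (diff a c)))
  exact h.sum_nonneg

theorem diff_comm (a b : Word) : diff a b = diff b a := by
  funext i
  exact Bool.xor_comm _ _

theorem prod_boolSign (u : Finset (Fin 18)) (x : Word) : ∏ i ∈ u, boolSign (x i) = (-1) ^ wt u x := by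
  simp only [boolSign, wt]
  rw [Finset.prod_ite, Finset.prod_const, Finset.prod_const_one, mul_one]

theorem ppW_swap_left (a b c d : Word) : ppW b a c d = ppW a b c d := by
  rw [ppW_eq, ppW_eq]
  refine Finset.sum_congr rfl fun u _ => ?_
  rw [diff_comm b a]
  congr 2
  by_cases h : wt u (diff a b) % 2 = 0
  · have h1 : ∏ i ∈ u, boolSign (diff a b i) = 1 := by
      rw [prod_boolSign]
      exact Even.neg_one_pow (Nat.even_iff.2 h)
    rw [prod_boolSign_diff] at h1
    congr 1
    have h2 : (∏ i ∈ u, boolSign (a i)) * ∏ i ∈ u, boolSign (a i) = 1 := by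
      rw [← Finset.prod_mul_distrib]
      exact Finset.prod_eq_one fun i _ => by cases a i <;> rfl
    calc ∏ i ∈ u, boolSign (b i)
        = ((∏ i ∈ u, boolSign (a i)) * ∏ i ∈ u, boolSign (a i)) * ∏ i ∈ u, boolSign (b i) := by
          rw [h2, one_mul]
      _ = (∏ i ∈ u, boolSign (a i)) * ((∏ i ∈ u, boolSign (a i)) * ∏ i ∈ u, boolSign (b i)) := by ring
      _ = _ := by rw [h1, mul_one]
  · simp [h]

theorem ppW_swap_pairs (a b c d : Word) : ppW c d a b = ppW a b c d := by
  rw [ppW_eq, ppW_eq]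
  refine Finset.sum_congr rfl fun u _ => ?_
  rw [← form_swap]
  simp only [cell_swap _ (diff a b) (diff c d)]
  ring

theorem ppW_swap_right (a b c d : Word) : ppW a b d c = ppW a b c d := by
  rw [← ppW_swap_pairs, ppW_swap_left, ppW_swap_pairs]

theorem rep_sub {t i : ℕ} (h : i ≤ t) : rep t (t - i) = rep t i := by
  rw [rep_eq, rep_eq]
  split_ifs <;> omega

theorem sgnZ_sub {t i : ℕ} (h : i ≤ t) : sgnZ t (t - i) = -sgnZ t i := by
  unfold sgnZ
  split_ifs <;> omega

theorem form_flip (data : List (List (List (List (List ℕ))))) (w i j i' j' p q r s p' q' r' s' : ℕ) :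
    form data w i j i' j' s r q p p' q' r' s' = form data w i j i' j' p q r s p' q' r' s' := by
  unfold form
  simp only [eZ_flip]

theorem qForm_flip (p1 p2 p3 p4 q1 q2 q3 q4 : ℕ) :
    qForm p4 p3 p2 p1 q1 q2 q3 q4 = qForm p1 p2 p3 p4 q1 q2 q3 q4 := by
  unfold qForm
  rw [form_flip dataQp, form_flip dataQm, show p4 + p3 + (p2 + p1) = p1 + p2 + (p3 + p4) by ring]
  have e1 : p4 + p3 = p1 + p2 + (p3 + p4) - (p1 + p2) := by omega
  have e2 : p4 + p2 = p1 + p2 + (p3 + p4) - (p1 + p3) := by omega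
  rw [e1, e2, rep_sub (by omega), rep_sub (by omega), sgnZ_sub (by omega), sgnZ_sub (by omega), neg_mul_neg]

theorem qForm_swap (p1 p2 p3 p4 q1 q2 q3 q4 : ℕ) :
    qForm p1 p3 p2 p4 q1 q3 q2 q4 = qForm p1 p2 p3 p4 q1 q2 q3 q4 := by
  unfold qForm
  rw [form_swap dataQp, form_swap dataQm, show p1 + p3 + (p2 + p4) = p1 + p2 + (p3 + p4) by ring, mul_comm (sgnZ _ _)]

theorem qW_swap_right (a b c d : Word) : qW a b d c = qW a b c d := by
  unfold qW
  rw [← qForm_swap]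
  simp only [cell_swap _ (diff a c) (diff a d)]

theorem qW_swap_left (a b c d : Word) : qW b a c d = qW a b c d := by
  have h1 : ∀ s t, cell (supp b a) (diff b c) (diff b d) s t = cell (supp a b) (diff a c) (diff a d) (!s) (!t) := by
    intro s t
    unfold cell supp diff
    rw [Finset.filter_filter, Finset.filter_filter]
    congr 1
    ext i
    simp only [Finset.mem_filter, Finset.mem_univ, true_and]
    cases a i <;> cases b i <;> cases c i <;> cases d i <;> revert s t <;> decide
  have h2 : ∀ s t, cell (supp b a)ᶜ (diff b c) (diff b d) s t = cell (supp a b)ᶜ (diff a c) (diff a d) s t := by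
    intro s t
    unfold cell supp diff
    congr 1
    ext i
    simp only [Finset.mem_filter, Finset.mem_univ, true_and, Finset.mem_compl]
    cases a i <;> cases b i <;> cases c i <;> cases d i <;> revert s t <;> decide
  unfold qW
  simp only [h1, h2, Bool.not_true, Bool.not_false]
  rw [qForm_flip]

/-- The symmetrized certificate function of four words. -/
def bW (a b c d : Word) : ℤ :=
  2 * (ppW a b c d + (ppW a c b d + ppW a d b c)) +
    ((qW a b c d + (qW a c b d + qW a d b c)) + (qW b c a d + (qW b d a c + qW c d a b)))

theorem bW_swap_ab (a b c d : Word) : bW b a c d = bW a b c d := by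
  unfold bW
  rw [ppW_swap_left a b c d, qW_swap_left a b c d, ← ppW_swap_pairs a d b c, ← ppW_swap_pairs a c b d,
    qW_swap_right c d a b]
  ring

theorem bW_swap_bc (a b c d : Word) : bW a c b d = bW a b c d := by
  unfold bW
  rw [qW_swap_left b c a d, ppW_swap_right a d b c, qW_swap_right a d b c]
  ring

theorem bW_swap_cd (a b c d : Word) : bW a b d c = bW a b c d := by
  unfold bW
  rw [qW_swap_left c d a b, ppW_swap_right a b c d, qW_swap_right a b c d]
  ring

theorem sum_comm_inner {C : Finset Word} (F : Word → Word → Word → Word → ℤ) :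
    ∑ a ∈ C, ∑ b ∈ C, ∑ c ∈ C, ∑ d ∈ C, F a c b d = ∑ a ∈ C, ∑ b ∈ C, ∑ c ∈ C, ∑ d ∈ C, F a b c d :=
  Finset.sum_congr rfl fun _ _ => Finset.sum_comm

theorem sum_comm_last {C : Finset Word} (F : Word → Word → Word → Word → ℤ) :
    ∑ a ∈ C, ∑ b ∈ C, ∑ c ∈ C, ∑ d ∈ C, F a b d c = ∑ a ∈ C, ∑ b ∈ C, ∑ c ∈ C, ∑ d ∈ C, F a b c d :=
  Finset.sum_congr rfl fun _ _ => Finset.sum_congr rfl fun _ _ => Finset.sum_comm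

theorem sum_comm_first {C : Finset Word} (F : Word → Word → Word → Word → ℤ) :
    ∑ a ∈ C, ∑ b ∈ C, ∑ c ∈ C, ∑ d ∈ C, F b a c d = ∑ a ∈ C, ∑ b ∈ C, ∑ c ∈ C, ∑ d ∈ C, F a b c d :=
  Finset.sum_comm

theorem sum_bW_nonneg (C : Finset Word) :
    0 ≤ ∑ a ∈ C, ∑ b ∈ C, ∑ c ∈ C, ∑ d ∈ C, bW a b c d := by
  have hp := sum_ppW_nonneg C
  have hq := sum_qW_nonneg C
  have e2 : ∀ F : Word → Word → Word → Word → ℤ, ∑ a ∈ C, ∑ b ∈ C, ∑ c ∈ C, ∑ d ∈ C, F a d b c =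
      ∑ a ∈ C, ∑ b ∈ C, ∑ c ∈ C, ∑ d ∈ C, F a b c d := fun F =>
    (sum_comm_last fun a b c d => F a c b d).trans (sum_comm_inner F)
  have e3 : ∀ F : Word → Word → Word → Word → ℤ, ∑ a ∈ C, ∑ b ∈ C, ∑ c ∈ C, ∑ d ∈ C, F b c a d =
      ∑ a ∈ C, ∑ b ∈ C, ∑ c ∈ C, ∑ d ∈ C, F a b c d := fun F =>
    (sum_comm_first fun a b c d => F a c b d).trans (sum_comm_inner F)
  have e4 : ∀ F : Word → Word → Word → Word → ℤ, ∑ a ∈ C, ∑ b ∈ C, ∑ c ∈ C, ∑ d ∈ C, F b d a c =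
      ∑ a ∈ C, ∑ b ∈ C, ∑ c ∈ C, ∑ d ∈ C, F a b c d := fun F =>
    (sum_comm_first fun a b c d => F a d b c).trans (e2 F)
  have e5 : ∀ F : Word → Word → Word → Word → ℤ, ∑ a ∈ C, ∑ b ∈ C, ∑ c ∈ C, ∑ d ∈ C, F c d a b =
      ∑ a ∈ C, ∑ b ∈ C, ∑ c ∈ C, ∑ d ∈ C, F a b c d := fun F =>
    (sum_comm_inner fun a b c d => F b d a c).trans (e4 F)
  unfold bW
  simp only [Finset.sum_add_distrib, ← Finset.mul_sum]
  rw [sum_comm_inner ppW, e2 ppW, sum_comm_inner qW, e2 qW, e3 qW, e4 qW, e5 qW]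
  linarith

theorem ppW_abs_le (a b c d : Word) : |ppW a b c d| ≤ 2 ^ 274 := by
  have hc : ∀ A x y s t, cell A x y s t ≤ 18 := fun A x y s t =>
    (Finset.card_filter_le _ _).trans (Finset.card_le_univ A)
  rw [ppW_eq]
  refine (Finset.abs_sum_le_sum_abs _ _).trans ?_
  have hs : ∀ (u : Finset (Fin 18)) (x : Word), |∏ i ∈ u, boolSign (x i)| = 1 := fun u x => by
    rw [prod_boolSign]
    exact abs_neg_one_pow _
  have hterm : ∀ (e : Prop) [Decidable e] (g : ℤ), |g| = 1 → |(if e then 1 else 0) * g| ≤ 1 := by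
    intro e _ g hg
    split_ifs <;> simp [hg]
  refine (Finset.sum_le_card_nsmul _ _ (2 ^ 256) fun u _ => ?_).trans ?_
  · rw [abs_mul, abs_mul]
    refine (mul_le_mul (mul_le_mul (hterm _ _ (hs u a)) (hterm _ _ (hs u c)) (abs_nonneg _) zero_le_one)
      (form_abs_le _ _ _ _ _ _ _ _ _ _ _ _ _ _ (hc _ _ _ _ _) (hc _ _ _ _ _) (hc _ _ _ _ _) (hc _ _ _ _ _)
        (hc _ _ _ _ _) (hc _ _ _ _ _) (hc _ _ _ _ _) (hc _ _ _ _ _)) (abs_nonneg _) (by norm_num)).trans ?_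
    norm_num
  · rw [Finset.card_powerset, Finset.card_univ, Fintype.card_fin]
    norm_num

theorem qW_abs_le (a b c d : Word) : |qW a b c d| ≤ 2 ^ 257 := by
  have hc : ∀ A x y s t, cell A x y s t ≤ 18 := fun A x y s t =>
    (Finset.card_filter_le _ _).trans (Finset.card_le_univ A)
  have hs : ∀ t i, |sgnZ t i| ≤ 1 := fun t i => by
    unfold sgnZ
    split_ifs <;> simp
  have hf : ∀ data w i j i' j', |form data w i j i' j'
      (cell (supp a b) (diff a c) (diff a d) true true) (cell (supp a b) (diff a c) (diff a d) true false)
      (cell (supp a b) (diff a c) (diff a d) false true) (cell (supp a b) (diff a c) (diff a d) false false)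
      (cell (supp a b)ᶜ (diff a c) (diff a d) true true) (cell (supp a b)ᶜ (diff a c) (diff a d) true false)
      (cell (supp a b)ᶜ (diff a c) (diff a d) false true)
      (cell (supp a b)ᶜ (diff a c) (diff a d) false false)| ≤ 2 ^ 256 := fun data w i j i' j' =>
    form_abs_le _ _ _ _ _ _ _ _ _ _ _ _ _ _ (hc _ _ _ _ _) (hc _ _ _ _ _) (hc _ _ _ _ _) (hc _ _ _ _ _)
        (hc _ _ _ _ _) (hc _ _ _ _ _) (hc _ _ _ _ _) (hc _ _ _ _ _)
  unfold qW qForm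
  refine (abs_add_le _ _).trans ?_
  rw [abs_mul, abs_mul]
  have h1 := mul_le_mul (mul_le_mul (hs (supp a b).card (wt (supp a b) (diff a c)))
    (hs (supp a b).card (wt (supp a b) (diff a d))) (abs_nonneg _) zero_le_one)
    (hf dataQm ((supp a b).card / 2) (rep (supp a b).card (wt (supp a b) (diff a c)))
        (wt (supp a b)ᶜ (diff a c) / 2)
        (rep (supp a b).card (wt (supp a b) (diff a d))) (wt (supp a b)ᶜ (diff a d) / 2))
    (abs_nonneg _) (by norm_num)
  have h2 := hf dataQp ((supp a b).card / 2) (rep (supp a b).card (wt (supp a b) (diff a c)))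
        (wt (supp a b)ᶜ (diff a c) / 2)
        (rep (supp a b).card (wt (supp a b) (diff a d))) (wt (supp a b)ᶜ (diff a d) / 2)
  rw [cell_total, cell_add_left, cell_add_right, cell_add_left, cell_add_right]
  refine (add_le_add h2 h1).trans ?_
  norm_num

theorem bW_abs_le (a b c d : Word) : |bW a b c d| ≤ 2 ^ 280 := by
  have hp := fun a b c d => abs_le.1 (ppW_abs_le a b c d)
  have hq := fun a b c d => abs_le.1 (qW_abs_le a b c d)
  obtain ⟨p1, p1'⟩ := hp a b c d
  obtain ⟨p2, p2'⟩ := hp a c b d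
  obtain ⟨p3, p3'⟩ := hp a d b c
  obtain ⟨q1, q1'⟩ := hq a b c d
  obtain ⟨q2, q2'⟩ := hq a c b d
  obtain ⟨q3, q3'⟩ := hq a d b c
  obtain ⟨q4, q4'⟩ := hq b c a d
  obtain ⟨q5, q5'⟩ := hq b d a c
  obtain ⟨q6, q6'⟩ := hq c d a b
  unfold bW
  rw [abs_le]
  constructor <;> linarith

theorem nonposN_sound {x : ℕ} {y : ℤ} (h : nonposN x = true) (hxy : (x : ZMod modulus) = (y : ZMod modulus))
    (hy : |y| ≤ 2 ^ 300) : y ≤ 0 := by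
  by_contra hlt
  have h1 : modulus / 2 ≤ (x + (modulus - 1)) % modulus := Nat.le_of_ble_eq_true h
  have hm : (modulus : ℤ) = 2 ^ 512 := by rw [modulus_eq]; norm_num
  have hm' : modulus = 2 ^ 512 := modulus_eq
  lift y to ℕ using by omega
  have hx : x % modulus = y % modulus := by
    have : (x : ZMod modulus) = (y : ZMod modulus) := by exact_mod_cast hxy
    exact (ZMod.natCast_eq_natCast_iff _ _ _).1 this
  have hy' : y ≤ 2 ^ 300 := by
    rw [abs_of_nonneg (by positivity)] at hy
    exact_mod_cast hy
  have hy1 : 1 ≤ y := by omega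
  rw [Nat.add_mod, hx, ← Nat.add_mod, show y + (modulus - 1) = y - 1 + modulus by
      have := modulus_pos; omega, Nat.add_mod_right] at h1
  rw [hm'] at h1
  norm_num at h1 hy'
  omega

theorem cnt_acbd (a b c d : Word) (s t r : Bool) : cnt a c b d s t r = cnt a b c d t s r := by
  unfold cnt cellThree
  congr 1
  ext i
  simp only [Finset.mem_filter, Finset.mem_univ, true_and]
  tauto

theorem cnt_adbc (a b c d : Word) (s t r : Bool) : cnt a d b c s t r = cnt a b c d t r s := by
  unfold cnt cellThree
  congr 1
  ext i
  simp only [Finset.mem_filter, Finset.mem_univ, true_and]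
  tauto

theorem cnt_bcad (a b c d : Word) (s t r : Bool) :
    cnt b c a d s t r = cnt a b c d t (xor s t) (xor t r) := by
  unfold cnt cellThree diff
  congr 1
  ext i
  simp only [Finset.mem_filter, Finset.mem_univ, true_and]
  cases a i <;> cases b i <;> cases c i <;> cases d i <;> revert s t r <;> decide

theorem cnt_bdac (a b c d : Word) (s t r : Bool) :
    cnt b d a c s t r = cnt a b c d t (xor t r) (xor s t) := by
  unfold cnt cellThree diff
  congr 1
  ext i
  simp only [Finset.mem_filter, Finset.mem_univ, true_and]
  cases a i <;> cases b i <;> cases c i <;> cases d i <;> revert s t r <;> decide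

theorem cnt_cdab (a b c d : Word) (s t r : Bool) :
    cnt c d a b s t r = cnt a b c d (xor t r) t (xor s t) := by
  unfold cnt cellThree diff
  congr 1
  ext i
  simp only [Finset.mem_filter, Finset.mem_univ, true_and]
  cases a i <;> cases b i <;> cases c i <;> cases d i <;> revert s t r <;> decide

theorem bN_cast (a b c d : Word) : ((atCells bN a b c d : ℕ) : ZMod modulus) = (bW a b c d : ℤ) := by
  have p1 := ppN_cast a b c d
  have p2 := ppN_cast a c b d
  have p3 := ppN_cast a d b c
  have q1 := qN_cast a b c d
  have q2 := qN_cast a c b d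
  have q3 := qN_cast a d b c
  have q4 := qN_cast b c a d
  have q5 := qN_cast b d a c
  have q6 := qN_cast c d a b
  unfold atCells at *
  simp only [cnt_acbd a b c d, cnt_adbc a b c d, cnt_bcad a b c d, cnt_bdac a b c d, cnt_cdab a b c d,
    Bool.xor_false, Bool.xor_true, Bool.not_false, Bool.not_true] at p2 p3 q2 q3 q4 q5 q6
  unfold bN bW
  simp only [Nat.add_eq, Nat.mul_eq]
  push_cast
  rw [p1, p2, p3, q1, q2, q3, q4, q5, q6]

theorem cnt_eq_sum (a b c d : Word) (s t r : Bool) : cnt a b c d s t r =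
    ∑ i, if diff a b i = s ∧ diff a c i = t ∧ diff a d i = r then 1 else 0 := by
  unfold cnt cellThree
  exact Finset.card_filter _ _

theorem hammingDist_eq_sum (a b : Word) : hammingDist a b = ∑ i, if a i ≠ b i then 1 else 0 :=
  Finset.card_filter _ _

/-- The cell sizes of a quadruple determine its distances. -/
theorem cnt_dist (a b c d : Word) :
    hammingDist a b = cnt a b c d true false false + cnt a b c d true false true +
      cnt a b c d true true false + cnt a b c d true true true ∧
    hammingDist a c = cnt a b c d false true false + cnt a b c d false true true +
      cnt a b c d true true false + cnt a b c d true true true ∧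
    hammingDist a d = cnt a b c d false false true + cnt a b c d false true true +
      cnt a b c d true false true + cnt a b c d true true true ∧
    hammingDist b c = cnt a b c d false true false + cnt a b c d false true true +
      cnt a b c d true false false + cnt a b c d true false true ∧
    hammingDist b d = cnt a b c d false false true + cnt a b c d false true true +
      cnt a b c d true false false + cnt a b c d true true false ∧
    hammingDist c d = cnt a b c d false false true + cnt a b c d false true false +
      cnt a b c d true false true + cnt a b c d true true false ∧
    cnt a b c d false false false + cnt a b c d false false true + cnt a b c d false true false +
      cnt a b c d false true true + cnt a b c d true false false + cnt a b c d true false true +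
      cnt a b c d true true false + cnt a b c d true true true = 18 := by
  simp only [hammingDist_eq_sum, cnt_eq_sum, ← Finset.sum_add_distrib]
  refine ⟨?_, ?_, ?_, ?_, ?_, ?_, Eq.trans (b := ∑ _i : Fin 18, 1) ?_ (by simp)⟩ <;>
  · refine Finset.sum_congr rfl fun i _ => ?_
    unfold diff
    cases a i <;> cases b i <;> cases c i <;> cases d i <;> rfl

theorem allL_sound {l : List ℕ} {f : ℕ → Bool} (h : allL l f = true) {x : ℕ} (hx : x ∈ l) : f x = true := by
  induction l with
  | nil => simp at hx
  | cons a l ih =>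
    have h' : (Bool.rec false (allL l f) (f a) : Bool) = true := h
    cases hf : f a with
    | false => rw [hf] at h'; cases h'
    | true =>
      rw [hf] at h'
      rcases List.mem_cons.1 hx with rfl | hx
      · exact hf
      · exact ih h' hx

theorem imp_sound {a b : Bool} (h : imp a b = true) (ha : a = true) : b = true := by
  subst ha
  exact h

theorem upto_sound {n : ℕ} {f : ℕ → Bool} (h : upto n f = true) {m : ℕ} (hm : m ≤ n) : f m = true := by
  induction n with
  | zero =>
    obtain rfl : m = 0 := by omega
    exact h
  | succ n ih =>
    have h' : (Bool.rec false (upto n f) (f (n + 1)) : Bool) = true := h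
    cases hf : f (n + 1) with
    | false => rw [hf] at h'; cases h'
    | true =>
      rw [hf] at h'
      rcases Nat.le_succ_iff.1 hm with hm | rfl
      · exact ih h' hm
      · exact hf

theorem subb_sound {x y z : ℕ} {f : ℕ → Bool} (h : subb x y f = true) (hz : x = z + y) : f z = true := by
  subst hz
  have h' := imp_sound h (Nat.ble_eq_true_of_le (Nat.le_add_left y z))
  rw [force_eq] at h'
  rwa [show Nat.sub (z + y) y = z from Nat.add_sub_cancel z y] at h'

theorem half_sound {n z : ℕ} {f : ℕ → Bool} (h : force (half n) f = true) (hz : n = 2 * z) : f z = true := by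
  subst hz
  rw [force_eq] at h
  rwa [show half (2 * z) = z from Nat.mul_div_cancel_left z two_pos] at h

theorem cellCheck_sound {f : ℕ → ℕ → ℕ → ℕ → ℕ → ℕ → ℕ → ℕ → Bool} {A B bc C bd cd : ℕ}
    (h : cellCheck f A B bc C bd cd = true) {c0 c1 c2 c3 c4 c5 c6 c7 : ℕ}
    (hA : A = c4 + c5 + c6 + c7) (hB : B = c2 + c3 + c6 + c7) (hC : C = c1 + c3 + c5 + c7)
    (hbc : bc = c2 + c3 + c4 + c5) (hbd : bd = c1 + c3 + c4 + c6) (hcd : cd = c1 + c2 + c5 + c6)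
    (ht : c0 + c1 + c2 + c3 + c4 + c5 + c6 + c7 = 18) : f c0 c1 c2 c3 c4 c5 c6 c7 = true := by
  unfold cellCheck at h
  simp only [Nat.add_eq] at h
  have h1 := subb_sound (z := 2 * (c6 + c7)) h (by omega)
  have h2 := subb_sound (z := 2 * (c5 + c7)) h1 (by omega)
  have h3 := subb_sound (z := 2 * (c3 + c7)) h2 (by omega)
  have h4 := half_sound h3 rfl
  have h5 := half_sound h4 rfl
  have h6 := half_sound h5 rfl
  have h7 := upto_sound h6 (Nat.le_add_left c7 c6)
  have h8 := subb_sound h7 rfl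
  have h9 := subb_sound h8 rfl
  have h10 := subb_sound h9 rfl
  have h11 := subb_sound (z := c4) h10 (by omega)
  have h12 := subb_sound (z := c2) h11 (by omega)
  have h13 := subb_sound (z := c1) h12 (by omega)
  exact subb_sound (z := c0) h13 (by omega)

/-- The distance key of a quadruple. -/
def key (a b c d : Word) : ℕ :=
  keyN (hammingDist a b) (hammingDist a c) (hammingDist b c) (hammingDist a d) (hammingDist b d)
    (hammingDist c d)

theorem minimalKey_of {a b c d e f : ℕ} (h1 : keyN a b c d e f ≤ keyN a c b e d f)
    (h2 : keyN a b c d e f ≤ keyN c b a f e d) (h3 : keyN a b c d e f ≤ keyN e f c d a b)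
    (h4 : keyN a b c d e f ≤ keyN b a c d f e) (h5 : keyN a b c d e f ≤ keyN d b f a e c)
    (h6 : keyN a b c d e f ≤ keyN a d e b c f) (h7 : keyN a b c d e f ≤ keyN a e d c b f) :
    minimalKey a b c d e f = true := by
  unfold minimalKey
  rw [force_eq, Nat.ble_eq_true_of_le h1, Nat.ble_eq_true_of_le h2, Nat.ble_eq_true_of_le h3,
    Nat.ble_eq_true_of_le h4, Nat.ble_eq_true_of_le h5, Nat.ble_eq_true_of_le h6]
  exact Nat.ble_eq_true_of_le h7

theorem keyN_eq (a b c d e f : ℕ) :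
    keyN a b c d e f = f + 32 * (e + 32 * (d + 32 * (c + 32 * (b + 32 * a)))) := rfl

theorem lt_of_mem_dists {x : ℕ} (h : x ∈ dists) : x < 32 := by
  simp only [dists, List.mem_cons, List.not_mem_nil, or_false] at h
  omega

/-- Admissible pairs of distinct codewords. -/
def Adm (a b : Word) : Prop := hammingDist a b ∈ dists

theorem Adm.symm {a b : Word} (h : Adm a b) : Adm b a := by
  unfold Adm
  rwa [hammingDist_comm]

theorem bW_nonpos_of_minimal (hq : quadAll = true) {a b c d : Word} (hab : Adm a b) (hac : Adm a c)
    (hbc : Adm b c) (had : Adm a d) (hbd : Adm b d) (hcd : Adm c d)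
    (h1 : key a b c d ≤ key b a c d) (h2 : key a b c d ≤ key c b a d) (h3 : key a b c d ≤ key d b c a)
    (h4 : key a b c d ≤ key a c b d) (h5 : key a b c d ≤ key a d c b) (h6 : key a b c d ≤ key a b d c)
    (h7 : key a b c d ≤ key b a d c) (h8 : key a b c d ≤ key c d a b) : bW a b c d ≤ 0 := by
  unfold key at *
  rw [hammingDist_comm b a] at h1 h7
  rw [hammingDist_comm c b, hammingDist_comm c a, hammingDist_comm b a] at h2
  rw [hammingDist_comm d b, hammingDist_comm d c, hammingDist_comm d a, hammingDist_comm b a,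
    hammingDist_comm c a] at h3
  rw [hammingDist_comm c b] at h4
  rw [hammingDist_comm d c, hammingDist_comm d b, hammingDist_comm c b] at h5
  rw [hammingDist_comm d c] at h6 h7
  rw [hammingDist_comm c a, hammingDist_comm d a, hammingDist_comm c b, hammingDist_comm d b] at h8
  have hm := minimalKey_of h1 h2 h3 h4 h5 h6 h7
  rw [keyN_eq, keyN_eq] at h1 h2 h3 h4 h5 h6 h7 h8
  have l1 := lt_of_mem_dists hab
  have l2 := lt_of_mem_dists hac
  have l3 := lt_of_mem_dists hbc
  have l4 := lt_of_mem_dists had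
  have l5 := lt_of_mem_dists hbd
  have l6 := lt_of_mem_dists hcd
  have g := allL_sound hq hab
  have g := imp_sound (allL_sound g hac) (Nat.ble_eq_true_of_le (by omega))
  have g := imp_sound (allL_sound g hbc) (Nat.ble_eq_true_of_le (by omega))
  have g := imp_sound (allL_sound g had) (Nat.ble_eq_true_of_le (by omega))
  have g := imp_sound (allL_sound g hbd) (Nat.ble_eq_true_of_le (by omega))
  have g := imp_sound (allL_sound g hcd) (Nat.ble_eq_true_of_le (by omega))
  have g := imp_sound g hm
  obtain ⟨e1, e2, e3, e4, e5, e6, e7⟩ := cnt_dist a b c d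
  have g := cellCheck_sound g e1 e2 e3 e4 e5 e6 e7
  exact nonposN_sound g (bN_cast a b c d) ((bW_abs_le a b c d).trans (by norm_num))

theorem bW_nonpos (hq : quadAll = true) {a b c d : Word} (hab : Adm a b) (hac : Adm a c)
    (hbc : Adm b c) (had : Adm a d) (hbd : Adm b d) (hcd : Adm c d) : bW a b c d ≤ 0 := by
  induction hn : key a b c d using Nat.strong_induction_on generalizing a b c d with
  | _ n ih =>
    subst hn
    rcases lt_or_ge (key b a c d) (key a b c d) with h1 | h1
    · have := ih _ h1 hab.symm hbc hac hbd had hcd rfl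
      rwa [bW_swap_ab] at this
    rcases lt_or_ge (key c b a d) (key a b c d) with h2 | h2
    · have := ih _ h2 hbc.symm hac.symm hab.symm hcd hbd had rfl
      rwa [bW_swap_ab, bW_swap_bc, bW_swap_ab] at this
    rcases lt_or_ge (key d b c a) (key a b c d) with h3 | h3
    · have := ih _ h3 hbd.symm hcd.symm hbc had.symm hab.symm hac.symm rfl
      rwa [bW_swap_ab, bW_swap_bc, bW_swap_cd, bW_swap_bc, bW_swap_ab] at this
    rcases lt_or_ge (key a c b d) (key a b c d) with h4 | h4
    · have := ih _ h4 hac hab hbc.symm had hcd hbd rfl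
      rwa [bW_swap_bc] at this
    rcases lt_or_ge (key a d c b) (key a b c d) with h5 | h5
    · have := ih _ h5 had hac hcd.symm hab hbd.symm hbc.symm rfl
      rwa [bW_swap_bc, bW_swap_cd, bW_swap_bc] at this
    rcases lt_or_ge (key a b d c) (key a b c d) with h6 | h6
    · have := ih _ h6 hab had hbd hac hbc hcd.symm rfl
      rwa [bW_swap_cd] at this
    rcases lt_or_ge (key b a d c) (key a b c d) with h7 | h7
    · have := ih _ h7 hab.symm hbd had hbc hac hcd.symm rfl
      rwa [bW_swap_ab, bW_swap_cd] at this
    rcases lt_or_ge (key c d a b) (key a b c d) with h8 | h8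
    · have := ih _ h8 hcd hac.symm had.symm hbc.symm hbd.symm hab rfl
      rwa [bW_swap_bc, bW_swap_ab, bW_swap_cd, bW_swap_bc] at this
    exact bW_nonpos_of_minimal hq hab hac hbc had hbd hcd h1 h2 h3 h4 h5 h6 h7 h8

theorem atCells_aabc {f : ℕ → ℕ → ℕ → ℕ → ℕ → ℕ → ℕ → ℕ → ℕ} (a b c : Word) {c0 c1 c2 c3 : ℕ}
    (h1 : hammingDist a b = c2 + c3) (h2 : hammingDist a c = c1 + c3) (h3 : hammingDist b c = c1 + c2)
    (h4 : c0 + c1 + c2 + c3 = 18) : atCells f a a b c = f c0 c1 c2 c3 0 0 0 0 := by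
  obtain ⟨e1, e2, e3, -, -, e6, e7⟩ := cnt_dist a a b c
  rw [hammingDist_self] at e1
  unfold atCells
  congr 1 <;> omega

theorem bW_triple_nonpos (ht : tripleAll = true) {a b c : Word} (hab : Adm a b) (hac : Adm a c)
    (hbc : Adm b c) : bW a a b c + bW b b a c + bW c c a b ≤ 0 := by
  obtain ⟨e1, e2, e3, -, -, e6, e7⟩ := cnt_dist a a b c
  rw [hammingDist_self] at e1
  generalize cnt a a b c false false false = c0 at *
  generalize cnt a a b c false false true = c1 at *
  generalize cnt a a b c false true false = c2 at *
  generalize cnt a a b c false true true = c3 at *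
  have g := allL_sound ht hab
  have g := allL_sound g hac
  have g := allL_sound g hbc
  have g := subb_sound (z := 2 * c3) g (by simp only [Nat.add_eq]; omega)
  have g := half_sound g rfl
  have g := subb_sound (z := c1) g (by omega)
  have g := subb_sound (z := c2) g (by omega)
  have g := subb_sound (z := c0) g (by simp only [Nat.add_eq]; omega)
  have p1 := bN_cast a a b c
  have p2 := bN_cast b b a c
  have p3 := bN_cast c c a b
  rw [atCells_aabc (c0 := c0) (c1 := c1) (c2 := c2) (c3 := c3) a b c (by omega) (by omega) (by omega)
    (by omega)] at p1
  rw [atCells_aabc (c0 := c0) (c1 := c1) (c2 := c3) (c3 := c2) b a c (by rw [hammingDist_comm]; omega)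
    (by omega) (by omega) (by omega)] at p2
  rw [atCells_aabc (c0 := c0) (c1 := c2) (c2 := c3) (c3 := c1) c a b (by rw [hammingDist_comm]; omega)
    (by rw [hammingDist_comm]; omega) (by omega) (by omega)] at p3
  have b1 := abs_le.1 (bW_abs_le a a b c)
  have b2 := abs_le.1 (bW_abs_le b b a c)
  have b3 := abs_le.1 (bW_abs_le c c a b)
  refine nonposN_sound g ?_ (abs_le.2 ⟨?_, ?_⟩)
  · simp only [Nat.add_eq]
    push_cast
    rw [p1, p2, p3]
    ring
  · have : (-2 ^ 300 : ℤ) ≤ 3 * -2 ^ 280 := by norm_num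
    linarith
  · have : 3 * 2 ^ 280 ≤ (2 ^ 300 : ℤ) := by norm_num
    linarith

theorem bW_pair_le (hp : pairAll = true) {a b : Word} (hab : Adm a b) :
    4 * bW a a a b + 3 * bW a a b b + (pairGap : ℤ) ≤ 0 := by
  have g := allL_sound hp hab
  unfold pairLeaf at g
  rw [force_eq] at g
  have h1 := (hammingDist_le_card_fintype : hammingDist a b ≤ Fintype.card (Fin 18))
  rw [Fintype.card_fin] at h1
  have p1 := bN_cast a a a b
  have p2 := bN_cast a a b b
  rw [atCells_aabc (c0 := Nat.sub 18 (hammingDist a b)) (c1 := hammingDist a b) (c2 := 0) (c3 := 0) a a b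
    (by rw [hammingDist_self]) (by omega) (by omega) (by simp only [Nat.sub_eq]; omega)] at p1
  rw [atCells_aabc (c0 := Nat.sub 18 (hammingDist a b)) (c1 := 0) (c2 := 0) (c3 := hammingDist a b) a b b
    (by omega) (by omega) (by rw [hammingDist_self]) (by simp only [Nat.sub_eq]; omega)] at p2
  have b1 := abs_le.1 (bW_abs_le a a a b)
  have b2 := abs_le.1 (bW_abs_le a a b b)
  refine nonposN_sound g ?_ (abs_le.2 ⟨?_, ?_⟩)
  · simp only [Nat.add_eq, Nat.mul_eq]
    push_cast
    rw [p1, p2]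
  · have : (-2 ^ 300 : ℤ) ≤ 7 * -2 ^ 280 + (pairGap : ℤ) := by norm_num [pairGap]
    linarith
  · have : 7 * 2 ^ 280 + (pairGap : ℤ) ≤ (2 ^ 300 : ℤ) := by norm_num [pairGap]
    linarith

theorem bW_diag_le (hd : diagCheck = true) (a : Word) :
    bW a a a a - 673 * (pairGap : ℤ) + 1 ≤ 0 := by
  have p1 := bN_cast a a a a
  rw [atCells_aabc (c0 := 18) (c1 := 0) (c2 := 0) (c3 := 0) a a a
    (by rw [hammingDist_self]) (by rw [hammingDist_self]) (by rw [hammingDist_self]) rfl] at p1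
  have b1 := abs_le.1 (bW_abs_le a a a a)
  unfold diagCheck at hd
  refine nonposN_sound hd ?_ (abs_le.2 ⟨?_, ?_⟩)
  · simp only [Nat.add_eq, Nat.mul_eq]
    push_cast
    rw [p1, cast_sub_one]
    ring
  · have : (-2 ^ 300 : ℤ) ≤ -2 ^ 280 - 673 * (pairGap : ℤ) + 1 := by norm_num [pairGap]
    linarith
  · have : 2 ^ 280 - 673 * (pairGap : ℤ) + 1 ≤ (2 ^ 300 : ℤ) := by norm_num [pairGap]
    linarith

section Decomposition

variable {ι : Type*} [DecidableEq ι]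

def distinctTriple (F : ι → ι → ι → ι → ℤ) (a b c : ι) : ℤ :=
  if a ≠ b ∧ a ≠ c ∧ b ≠ c then F a a b c else 0

theorem le_sum_coincidences {F : ι → ι → ι → ι → ℤ} (hab : ∀ a b c d, F b a c d = F a b c d)
    (hbc : ∀ a b c d, F a c b d = F a b c d) (hcd : ∀ a b c d, F a b d c = F a b c d)
    (h4 : ∀ a b c d, a ≠ b → a ≠ c → b ≠ c → a ≠ d → b ≠ d → c ≠ d → F a b c d ≤ 0) (a b c d : ι) :
    F a b c d ≤
      (if a = b then distinctTriple F a c d else 0) + (if a = c then distinctTriple F a b d else 0)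
      + (if b = c then distinctTriple F b a d else 0) + (if a = d then distinctTriple F a b c else 0)
      + (if b = d then distinctTriple F b a c else 0) + (if c = d then distinctTriple F c a b else 0)
      + (if a = b then if c = d then if a ≠ c then F a a c c else 0 else 0 else 0)
      + (if a = c then if b = d then if a ≠ b then F a a b b else 0 else 0 else 0)
      + (if b = c then if a = d then if a ≠ b then F a a b b else 0 else 0 else 0)
      + (if a = b then if a = c then if a ≠ d then F a a a d else 0 else 0 else 0)
      + (if a = b then if a = d then if a ≠ c then F a a a c else 0 else 0 else 0)
      + (if a = c then if a = d then if a ≠ b then F a a a b else 0 else 0 else 0)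
      + (if b = c then if b = d then if b ≠ a then F b b b a else 0 else 0 else 0)
      + (if a = b then if a = c then if a = d then F a a a a else 0 else 0 else 0) := by
  unfold distinctTriple
  by_cases e1 : a = b
  · subst e1
    by_cases e2 : a = c
    · subst e2
      by_cases e3 : a = d
      · subst e3; simp
      · simp [e3]
    · by_cases e3 : a = d
      · subst e3; simp [e2, Ne.symm e2, hcd]
      · by_cases e4 : c = d
        · subst e4; simp [e2, Ne.symm e2]
        · simp [e2, e3, e4]
  · by_cases e2 : a = c
    · subst e2
      by_cases e3 : a = d
      · subst e3; simp [e1, Ne.symm e1, hbc, hcd]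
      · by_cases e4 : b = d
        · subst e4; simp [e1, Ne.symm e1, hbc]
        · simp [e1, e3, e4, Ne.symm e1, hbc]
    · by_cases e5 : b = c
      · subst e5
        by_cases e3 : a = d
        · subst e3; simp [e1, Ne.symm e1, hbc a a b b, hcd a b a b]
        · by_cases e4 : b = d
          · subst e4; simp [e1, Ne.symm e1, ← hab a b b b, ← hbc b a b b, ← hcd b b a b]
          · simp [e1, e3, e4, Ne.symm e1, ← hab a b b d, ← hbc b a b d]
      · by_cases e3 : a = d
        · subst e3; simp [e1, e2, e5, Ne.symm e1, Ne.symm e2, hbc a a b c, hcd a b a c]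
        · by_cases e4 : b = d
          · subst e4; simp [e1, e2, e5, Ne.symm e1, Ne.symm e5, ← hab a b c b, ← hbc b a c b, ← hcd b c a b]
            rw [hbc, hcd, hbc]
          · by_cases e6 : c = d
            · subst e6
              simp [e1, e2, e5, Ne.symm e2, Ne.symm e5]
              rw [← hbc a b c c, hab, ← hcd, hbc]
            · simpa [e1, e2, e3, e4, e5, e6] using h4 a b c d e1 e2 e5 e3 e4 e6

theorem sum_distinctTriple_rotate [Fintype ι] (F : ι → ι → ι → ι → ℤ) :
    ∑ a, ∑ b, ∑ c, distinctTriple F c a b = ∑ a, ∑ b, ∑ c, distinctTriple F a b c := by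
  rw [Finset.sum_congr rfl fun a _ => Finset.sum_comm]
  exact Finset.sum_comm

theorem sum_distinctTriple_nonpos [Fintype ι] {F : ι → ι → ι → ι → ℤ}
    (h3 : ∀ a b c, a ≠ b → a ≠ c → b ≠ c → F a a b c + F b b a c + F c c a b ≤ 0) :
    ∑ a, ∑ b, ∑ c, distinctTriple F a b c ≤ 0 := by
  have r1 : ∑ a, ∑ b, ∑ c, distinctTriple F b a c = ∑ a, ∑ b, ∑ c, distinctTriple F a b c :=
    Finset.sum_comm
  have r2 := sum_distinctTriple_rotate F
  have r3 : ∑ a, ∑ b, ∑ c, (distinctTriple F a b c + distinctTriple F b a c + distinctTriple F c a b) ≤ 0 := by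
    refine Finset.sum_nonpos fun a _ => Finset.sum_nonpos fun b _ => Finset.sum_nonpos fun c _ => ?_
    unfold distinctTriple
    by_cases h : a ≠ b ∧ a ≠ c ∧ b ≠ c
    · obtain ⟨x, y, z⟩ := h
      simpa [x, y, z, x.symm, y.symm, z.symm] using h3 a b c x y z
    · rw [if_neg h, if_neg (by tauto), if_neg (by tauto)]
      simp
  simp only [Finset.sum_add_distrib] at r3
  linarith

theorem sum_le_of_distinct_nonpos [Fintype ι] {F : ι → ι → ι → ι → ℤ} (hab : ∀ a b c d, F b a c d = F a b c d)
    (hbc : ∀ a b c d, F a c b d = F a b c d) (hcd : ∀ a b c d, F a b d c = F a b c d)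
    (h4 : ∀ a b c d, a ≠ b → a ≠ c → b ≠ c → a ≠ d → b ≠ d → c ≠ d → F a b c d ≤ 0)
    (h3 : ∀ a b c, a ≠ b → a ≠ c → b ≠ c → F a a b c + F b b a c + F c c a b ≤ 0) :
    ∑ a, ∑ b, ∑ c, ∑ d, F a b c d ≤
      ∑ a, ∑ b, (if a ≠ b then 4 * F a a a b + 3 * F a a b b else 0) + ∑ a, F a a a a := by
  refine (Finset.sum_le_sum fun a _ => Finset.sum_le_sum fun b _ => Finset.sum_le_sum fun c _ =>
    Finset.sum_le_sum fun d _ => le_sum_coincidences hab hbc hcd h4 a b c d).trans ?_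
  have t := sum_distinctTriple_nonpos h3
  have k : ∑ a, ∑ b, (if a ≠ b then 4 * F a a a b + 3 * F a a b b else 0)
    = 4 * ∑ a, ∑ b, (if a ≠ b then F a a a b else 0) + 3 * ∑ a, ∑ b, (if a ≠ b then F a a b b else 0) := by
    simp only [Finset.mul_sum, ← Finset.sum_add_distrib]
    refine Finset.sum_congr rfl fun a _ => Finset.sum_congr rfl fun b _ => ?_
    split <;> simp
  rw [k]
  simp only [Finset.sum_add_distrib, Finset.sum_ite_irrel, Finset.sum_const_zero, Finset.sum_ite_eq,
    Finset.mem_univ, if_true]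
  have r2 : ∑ a, ∑ b, ∑ c, distinctTriple F b a c = ∑ a, ∑ b, ∑ c, distinctTriple F a b c :=
    Finset.sum_comm
  have r3 : ∑ a, ∑ b, (if b ≠ a then F b b b a else 0) = ∑ a, ∑ b, (if a ≠ b then F a a a b else 0) :=
    Finset.sum_comm
  rw [r2, r3, sum_distinctTriple_rotate]
  linarith

end Decomposition

theorem card_le_of_adm {C : Finset Word} (hC : ∀ a ∈ C, ∀ b ∈ C, a ≠ b → Adm a b)
    (hq : quadAll = true) (ht : tripleAll = true) (hp : pairAll = true) (hd : diagCheck = true) :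
    C.card ≤ 673 := by
  have key := sum_le_of_distinct_nonpos (ι := C) (F := fun a b c d => bW a b c d)
    (fun a b c d => bW_swap_ab ..) (fun a b c d => bW_swap_bc ..) (fun a b c d => bW_swap_cd ..)
    (fun a b c d h1 h2 h3 h4 h5 h6 => by
      have adm (x y : C) (h : x ≠ y) : Adm x y := hC x x.2 y y.2 (Subtype.coe_ne_coe.2 h)
      exact bW_nonpos hq (adm _ _ h1) (adm _ _ h2) (adm _ _ h3) (adm _ _ h4) (adm _ _ h5) (adm _ _ h6))
    (fun a b c h1 h2 h3 => by
      have adm (x y : C) (h : x ≠ y) : Adm x y := hC x x.2 y y.2 (Subtype.coe_ne_coe.2 h)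
      exact bW_triple_nonpos ht (adm _ _ h1) (adm _ _ h2) (adm _ _ h3))
  have pos := sum_bW_nonneg C
  have conv : ∑ a : C, ∑ b : C, ∑ c : C, ∑ d : C, bW a b c d = ∑ a ∈ C, ∑ b ∈ C, ∑ c ∈ C, ∑ d ∈ C, bW a b c d := by
    simp only [← Finset.sum_coe_sort C]
  rw [← conv] at pos
  have pairs : ∑ a : C, ∑ b : C, (if a ≠ b then 4 * bW a a a b + 3 * bW a a b b else 0)
      ≤ ∑ a : C, ∑ b : C, ((if a = b then (pairGap : ℤ) else 0) - pairGap) := by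
    refine Finset.sum_le_sum fun a _ => Finset.sum_le_sum fun b _ => ?_
    by_cases h : a = b
    · simp [h]
    · have := bW_pair_le hp (hC a a.2 b b.2 (Subtype.coe_ne_coe.2 h))
      rw [if_pos h, if_neg h]
      linarith
  have diag : ∑ a : C, bW a a a a ≤ ∑ _a : C, (673 * (pairGap : ℤ) - 1) :=
    Finset.sum_le_sum fun a _ => by linarith [bW_diag_le hd a]
  simp only [Finset.sum_sub_distrib, Finset.sum_ite_eq, Finset.mem_univ, if_true, Finset.sum_const,
    Finset.card_univ, Fintype.card_coe, nsmul_eq_mul] at pairs diag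
  by_contra! hlt
  have hg : (0 : ℤ) ≤ pairGap := Nat.cast_nonneg _
  generalize (pairGap : ℤ) = k at *
  have hM : (674 : ℤ) ≤ C.card := by exact_mod_cast hlt
  have : (C.card : ℤ) * (k * (674 - C.card) - 1) ≥ 0 := by linarith
  nlinarith [mul_nonneg hg (sub_nonneg.2 hM)]

/-- The number of ones among the first seventeen coordinates. -/
def initWeight (u : Word) : ℕ := ∑ i : Fin 17, (u i.castSucc).toNat

/-- Replaces the last coordinate by the parity of the others. -/
def evenize (u : Word) : Word :=
  fun i => if i = Fin.last 17 then decide (initWeight u % 2 = 1) else u i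

theorem hammingDist_eq_init_add_last (u v : Word) : hammingDist u v =
    ∑ i : Fin 17, (if u i.castSucc ≠ v i.castSucc then 1 else 0)
      + if u (Fin.last 17) ≠ v (Fin.last 17) then 1 else 0 := by
  rw [hammingDist, Finset.card_filter, Fin.sum_univ_castSucc]

theorem initWeight_add (u v : Word) : initWeight u + initWeight v =
    ∑ i : Fin 17, (if u i.castSucc ≠ v i.castSucc then 1 else 0)
      + 2 * ∑ i : Fin 17, (u i.castSucc && v i.castSucc).toNat := by
  simp only [initWeight, Finset.mul_sum, ← Finset.sum_add_distrib]
  refine Finset.sum_congr rfl fun i _ => ?_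
  cases u i.castSucc <;> cases v i.castSucc <;> rfl

theorem adm_evenize {u v : Word} (h : 6 ≤ hammingDist u v) : Adm (evenize u) (evenize v) := by
  have e := initWeight_add u v
  have d := hammingDist_eq_init_add_last (evenize u) (evenize v)
  have le : hammingDist (evenize u) (evenize v) ≤ Fintype.card (Fin 18) := hammingDist_le_card_fintype
  rw [hammingDist_eq_init_add_last] at h
  simp only [evenize, Fin.castSucc_ne_last, if_false, if_true] at d
  rw [Fintype.card_fin] at le
  unfold Adm
  generalize hammingDist (evenize u) (evenize v) = D at *
  generalize (∑ i : Fin 17, if u i.castSucc ≠ v i.castSucc then 1 else 0) = E at *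
  have h5 : 5 ≤ E := by
    split at h <;> omega
  have hD : D % 2 = 0 ∧ E ≤ D := by
    simp only [ne_eq, decide_eq_decide] at d
    split at d <;> omega
  have : D = 6 ∨ D = 8 ∨ D = 10 ∨ D = 12 ∨ D = 14 ∨ D = 16 ∨ D = 18 := by omega
  simpa [dists] using this

theorem card_le_of_six_le_hammingDist {C : Finset Word}
    (hC : ∀ u ∈ C, ∀ v ∈ C, u ≠ v → 6 ≤ hammingDist u v)
    (hq : quadAll = true) (ht : tripleAll = true) (hp : pairAll = true) (hd : diagCheck = true) :
    C.card ≤ 673 := by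
  have inj : Set.InjOn evenize C := by
    intro u hu v hv huv
    by_contra hne
    have h := adm_evenize (hC u hu v hv hne)
    rw [Adm, huv, hammingDist_self] at h
    simp [dists] at h
  rw [← Finset.card_image_of_injOn inj]
  refine card_le_of_adm ?_ hq ht hp hd
  simp only [Finset.mem_image]
  rintro _ ⟨u, hu, rfl⟩ _ ⟨v, hv, rfl⟩ huv
  exact adm_evenize (hC u hu v hv fun h => huv (h ▸ rfl))

section Checks

set_option maxRecDepth 100000

theorem quadAll_eq : quadAll = true := by decide +kernel

theorem tripleAll_eq : tripleAll = true := by decide +kernel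

theorem pairAll_eq : pairAll = true := by decide +kernel

theorem diagCheck_eq : diagCheck = true := by decide +kernel

end Checks

end CodeBound

/-- `A(18,6) ≤ 673`: every binary code of length 18 in which any two distinct
codewords have Hamming distance at least 6 has at most 673 codewords. -/
theorem A_18_6_le_673 (C : Finset (Fin 18 → Bool))
    (hC : ∀ u ∈ C, ∀ v ∈ C, u ≠ v → 6 ≤ hammingDist u v) :
    C.card ≤ 673 :=
  CodeBound.card_le_of_six_le_hammingDist hC CodeBound.quadAll_eq CodeBound.tripleAll_eq
    CodeBound.pairAll_eq CodeBound.diagCheck_eq
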